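/- Let 0 < l < 2π and let λ₊, λ₋ ≥ 0 with λ₊ ≠ λ₋. Let u be a minimizer of J(C_1, λ₊, λ₋) on the cone of length l. Then the vertex does not belong to the free boundary: there exists ε ∈ (0,1) such that either u > 0 everywhere on C_ε, or u < 0 everywhere on C_ε, or u ≡ 0 on C_ε. -/

import Mathlib

open MeasureTheory Set

noncomputable section

/-- The cone distance on the cone of length `l`, in polar coordinates:
`d((r,θ),(s,φ)) = sqrt(r² + s² − 2 r s cos(min(δ, π)))` with
`δ = min_{k ∈ ℤ} |θ − φ + k l|`. -/
def coneDist (l : ℝ) (p q : ℝ × ℝ) : ℝ :=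
  Real.sqrt (p.1 ^ 2 + q.1 ^ 2 -
    2 * p.1 * q.1 * Real.cos (min (⨅ k : ℤ, |p.2 - q.2 + (k : ℝ) * l|) Real.pi))

/-- A Lipschitz function on the cone ball `C_R` of the cone of length `l`, given in
polar coordinates: `l`-periodic in `θ` and Lipschitz for the cone distance (this forces
a well-defined vertex value `u 0 _` and continuity at the vertex). -/
structure ConeLip (l R : ℝ) (u : ℝ → ℝ → ℝ) : Prop where
  periodic : ∀ r θ : ℝ, u r (θ + l) = u r θ
  lipschitz : ∃ K : ℝ, ∀ p q : ℝ × ℝ, p.1 ∈ Set.Icc 0 R → q.1 ∈ Set.Icc 0 R →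
    |u p.1 p.2 - u q.1 q.2| ≤ K * coneDist l p q

/-- The squared cone gradient `|Du|² = (∂_r u)² + (∂_θ u)²/r²` at a polar point,
computed from Lean's a.e.-defined derivatives. -/
def gradSq (u : ℝ → ℝ → ℝ) (p : ℝ × ℝ) : ℝ :=
  (deriv (fun s => u s p.2) p.1) ^ 2 + (deriv (fun φ => u p.1 φ) p.2) ^ 2 / p.1 ^ 2

/-- The two-phase functional
`J(u, C_R) = ∫_{C_R} |Du|² + λ₊ area({u > 0} ∩ C_R) + λ₋ area({u < 0} ∩ C_R)`,
computed in polar coordinates with area measure `r dr dθ`, `θ` ranging over `(0, l)`. -/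
def Jfun (l lp lm : ℝ) (u : ℝ → ℝ → ℝ) (R : ℝ) : ℝ :=
  ∫ p in Set.Ioo (0:ℝ) R ×ˢ Set.Ioo (0:ℝ) l,
    (gradSq u p + (if 0 < u p.1 p.2 then lp else 0)
      + (if u p.1 p.2 < 0 then lm else 0)) * p.1

/-- The Dirichlet energy `∫_{C_R} |Du|²` with respect to the area measure `r dr dθ`. -/
def Dir (l : ℝ) (u : ℝ → ℝ → ℝ) (R : ℝ) : ℝ :=
  ∫ p in Set.Ioo (0:ℝ) R ×ˢ Set.Ioo (0:ℝ) l, gradSq u p * p.1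

/-- `u` is a minimizer of `J(C_R, λ₊, λ₋)` on the cone of length `l`: a cone Lipschitz
function beating every cone Lipschitz competitor with the same boundary values on
`{r = R}`. -/
def IsMinimizerJ (l lp lm R : ℝ) (u : ℝ → ℝ → ℝ) : Prop :=
  ConeLip l R u ∧ ∀ w : ℝ → ℝ → ℝ, ConeLip l R w → (∀ θ : ℝ, w R θ = u R θ) →
    Jfun l lp lm u R ≤ Jfun l lp lm w R

section

open MeasureTheory Set

/-- Globally defined Lipschitz functions in polar coordinates. -/
structure PLip (l K : ℝ) (u : ℝ → ℝ → ℝ) : Prop where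
  per : ∀ r θ : ℝ, u r (θ + l) = u r θ
  rad : ∀ r s θ : ℝ, |u r θ - u s θ| ≤ K * |r - s|
  ang : ∀ r θ φ : ℝ, |u r θ - u r φ| ≤ K * |r| * |θ - φ|

/-- The density of the functional. -/
def den (lp lm : ℝ) (u : ℝ → ℝ → ℝ) (p : ℝ × ℝ) : ℝ :=
  gradSq u p + (if 0 < u p.1 p.2 then lp else 0) + (if u p.1 p.2 < 0 then lm else 0)

/-- The region of integration. -/
def Om (l R : ℝ) : Set (ℝ × ℝ) := Set.Ioo (0:ℝ) R ×ˢ Set.Ioo (0:ℝ) l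

lemma Jfun_eq (l lp lm : ℝ) (u : ℝ → ℝ → ℝ) (R : ℝ) :
    Jfun l lp lm u R = ∫ p in Om l R, den lp lm u p * p.1 := rfl

lemma measurableSet_Om (l R : ℝ) : MeasurableSet (Om l R) :=
  measurableSet_Ioo.prod measurableSet_Ioo

lemma volume_Om_lt_top (l R : ℝ) : volume (Om l R) < ⊤ := by
  rw [Om, Measure.volume_eq_prod, Measure.prod_prod, Real.volume_Ioo, Real.volume_Ioo]
  exact ENNReal.mul_lt_top ENNReal.ofReal_lt_top ENNReal.ofReal_lt_top

lemma intOn_Om {l R C : ℝ} {F : ℝ × ℝ → ℝ} (hF : Measurable F)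
    (hC : ∀ p ∈ Om l R, |F p| ≤ C) : IntegrableOn F (Om l R) :=
  IntegrableOn.of_bound (volume_Om_lt_top l R) hF.aestronglyMeasurable C
    ((ae_restrict_iff' (measurableSet_Om l R)).2 (Filter.Eventually.of_forall hC))

lemma fub_rt {l R : ℝ} (hl : 0 ≤ l) (hR : 0 ≤ R) {F : ℝ × ℝ → ℝ} (hF : IntegrableOn F (Om l R)) :
    ∫ p in Om l R, F p = ∫ r in (0:ℝ)..R, ∫ θ in (0:ℝ)..l, F (r, θ) := by
  rw [Om, Measure.volume_eq_prod, setIntegral_prod F hF, intervalIntegral.integral_of_le hR,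
    integral_Ioc_eq_integral_Ioo]
  refine setIntegral_congr_fun measurableSet_Ioo fun r _ => ?_
  rw [intervalIntegral.integral_of_le hl, integral_Ioc_eq_integral_Ioo]

lemma fub_tr {l R : ℝ} (hl : 0 ≤ l) (hR : 0 ≤ R) {F : ℝ × ℝ → ℝ} (hF : IntegrableOn F (Om l R)) :
    ∫ p in Om l R, F p = ∫ θ in (0:ℝ)..l, ∫ r in (0:ℝ)..R, F (r, θ) := by
  rw [Om, Measure.volume_eq_prod, ← setIntegral_prod_swap, setIntegral_prod, 
    intervalIntegral.integral_of_le hl, integral_Ioc_eq_integral_Ioo]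
  · refine setIntegral_congr_fun measurableSet_Ioo fun r _ => ?_
    rw [intervalIntegral.integral_of_le hR, integral_Ioc_eq_integral_Ioo]
    rfl
  · exact hF.swap

lemma lip_of {K : ℝ} {f : ℝ → ℝ} (h : ∀ x y, |f x - f y| ≤ K * |x - y|) :
    LipschitzWith K.toNNReal f := by
  refine LipschitzWith.of_dist_le_mul fun x y => ?_
  rw [Real.dist_eq, Real.dist_eq]
  exact (h x y).trans (mul_le_mul_of_nonneg_right (Real.le_coe_toNNReal K) (abs_nonneg _))

lemma deriv_le_of {K : ℝ} (hK : 0 ≤ K) {f : ℝ → ℝ} (h : ∀ x y, |f x - f y| ≤ K * |x - y|) (x : ℝ) :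
    |deriv f x| ≤ K := by
  have := norm_deriv_le_of_lipschitz (lip_of h) (x₀ := x)
  rwa [Real.coe_toNNReal _ hK, Real.norm_eq_abs] at this

lemma lip_ac {K : ℝ} {f : ℝ → ℝ} (h : ∀ x y, |f x - f y| ≤ K * |x - y|) (a b : ℝ) :
    AbsolutelyContinuousOnInterval f a b :=
  ((lip_of h).lipschitzOnWith).absolutelyContinuousOnInterval

namespace PLip

variable {l K : ℝ} {u : ℝ → ℝ → ℝ}

lemma K_nonneg (h : PLip l K u) : 0 ≤ K := by
  have := h.rad 1 0 0
  have h2 := abs_nonneg (u 1 0 - u 0 0)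
  simp at this; linarith

lemma cont (h : PLip l K u) : Continuous (fun p : ℝ × ℝ => u p.1 p.2) := by
  have hK := h.K_nonneg
  rw [continuous_iff_continuousAt]
  intro p
  rw [ContinuousAt, tendsto_iff_dist_tendsto_zero]
  have hb : ∀ q : ℝ × ℝ, dist (u q.1 q.2) (u p.1 p.2) ≤ K * |q.1 - p.1| + K * |p.1| * |q.2 - p.2| := by
    intro q
    rw [Real.dist_eq]
    have := h.rad q.1 p.1 q.2
    have := h.ang p.1 q.2 p.2
    have := abs_sub_le (u q.1 q.2) (u p.1 q.2) (u p.1 p.2)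
    linarith
  refine squeeze_zero (fun _ => dist_nonneg) hb ?_
  have : Continuous fun q : ℝ × ℝ => K * |q.1 - p.1| + K * |p.1| * |q.2 - p.2| := by fun_prop
  have := this.tendsto p
  simpa using this

lemma cont_r (h : PLip l K u) (θ : ℝ) : Continuous (fun s => u s θ) :=
  h.cont.comp (by fun_prop : Continuous fun s : ℝ => (s, θ))
lemma cont_t (h : PLip l K u) (r : ℝ) : Continuous (fun φ => u r φ) :=
  h.cont.comp (by fun_prop : Continuous fun s : ℝ => (r, s))

lemma meas (h : PLip l K u) : Measurable (fun p : ℝ × ℝ => u p.1 p.2) := h.cont.measurable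

lemma meas_dt (h : PLip l K u) : Measurable (fun p : ℝ × ℝ => deriv (fun φ => u p.1 φ) p.2) :=
  measurable_deriv_with_param (f := fun r φ => u r φ) h.cont

lemma meas_dr (h : PLip l K u) : Measurable (fun p : ℝ × ℝ => deriv (fun s => u s p.2) p.1) := by
  have hc : Continuous (Function.uncurry (fun θ s => u s θ)) :=
    h.cont.comp continuous_swap
  exact (measurable_deriv_with_param hc).comp measurable_swap

lemma meas_gradSq (h : PLip l K u) : Measurable (gradSq u) := by
  unfold gradSq
  exact (h.meas_dr.pow_const 2).add ((h.meas_dt.pow_const 2).div (measurable_fst.pow_const 2))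

lemma meas_den (h : PLip l K u) (lp lm : ℝ) : Measurable (den lp lm u) := by
  unfold den
  exact (h.meas_gradSq.add (Measurable.ite (measurableSet_lt measurable_const h.meas)
    measurable_const measurable_const)).add (Measurable.ite (measurableSet_lt h.meas measurable_const)
    measurable_const measurable_const)

lemma dr_le (h : PLip l K u) (r θ : ℝ) : |deriv (fun s => u s θ) r| ≤ K :=
  deriv_le_of h.K_nonneg (fun x y => h.rad x y θ) r

lemma dt_le (h : PLip l K u) (r θ : ℝ) : |deriv (fun φ => u r φ) θ| ≤ K * |r| :=
  deriv_le_of (mul_nonneg h.K_nonneg (abs_nonneg r)) (fun x y => h.ang r x y) θ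

lemma gradSq_nonneg (u : ℝ → ℝ → ℝ) (p : ℝ × ℝ) : 0 ≤ gradSq u p := by
  unfold gradSq; positivity

lemma gradSq_le (h : PLip l K u) (p : ℝ × ℝ) : gradSq u p ≤ 2 * K ^ 2 := by
  unfold gradSq
  have h1 := sq_le_sq' (neg_le_of_abs_le (h.dr_le p.1 p.2)) (le_of_abs_le (h.dr_le p.1 p.2))
  have h2 := sq_le_sq' (neg_le_of_abs_le (h.dt_le p.1 p.2)) (le_of_abs_le (h.dt_le p.1 p.2))
  have : (deriv (fun φ => u p.1 φ) p.2) ^ 2 / p.1 ^ 2 ≤ K ^ 2 := by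
    rcases eq_or_ne p.1 0 with h0 | h0
    · rw [h0]; simp; positivity
    · rw [div_le_iff₀ (by positivity)]
      rw [mul_pow, sq_abs] at h2; exact h2
  linarith

lemma den_nonneg {lp lm : ℝ} (hlp : 0 ≤ lp) (hlm : 0 ≤ lm) (p : ℝ × ℝ) : 0 ≤ den lp lm u p := by
  unfold den
  have := gradSq_nonneg u p
  split_ifs <;> linarith

lemma den_le (h : PLip l K u) {lp lm : ℝ} (hlp : 0 ≤ lp) (hlm : 0 ≤ lm) (p : ℝ × ℝ) :
    den lp lm u p ≤ 2 * K ^ 2 + lp + lm := by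
  unfold den
  have := h.gradSq_le p
  split_ifs <;> linarith

lemma intOn (h : PLip l K u) {lp lm : ℝ} (hlp : 0 ≤ lp) (hlm : 0 ≤ lm) (R : ℝ) :
    IntegrableOn (fun p => den lp lm u p * p.1) (Om l R) := by
  refine intOn_Om (C := (2 * K ^ 2 + lp + lm) * R) ((h.meas_den lp lm).mul measurable_fst) ?_
  rintro p ⟨⟨h1, h2⟩, -⟩
  have h3 := den_nonneg (u := u) hlp hlm p
  have h4 := h.den_le hlp hlm p
  rw [abs_of_nonneg (mul_nonneg h3 h1.le)]
  exact mul_le_mul h4 h2.le h1.le (h3.trans h4)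

lemma ae_diff_r (h : PLip l K u) : ∀ᵐ p : ℝ × ℝ, DifferentiableAt ℝ (fun s => u s p.2) p.1 := by
  have hc : Continuous (Function.uncurry (fun θ s => u s θ)) :=
    h.cont.comp continuous_swap
  have hm := measurableSet_of_differentiableAt_with_param ℝ hc
  have : ∀ᵐ p : ℝ × ℝ, DifferentiableAt ℝ (fun s => u s p.1) p.2 := by
    rw [Measure.volume_eq_prod, Measure.ae_prod_iff_ae_ae hm]
    exact Filter.Eventually.of_forall fun θ => (lip_of fun x y => h.rad x y θ).ae_differentiableAt_real
  have hq : Measure.QuasiMeasurePreserving (Prod.swap : ℝ × ℝ → ℝ × ℝ) volume volume := by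
    rw [Measure.volume_eq_prod]
    exact Measure.measurePreserving_swap.quasiMeasurePreserving
  exact hq.ae this

lemma ae_diff_t (h : PLip l K u) : ∀ᵐ p : ℝ × ℝ, DifferentiableAt ℝ (fun φ => u p.1 φ) p.2 := by
  have hm := measurableSet_of_differentiableAt_with_param ℝ (f := fun r φ => u r φ) h.cont
  rw [Measure.volume_eq_prod, Measure.ae_prod_iff_ae_ae hm]
  exact Filter.Eventually.of_forall fun r => (lip_of fun x y => h.ang r x y).ae_differentiableAt_real

end PLip

end

section

open MeasureTheory Set

lemma coneDist_rad {l : ℝ} (r s θ : ℝ) : coneDist l (r, θ) (s, θ) ≤ |r - s| := by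
  have h0 : (⨅ k : ℤ, |θ - θ + (k : ℝ) * l|) = 0 := by
    apply le_antisymm
    · exact (ciInf_le ⟨0, by rintro _ ⟨k, rfl⟩; positivity⟩ (0:ℤ)).trans (by simp)
    · exact le_ciInf fun k => abs_nonneg _
  unfold coneDist
  simp only
  rw [h0, min_eq_left Real.pi_pos.le, Real.cos_zero, ← Real.sqrt_sq_eq_abs]
  apply le_of_eq; congr 1; ring

lemma coneDist_ang {l : ℝ} (r θ φ : ℝ) (hr : 0 ≤ r) :
    coneDist l (r, θ) (r, φ) ≤ r * |θ - φ| := by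
  have h1 : (⨅ k : ℤ, |θ - φ + (k : ℝ) * l|) ≤ |θ - φ| := by
    exact (ciInf_le ⟨0, by rintro _ ⟨k, rfl⟩; positivity⟩ (0:ℤ)).trans (by simp)
  have h2 : 0 ≤ (⨅ k : ℤ, |θ - φ + (k : ℝ) * l|) := le_ciInf fun k => abs_nonneg _
  unfold coneDist
  simp only
  set m := min (⨅ k : ℤ, |θ - φ + (k : ℝ) * l|) Real.pi with hm
  have hm0 : 0 ≤ m := le_min h2 Real.pi_pos.le
  have hm1 : m ≤ |θ - φ| := (min_le_left _ _).trans h1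
  have hc := Real.one_sub_sq_div_two_le_cos (x := m)
  apply Real.sqrt_le_iff.2
  refine ⟨by positivity, ?_⟩
  have h3 : m ^ 2 ≤ |θ - φ| ^ 2 := pow_le_pow_left₀ hm0 hm1 2
  have h4 : r ^ 2 * m ^ 2 ≤ r ^ 2 * |θ - φ| ^ 2 := mul_le_mul_of_nonneg_left h3 (sq_nonneg r)
  nlinarith [mul_le_mul_of_nonneg_left hc (sq_nonneg r)]

lemma PLip.per_int {l K : ℝ} {u : ℝ → ℝ → ℝ} (h : PLip l K u) (r θ : ℝ) (k : ℤ) :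
    u r (θ + k * l) = u r θ := by
  have : Function.Periodic (u r) l := fun x => h.per r x
  have := this.int_mul k θ
  simpa using this

lemma PLip.coneLip {l K R : ℝ} {u : ℝ → ℝ → ℝ} (hl0 : 0 < l) (hl : l < 2 * Real.pi)
    (h : PLip l K u) : ConeLip l R u := by
  refine ⟨h.per, K * (1 + Real.pi / 2), ?_⟩
  rintro ⟨r, θ⟩ ⟨s, φ⟩ ⟨hr, -⟩ ⟨hs, -⟩
  simp only at hr hs ⊢
  have hK := h.K_nonneg
  have hpi := Real.pi_pos
  set d := ⨅ k : ℤ, |θ - φ + (k : ℝ) * l| with hd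
  have hbdd : BddBelow (range fun k : ℤ => |θ - φ + (k : ℝ) * l|) :=
    ⟨0, by rintro _ ⟨k, rfl⟩; positivity⟩
  have hd0 : 0 ≤ d := le_ciInf fun k => abs_nonneg _
  have hdl : d ≤ l / 2 := by
    refine (ciInf_le hbdd (-round ((θ - φ) / l))).trans ?_
    have h1 := abs_sub_round ((θ - φ) / l)
    have h2 : θ - φ + ((-round ((θ - φ) / l) : ℤ) : ℝ) * l = l * ((θ - φ) / l - round ((θ - φ) / l)) := by
      push_cast; field_simp; ring
    rw [h2, abs_mul, abs_of_pos hl0]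
    nlinarith
  have hmin : min d Real.pi = d := min_eq_left (by linarith)
  set m := min r s with hmdef
  have hm0 : 0 ≤ m := le_min hr hs
  have key : |u r θ - u s φ| ≤ K * |r - s| + K * m * d := by
    rw [hd, Real.mul_iInf_of_nonneg (by positivity), ← sub_le_iff_le_add']
    refine le_ciInf fun k => ?_
    rw [sub_le_iff_le_add']
    rcases le_total r s with hrs | hrs
    · have hm' : m = |r| := by rw [hmdef, min_eq_left hrs, abs_of_nonneg hr]
      have h1 := h.rad r s φ
      have h2 := h.ang r (θ + k * l) φ
      rw [h.per_int, ← hm', show θ + k * l - φ = θ - φ + k * l by ring] at h2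
      have := abs_sub_le (u r θ) (u r φ) (u s φ)
      linarith
    · have hm' : m = |s| := by rw [hmdef, min_eq_right hrs, abs_of_nonneg hs]
      have h1 := h.rad r s θ
      have h2 := h.ang s (θ + k * l) φ
      rw [h.per_int, ← hm', show θ + k * l - φ = θ - φ + k * l by ring] at h2
      have := abs_sub_le (u r θ) (u s θ) (u s φ)
      linarith
  have hcos := Real.cos_le_one_sub_mul_cos_sq (x := d) (by rw [abs_of_nonneg hd0]; linarith)
  have hD : coneDist l (r, θ) (s, φ) = Real.sqrt (r ^ 2 + s ^ 2 - 2 * r * s * Real.cos d) := by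
    unfold coneDist; simp only; rw [← hd, hmin]
  have hrs : 0 ≤ r * s := mul_nonneg hr hs
  have hmm : m ^ 2 ≤ r * s := by
    rcases le_total r s with hh | hh
    · rw [hmdef, min_eq_left hh]; nlinarith
    · rw [hmdef, min_eq_right hh]; nlinarith
  have hlow : (r - s) ^ 2 + 4 / Real.pi ^ 2 * (m * d) ^ 2 ≤ r ^ 2 + s ^ 2 - 2 * r * s * Real.cos d := by
    have h1 := mul_le_mul_of_nonneg_left hcos hrs
    have h2 := mul_le_mul_of_nonneg_right hmm (by positivity : 0 ≤ 4 / Real.pi ^ 2 * d ^ 2)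
    have h3 : r * s * (1 - 2 / Real.pi ^ 2 * d ^ 2) = r * s - (r * s * (4 / Real.pi ^ 2 * d ^ 2)) / 2 := by ring
    have h4 : 4 / Real.pi ^ 2 * (m * d) ^ 2 = m ^ 2 * (4 / Real.pi ^ 2 * d ^ 2) := by ring
    rw [h4]
    nlinarith
  have hA : |r - s| ≤ coneDist l (r, θ) (s, φ) := by
    rw [hD]; apply Real.abs_le_sqrt
    have : 0 ≤ 4 / Real.pi ^ 2 * (m * d) ^ 2 := by positivity
    linarith
  have hB : m * d ≤ Real.pi / 2 * coneDist l (r, θ) (s, φ) := by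
    have : |2 / Real.pi * (m * d)| ≤ coneDist l (r, θ) (s, φ) := by
      rw [hD]; apply Real.abs_le_sqrt
      have h1 : (2 / Real.pi * (m * d)) ^ 2 = 4 / Real.pi ^ 2 * (m * d) ^ 2 := by ring
      rw [h1]; nlinarith [sq_nonneg (r - s)]
    have h5 := mul_le_mul_of_nonneg_left ((le_abs_self _).trans this) (by positivity : 0 ≤ Real.pi / 2)
    have h6 : Real.pi / 2 * (2 / Real.pi * (m * d)) = m * d := by field_simp
    linarith
  calc |u r θ - u s φ| ≤ K * |r - s| + K * m * d := key
    _ = K * (|r - s| + m * d) := by ring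
    _ ≤ K * (coneDist l (r, θ) (s, φ) + Real.pi / 2 * coneDist l (r, θ) (s, φ)) :=
        mul_le_mul_of_nonneg_left (add_le_add hA hB) hK
    _ = _ := by ring

/-- Radial clamping. -/
def clampU (u : ℝ → ℝ → ℝ) (r θ : ℝ) : ℝ := u (max 0 (min r 1)) θ

lemma clampU_eq {u : ℝ → ℝ → ℝ} {r : ℝ} (h0 : 0 ≤ r) (h1 : r ≤ 1) (θ : ℝ) : clampU u r θ = u r θ := by
  unfold clampU; rw [min_eq_left h1, max_eq_right h0]

lemma clamp_lip (r s : ℝ) : |max 0 (min r 1) - max 0 (min s 1)| ≤ |r - s| :=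
  (abs_max_sub_max_le_abs' r s)
where
  abs_max_sub_max_le_abs' (r s : ℝ) : |max 0 (min r 1) - max 0 (min s 1)| ≤ |r - s| := by
    grind

lemma ConeLip.exists_PLip {l : ℝ} {u : ℝ → ℝ → ℝ} (h : ConeLip l 1 u) :
    ∃ K, PLip l K (clampU u) := by
  obtain ⟨K, hK⟩ := h.lipschitz
  have hc : ∀ r : ℝ, max 0 (min r 1) ∈ Icc (0:ℝ) 1 := fun r => ⟨le_max_left _ _, by simp⟩
  refine ⟨|K|, fun r θ => h.periodic _ _, fun r s θ => ?_, fun r θ φ => ?_⟩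
  · refine (hK (_, θ) (_, θ) (hc r) (hc s)).trans ?_
    refine (mul_le_mul_of_nonneg_right (le_abs_self K) (Real.sqrt_nonneg _)).trans ?_
    exact mul_le_mul_of_nonneg_left ((coneDist_rad _ _ _).trans (clamp_lip r s)) (abs_nonneg K)
  · refine (hK (_, θ) (_, φ) (hc r) (hc r)).trans ?_
    refine (mul_le_mul_of_nonneg_right (le_abs_self K) (Real.sqrt_nonneg _)).trans ?_
    rw [mul_assoc |K| |r|]
    refine mul_le_mul_of_nonneg_left ((coneDist_ang _ _ _ (hc r).1).trans ?_) (abs_nonneg K)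
    refine mul_le_mul_of_nonneg_right ?_ (abs_nonneg _)
    grind

/-- Minimality on all balls among globally Lipschitz competitors. -/
def PMin (l lp lm : ℝ) (u : ℝ → ℝ → ℝ) : Prop :=
  ∀ R, 0 < R → R ≤ 1 → ∀ (w : ℝ → ℝ → ℝ) (K : ℝ), PLip l K w → (∀ θ, w R θ = u R θ) →
    Jfun l lp lm u R ≤ Jfun l lp lm w R

lemma den_congr {lp lm : ℝ} {u w : ℝ → ℝ → ℝ} {r : ℝ}
    (h : ∀ᶠ s in nhds r, ∀ θ, u s θ = w s θ) (θ : ℝ) : den lp lm u (r, θ) = den lp lm w (r, θ) := by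
  have h0 := h.self_of_nhds
  have h1 : deriv (fun s => u s θ) r = deriv (fun s => w s θ) r :=
    Filter.EventuallyEq.deriv_eq (h.mono fun s hs => hs θ)
  have h2 : (fun φ => u r φ) = fun φ => w r φ := funext h0
  unfold den gradSq
  simp only [h0 θ, h1, h2]

lemma Jfun_congr {l lp lm R : ℝ} {u w : ℝ → ℝ → ℝ} (h : ∀ s ∈ Ioo 0 R, ∀ θ, u s θ = w s θ) :
    Jfun l lp lm u R = Jfun l lp lm w R := by
  rw [Jfun_eq, Jfun_eq]
  refine setIntegral_congr_fun (measurableSet_Om l R) ?_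
  rintro ⟨r, θ⟩ ⟨hr, -⟩
  simp only
  rw [den_congr (Filter.eventually_of_mem (isOpen_Ioo.mem_nhds hr) h)]

lemma glue_PLip {l K K' R : ℝ} {u w : ℝ → ℝ → ℝ} (hu : PLip l K u) (hw : PLip l K' w)
    (h : ∀ θ, w R θ = u R θ) : PLip l (max K K') (fun r θ => if r ≤ R then w r θ else u r θ) := by
  have hK := hu.K_nonneg
  have h1 := le_max_left K K'
  have h2 := le_max_right K K'
  have mix : ∀ r s θ, r ≤ R → R < s → |w r θ - u s θ| ≤ max K K' * |r - s| := by
    intro r s θ hr hs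
    have a1 := hw.rad r R θ
    have a2 := hu.rad R s θ
    have a3 := abs_sub_le (w r θ) (w R θ) (u s θ)
    rw [h θ] at a3 a1
    rw [abs_of_nonpos (by linarith : r - R ≤ 0)] at a1
    rw [abs_of_nonpos (by linarith : R - s ≤ 0)] at a2
    rw [abs_of_nonpos (by linarith : r - s ≤ 0)]
    nlinarith
  refine ⟨fun r θ => ?_, fun r s θ => ?_, fun r θ φ => ?_⟩
  · simp only [hu.per, hw.per]
  · rcases le_or_gt r R with hr | hr <;> rcases le_or_gt s R with hs | hs
    · simp only [hr, hs, if_true]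
      exact (hw.rad r s θ).trans (mul_le_mul_of_nonneg_right h2 (abs_nonneg _))
    · simp only [hr, not_le.2 hs, if_true, if_false]
      exact mix r s θ hr hs
    · simp only [hs, not_le.2 hr, if_true, if_false]
      rw [abs_sub_comm, abs_sub_comm r s]
      exact mix s r θ hs hr
    · simp only [not_le.2 hr, not_le.2 hs, if_false]
      exact (hu.rad r s θ).trans (mul_le_mul_of_nonneg_right h1 (abs_nonneg _))
  · rcases le_or_gt r R with hr | hr
    · simp only [hr, if_true]
      exact (hw.ang r θ φ).trans (by gcongr)
    · simp only [not_le.2 hr, if_false]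
      exact (hu.ang r θ φ).trans (by gcongr)

lemma ae_fst_ne (R : ℝ) : ∀ᵐ p : ℝ × ℝ, p.1 ≠ R := by
  have : Measure.QuasiMeasurePreserving (Prod.fst : ℝ × ℝ → ℝ) volume volume := by
    rw [Measure.volume_eq_prod]; exact Measure.quasiMeasurePreserving_fst
  exact this.ae (Measure.ae_ne volume R)

lemma Jfun_sub {l lp lm R : ℝ} (hlp : 0 ≤ lp) (hlm : 0 ≤ lm) {K K' : ℝ} {u w : ℝ → ℝ → ℝ}
    (hu : PLip l K u) (hw : PLip l K' w) :
    Jfun l lp lm w R - Jfun l lp lm u R =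
      ∫ p in Om l R, (den lp lm w p - den lp lm u p) * p.1 := by
  rw [Jfun_eq, Jfun_eq, ← integral_sub (hw.intOn hlp hlm R) (hu.intOn hlp hlm R)]
  simp only [sub_mul]

lemma IsMinimizerJ.pmin {l lp lm : ℝ} (hl0 : 0 < l) (hl : l < 2 * Real.pi) (hlp : 0 ≤ lp)
    (hlm : 0 ≤ lm) {u : ℝ → ℝ → ℝ} (hu : IsMinimizerJ l lp lm 1 u) : PMin l lp lm (clampU u) := by
  obtain ⟨K, hK⟩ := hu.1.exists_PLip
  intro R hR hR1 w K' hw hwR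
  set v : ℝ → ℝ → ℝ := fun r θ => if r ≤ R then w r θ else clampU u r θ with hv
  have hvP : PLip l (max K K') v := glue_PLip hK hw hwR
  have h1 := hu.2 v (hvP.coneLip hl0 hl) (by
    intro θ
    rw [hv]; simp only
    split_ifs with h
    · have : R = 1 := le_antisymm hR1 h
      rw [this] at hwR; rw [hwR, clampU_eq zero_le_one le_rfl]
    · rw [clampU_eq zero_le_one le_rfl])
  have h2 : Jfun l lp lm u 1 = Jfun l lp lm (clampU u) 1 :=
    Jfun_congr fun s hs θ => (clampU_eq hs.1.le hs.2.le θ).symm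
  rw [h2, ← sub_nonneg, Jfun_sub hlp hlm hK hvP] at h1
  rw [← sub_nonneg, Jfun_sub hlp hlm hK hw]
  have h3 : ∫ p in Om l R, (den lp lm w p - den lp lm (clampU u) p) * p.1 =
      ∫ p in Om l R, (den lp lm v p - den lp lm (clampU u) p) * p.1 := by
    refine setIntegral_congr_fun (measurableSet_Om l R) ?_
    rintro ⟨r, θ⟩ ⟨hr, -⟩
    simp only
    rw [den_congr (u := v) (w := w)]
    refine Filter.eventually_of_mem (isOpen_Ioo.mem_nhds hr) fun s hs θ => ?_
    simp [hv, hs.2.le]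
  rw [h3]
  rw [setIntegral_eq_of_subset_of_ae_sdiff_eq_zero (s := Om l R)
    (measurableSet_Om l 1).nullMeasurableSet] at h1
  · exact h1
  · exact prod_mono (Ioo_subset_Ioo_right hR1) le_rfl
  · filter_upwards [ae_fst_ne R] with p hp hp2
    have : R < p.1 := by
      rcases lt_or_gt_of_ne hp with h | h
      · exact absurd ⟨⟨hp2.1.1.1, h⟩, hp2.1.2⟩ hp2.2
      · exact h
    obtain ⟨r, θ⟩ := p
    rw [den_congr (u := v) (w := clampU u)]
    · simp
    refine Filter.eventually_of_mem (isOpen_Ioi.mem_nhds this) fun s hs θ => ?_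
    have hs' : ¬ s ≤ R := not_le.2 (mem_Ioi.1 hs)
    simp [hv, hs']

end

section

open MeasureTheory Set

/-- Rescaling. -/
def scU (u : ℝ → ℝ → ℝ) (a r θ : ℝ) : ℝ := u (a * r) θ / a

/-- Rotation. -/
def rotU (u : ℝ → ℝ → ℝ) (a r θ : ℝ) : ℝ := u r (θ + a)

/-- Negation. -/
def negU (u : ℝ → ℝ → ℝ) (r θ : ℝ) : ℝ := - u r θ

variable {l lp lm K : ℝ} {u : ℝ → ℝ → ℝ}

lemma PLip.scU (h : PLip l K u) {a : ℝ} (ha : 0 < a) : PLip l K (scU u a) := by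
  refine ⟨fun r θ => ?_, fun r s θ => ?_, fun r θ φ => ?_⟩
  · unfold _root_.scU; rw [h.per]
  · unfold _root_.scU
    rw [← sub_div, abs_div, abs_of_pos ha, div_le_iff₀ ha]
    refine (h.rad _ _ θ).trans (le_of_eq ?_)
    rw [← mul_sub, abs_mul, abs_of_pos ha]; ring
  · unfold _root_.scU
    rw [← sub_div, abs_div, abs_of_pos ha, div_le_iff₀ ha]
    refine (h.ang _ _ _).trans (le_of_eq ?_)
    rw [abs_mul, abs_of_pos ha]; ring

lemma PLip.rotU (h : PLip l K u) (a : ℝ) : PLip l K (rotU u a) := by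
  refine ⟨fun r θ => ?_, fun r s θ => h.rad r s _, fun r θ φ => ?_⟩
  · unfold _root_.rotU; rw [add_right_comm, h.per]
  · unfold _root_.rotU
    have := h.ang r (θ + a) (φ + a)
    rwa [add_sub_add_right_eq_sub] at this

lemma PLip.negU (h : PLip l K u) : PLip l K (negU u) := by
  refine ⟨fun r θ => ?_, fun r s θ => ?_, fun r θ φ => ?_⟩
  · unfold _root_.negU; rw [h.per]
  · unfold _root_.negU
    have := h.rad s r θ
    rwa [abs_sub_comm s r, show u s θ - u r θ = -u r θ - -u s θ by ring] at this
  · unfold _root_.negU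
    have := h.ang r φ θ
    rwa [abs_sub_comm φ θ, show u r φ - u r θ = -u r θ - -u r φ by ring] at this

lemma den_scU (u : ℝ → ℝ → ℝ) {a : ℝ} (ha : 0 < a) (r θ : ℝ) :
    den lp lm (scU u a) (r, θ) = den lp lm u (a * r, θ) := by
  have h1 : deriv (fun s => scU u a s θ) r = deriv (fun s => u s θ) (a * r) := by
    unfold scU
    rw [deriv_div_const, deriv_comp_mul_left a (fun s => u s θ), smul_eq_mul]
    field_simp
  have h2 : deriv (fun φ => scU u a r φ) θ = deriv (fun φ => u (a * r) φ) θ / a := by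
    unfold scU
    rw [deriv_div_const]
  have h3 : (0 < scU u a r θ) = (0 < u (a * r) θ) := by
    unfold scU; rw [div_pos_iff_of_pos_right ha]
  have h4 : (scU u a r θ < 0) = (u (a * r) θ < 0) := by
    unfold scU; rw [div_neg_iff]; simp [ha, not_lt.2 ha.le]
  unfold den gradSq
  simp only [h1, h2, h3, h4]
  congr 3
  rw [div_pow, mul_pow, div_div]

lemma Jfun_scU (hl : 0 ≤ l) (hlp : 0 ≤ lp) (hlm : 0 ≤ lm) (h : PLip l K u) {a R : ℝ} (ha : 0 < a)
    (hR : 0 ≤ R) : Jfun l lp lm (scU u a) R = Jfun l lp lm u (a * R) / a ^ 2 := by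
  rw [Jfun_eq, Jfun_eq, fub_tr hl hR ((h.scU ha).intOn hlp hlm R),
    fub_tr hl (by positivity) (h.intOn hlp hlm (a * R)), ← intervalIntegral.integral_div]
  congr 1; ext θ
  have := intervalIntegral.integral_comp_mul_left (a := 0) (b := R) (c := a)
    (fun s => den lp lm u (s, θ) * s / a) ha.ne'
  have h2 : ∀ r, den lp lm (scU u a) (r, θ) * r = den lp lm u (a * r, θ) * (a * r) / a := by
    intro r; rw [den_scU u ha]; field_simp
  simp only [h2]
  rw [this, mul_zero, intervalIntegral.integral_div, smul_eq_mul]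
  field_simp

lemma scU_inv (u : ℝ → ℝ → ℝ) {a : ℝ} (ha : 0 < a) : scU (scU u a⁻¹) a = u := by
  ext r θ; unfold scU; field_simp

lemma PMin.scU (hl : 0 ≤ l) (hlp : 0 ≤ lp) (hlm : 0 ≤ lm) (h : PLip l K u) (hm : PMin l lp lm u)
    {a : ℝ} (ha : 0 < a) (ha1 : a ≤ 1) : PMin l lp lm (scU u a) := by
  intro R hR hR1 w K' hw hwR
  have hw' := hw.scU (inv_pos.2 ha)
  have := hm (a * R) (by positivity) (by nlinarith) (_root_.scU w a⁻¹) K' hw' (by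
    intro θ
    have := hwR θ
    unfold _root_.scU at *
    rw [inv_mul_cancel_left₀ ha.ne', this]; field_simp)
  rw [Jfun_scU hl hlp hlm h ha hR.le]
  have h2 := Jfun_scU hl hlp hlm hw' ha hR.le
  rw [scU_inv w ha] at h2
  rw [h2]
  gcongr

lemma den_rotU (u : ℝ → ℝ → ℝ) (a r θ : ℝ) :
    den lp lm (rotU u a) (r, θ) = den lp lm u (r, θ + a) := by
  have h2 : deriv (fun φ => rotU u a r φ) θ = deriv (fun φ => u r φ) (θ + a) := by
    unfold rotU
    exact deriv_comp_add_const (fun φ => u r φ) a θ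
  unfold den gradSq
  simp only [h2]
  rfl

lemma den_per (h : PLip l K u) (r θ : ℝ) : den lp lm u (r, θ + l) = den lp lm u (r, θ) := by
  rw [← den_rotU]
  congr 1; ext r θ; exact h.per r θ

lemma Jfun_rotU (hl : 0 ≤ l) (hlp : 0 ≤ lp) (hlm : 0 ≤ lm) (h : PLip l K u) {a R : ℝ}
    (hR : 0 ≤ R) : Jfun l lp lm (rotU u a) R = Jfun l lp lm u R := by
  rw [Jfun_eq, Jfun_eq, fub_rt hl hR ((h.rotU a).intOn hlp hlm R),
    fub_rt hl hR (h.intOn hlp hlm R)]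
  congr 1; ext r
  simp only [den_rotU]
  have hp : Function.Periodic (fun θ => den lp lm u (r, θ) * r) l := fun θ => by
    simp only [den_per h]
  rw [intervalIntegral.integral_comp_add_right (fun θ => den lp lm u (r, θ) * r)]
  have := hp.intervalIntegral_add_eq a 0
  rw [zero_add] at this
  rw [zero_add, add_comm l a, this]

lemma PMin.rotU (hl : 0 ≤ l) (hlp : 0 ≤ lp) (hlm : 0 ≤ lm) (h : PLip l K u) (hm : PMin l lp lm u)
    (a : ℝ) : PMin l lp lm (rotU u a) := by
  intro R hR hR1 w K' hw hwR
  have := hm R hR hR1 (_root_.rotU w (-a)) K' (hw.rotU _) (by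
    intro θ
    unfold _root_.rotU at *
    rw [hwR]; simp)
  rwa [Jfun_rotU hl hlp hlm hw hR.le, ← Jfun_rotU (a := a) hl hlp hlm h hR.le] at this

lemma Jfun_negU (u : ℝ → ℝ → ℝ) (R : ℝ) : Jfun l lm lp (negU u) R = Jfun l lp lm u R := by
  rw [Jfun_eq, Jfun_eq]
  congr 1; ext ⟨r, θ⟩
  have h1 : deriv (fun s => negU u s θ) r = - deriv (fun s => u s θ) r := by
    unfold negU; exact deriv.fun_neg
  have h2 : deriv (fun φ => negU u r φ) θ = - deriv (fun φ => u r φ) θ := by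
    unfold negU; exact deriv.fun_neg
  unfold den gradSq
  simp only [h1, h2, neg_sq]
  unfold negU
  simp only [Left.neg_pos_iff, Left.neg_neg_iff]
  ring

lemma PMin.negU (hm : PMin l lp lm u) : PMin l lm lp (negU u) := by
  intro R hR hR1 w K' hw hwR
  have := hm R hR hR1 (_root_.negU w) K' hw.negU (by
    intro θ
    unfold _root_.negU at *
    rw [hwR]; simp)
  rw [Jfun_negU]
  have h2 := Jfun_negU (l := l) (lp := lm) (lm := lp) w R
  rwa [h2] at this

end

section

open MeasureTheory Set

lemma fub_tr_int {l R : ℝ} (hl : 0 ≤ l) (hR : 0 ≤ R) {F : ℝ × ℝ → ℝ} (hF : IntegrableOn F (Om l R)) :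
    IntervalIntegrable (fun θ => ∫ r in (0:ℝ)..R, F (r, θ)) volume 0 l := by
  rw [intervalIntegrable_iff_integrableOn_Ioo_of_le hl]
  simp only [intervalIntegral.integral_of_le hR, integral_Ioc_eq_integral_Ioo]
  unfold Om IntegrableOn at hF
  rw [Measure.volume_eq_prod, ← Measure.prod_restrict] at hF
  exact hF.integral_prod_right

lemma fub_rt_int {l R : ℝ} (hl : 0 ≤ l) (hR : 0 ≤ R) {F : ℝ × ℝ → ℝ} (hF : IntegrableOn F (Om l R)) :
    IntervalIntegrable (fun r => ∫ θ in (0:ℝ)..l, F (r, θ)) volume 0 R := by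
  rw [intervalIntegrable_iff_integrableOn_Ioo_of_le hR]
  simp only [intervalIntegral.integral_of_le hl, integral_Ioc_eq_integral_Ioo]
  unfold Om IntegrableOn at hF
  rw [Measure.volume_eq_prod, ← Measure.prod_restrict] at hF
  exact hF.integral_prod_left

/-- bounded measurable functions of one variable are interval integrable -/
lemma bm_int {f : ℝ → ℝ} (hf : Measurable f) {C a b : ℝ} (hab : a ≤ b) (hC : ∀ x ∈ Ioo a b, |f x| ≤ C) :
    IntervalIntegrable f volume a b := by
  rw [intervalIntegrable_iff_integrableOn_Ioo_of_le hab]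
  exact IntegrableOn.of_bound (by simp) hf.aestronglyMeasurable C
    ((ae_restrict_iff' measurableSet_Ioo).2 (Filter.Eventually.of_forall hC))

lemma cont_zero {l : ℝ} (hl : 0 < l) {g : ℝ → ℝ} (hg : Continuous g) (hp : ∀ x, g (x + l) = g x)
    (h0 : ∀ x, 0 ≤ g x) (hi : ∫ x in (0:ℝ)..l, g x ≤ 0) (x : ℝ) : g x = 0 := by
  by_contra hx
  have hpos : 0 < g x := lt_of_le_of_ne (h0 x) (Ne.symm hx)
  obtain ⟨y, hy, hyx⟩ := Function.Periodic.exists_mem_Ico₀ (f := g) hp hl x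
  have : 0 < ∫ x in (0:ℝ)..l, g x := by
    refine intervalIntegral.integral_pos hl hg.continuousOn (fun x _ => h0 x) ⟨y, Ico_subset_Icc_self hy, ?_⟩
    rwa [← hyx]
  linarith

lemma log_max_lip {a : ℝ} (ha : 0 < a) (r s : ℝ) :
    |Real.log (max r a) - Real.log (max s a)| ≤ 1 / a * |r - s| := by
  wlog h : s ≤ r with H
  · rw [abs_sub_comm, abs_sub_comm r s]; exact H ha s r (le_of_not_ge h)
  have h1 : max s a ≤ max r a := max_le_max_right a h
  have h2 : 0 < max s a := lt_max_of_lt_right ha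
  have h3 : 0 < max r a := lt_max_of_lt_right ha
  have h4 : max r a - max s a ≤ r - s := by grind
  rw [abs_of_nonneg (sub_nonneg.2 (Real.log_le_log h2 h1)), abs_of_nonneg (sub_nonneg.2 h),
    ← Real.log_div h3.ne' h2.ne']
  have h5 := Real.log_le_sub_one_of_pos (div_pos h3 h2)
  have h6 : max r a / max s a - 1 = (max r a - max s a) / max s a := by field_simp
  rw [h6] at h5
  refine h5.trans ?_
  rw [one_div, inv_mul_eq_div]
  exact div_le_div₀ (sub_nonneg.2 h) h4 ha (le_max_right _ _)

lemma hasDerivAt_log_max {a r : ℝ} (ha : 0 < a) (hr : a < r) :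
    HasDerivAt (fun s => Real.log (max s a)) (1 / r) r := by
  have h1 : HasDerivAt Real.log (r⁻¹) r := Real.hasDerivAt_log (by linarith)
  rw [one_div]
  refine h1.congr_of_eventuallyEq ?_
  filter_upwards [isOpen_Ioi.mem_nhds hr] with s hs
  rw [max_eq_left (le_of_lt hs)]

lemma max_zero_deriv_of_nonpos {g : ℝ → ℝ} {x : ℝ} (h : g x ≤ 0) : deriv (fun s => max (g s) 0) x = 0 := by
  apply IsLocalMin.deriv_eq_zero
  refine Filter.Eventually.of_forall fun s => ?_
  simp [h]

lemma max_zero_deriv_of_pos {g : ℝ → ℝ} {x : ℝ} (hg : Continuous g) (h : 0 < g x) :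
    deriv (fun s => max (g s) 0) x = deriv g x := by
  apply Filter.EventuallyEq.deriv_eq
  filter_upwards [hg.continuousAt.eventually (lt_mem_nhds h)] with s hs
  exact max_eq_left (le_of_lt hs)

lemma max_lip {K : ℝ} {U : ℝ → ℝ} (h : ∀ x y, |U x - U y| ≤ K * |x - y|) (x y : ℝ) :
    |max (U x) 0 - max (U y) 0| ≤ K * |x - y| :=
  (abs_max_sub_max_le_abs (U x) (U y) 0).trans (h x y)

lemma radial_trace {K ρ : ℝ} (hρ : 0 < ρ) {U : ℝ → ℝ} (hU : ∀ x y, |U x - U y| ≤ K * |x - y|)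
    (h0 : U 0 = 0) (hK : 0 ≤ K) :
    ρ * max (U ρ) 0 ≤ 3 * K * ∫ s in (0:ℝ)..ρ, (if 0 < U s then s else 0) := by
  have hUc : Continuous U := (lip_of hU).continuous
  have hg := max_lip hU
  have hac1 : AbsolutelyContinuousOnInterval (fun s : ℝ => s ^ 2) 0 ρ := by
    have h1 : AbsolutelyContinuousOnInterval (fun s : ℝ => s) 0 ρ :=
      lip_ac (K := 1) (fun x y => by simp) 0 ρ
    simpa [sq] using h1.fun_mul h1
  have hac2 := lip_ac hg 0 ρ
  have key := hac1.integral_deriv_mul_eq_sub hac2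
  have hmeas : Measurable fun s => if 0 < U s then s else 0 :=
    Measurable.ite (measurableSet_lt measurable_const hUc.measurable) measurable_id measurable_const
  have hI : IntervalIntegrable (fun s => if 0 < U s then s else 0) volume 0 ρ := by
    refine bm_int hmeas hρ.le (C := ρ) ?_
    rintro x ⟨hx, hx'⟩
    split_ifs
    · rw [abs_of_pos hx]; exact hx'.le
    · simp [hρ.le]
  have hI2 : IntervalIntegrable (fun x => deriv (fun s : ℝ => s ^ 2) x * max (U x) 0
      + x ^ 2 * deriv (fun s => max (U s) 0) x) volume 0 ρ :=
    (hac1.intervalIntegrable_deriv.mul_continuousOn hac2.continuousOn).add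
      (hac2.intervalIntegrable_deriv.continuousOn_mul hac1.continuousOn)
  have hle := intervalIntegral.integral_mono_on hρ.le hI2 (hI.const_mul (3 * K * ρ)) (by
    rintro x ⟨hx, hx'⟩
    split_ifs with hux
    · have h1 : max (U x) 0 ≤ K * x := by
        have := hU x 0
        rw [h0, sub_zero, sub_zero, abs_of_nonneg hx] at this
        exact max_le (le_of_abs_le this) (by positivity)
      have h2 := le_of_abs_le (deriv_le_of hK hg x)
      have h3 : deriv (fun s : ℝ => s ^ 2) x = 2 * x := by simp
      rw [h3]
      have h4 := mul_le_mul_of_nonneg_left h1 (by positivity : 0 ≤ 2 * x)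
      have h5 := mul_le_mul_of_nonneg_left h2 (by positivity : 0 ≤ x ^ 2)
      have h6 := mul_le_mul_of_nonneg_left hx' (by positivity : 0 ≤ 3 * K * x)
      nlinarith
    · have h1 : U x ≤ 0 := not_lt.1 hux
      rw [max_zero_deriv_of_nonpos h1, max_eq_right h1]; simp)
  rw [key, intervalIntegral.integral_const_mul] at hle
  simp only [h0] at hle
  have : ρ * (ρ * max (U ρ) 0) ≤ ρ * (3 * K * ∫ s in (0:ℝ)..ρ, (if 0 < U s then s else 0)) := by
    simp at hle
    nlinarith
  exact le_of_mul_le_mul_left this hρ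

end

section

open MeasureTheory Set

/-- pointwise comparison of densities for the competitor `min u h` -/
lemma min_comp_pt {lp lm a ρ r θ : ℝ} (hlp : 0 ≤ lp) (hlm : 0 ≤ lm) {u : ℝ → ℝ → ℝ} {h : ℝ → ℝ} (hr : 0 < r)
    (hrρ : r ≠ ρ) (h0 : ∀ s, s ≤ ρ → h s = 0) (hh : ∀ s, ρ < s → 0 ≤ h s)
    (hd : ∀ s, ρ < s → HasDerivAt h (a / s) s)
    (hc : Continuous fun s => u s θ - h s) (hct : Continuous fun φ => u r φ - h r)
    (hu1 : DifferentiableAt ℝ (fun s => u s θ) r) (hu2 : DifferentiableAt ℝ (fun φ => u r φ) θ)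
    (hw1 : DifferentiableAt ℝ (fun s => min (u s θ) (h s)) r)
    (hw2 : DifferentiableAt ℝ (fun φ => min (u r φ) (h r)) θ) :
    (den lp lm (fun s φ => min (u s φ) (h s)) (r, θ) - den lp lm u (r, θ)) * r ≤
      (if r < ρ then -lp * (if 0 < u r θ then r else 0)
        else -2 * a * deriv (fun s => max (u s θ - h s) 0) r) := by
  have hw : ∀ s φ, min (u s φ) (h s) = u s φ - max (u s φ - h s) 0 := by
    intro s φ; rcases le_total (u s φ) (h s) with H | H <;> simp [H]
  by_cases hle : u r θ ≤ h r
  · have hle' : u r θ - h r ≤ 0 := by linarith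
    have e1 : deriv (fun s => max (u s θ - h s) 0) r = 0 :=
      max_zero_deriv_of_nonpos (g := fun s => u s θ - h s) hle'
    have e2 : deriv (fun φ => max (u r φ - h r) 0) θ = 0 :=
      max_zero_deriv_of_nonpos (g := fun φ => u r φ - h r) hle'
    have d1 : deriv (fun s => min (u s θ) (h s)) r = deriv (fun s => u s θ) r := by
      have : (fun s => max (u s θ - h s) 0) = fun s => u s θ - min (u s θ) (h s) := by
        funext s; rw [hw]; ring
      rw [this, deriv_fun_sub hu1 hw1] at e1
      linarith
    have d2 : deriv (fun φ => min (u r φ) (h r)) θ = deriv (fun φ => u r φ) θ := by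
      have : (fun φ => max (u r φ - h r) 0) = fun φ => u r φ - min (u r φ) (h r) := by
        funext s; rw [hw]; ring
      rw [this, deriv_fun_sub hu2 hw2] at e2
      linarith
    have hz : den lp lm (fun s φ => min (u s φ) (h s)) (r, θ) = den lp lm u (r, θ) := by
      simp only [den, gradSq, d1, d2, min_eq_left hle]
    rw [hz, sub_self, zero_mul, e1, mul_zero]
    split_ifs with h1 h2
    · have := h0 r h1.le; linarith
    · simp
    · rfl
  · push Not at hle
    have hpos : 0 < u r θ - h r := by linarith
    have d1 : deriv (fun s => min (u s θ) (h s)) r = deriv h r := by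
      apply Filter.EventuallyEq.deriv_eq
      filter_upwards [hc.continuousAt.eventually (lt_mem_nhds hpos)] with s hs
      exact min_eq_right (by linarith)
    have d2 : deriv (fun φ => min (u r φ) (h r)) θ = 0 := by
      have : deriv (fun φ => min (u r φ) (h r)) θ = deriv (fun _ => h r) θ := by
        apply Filter.EventuallyEq.deriv_eq
        filter_upwards [hct.continuousAt.eventually (lt_mem_nhds hpos)] with s hs
        exact min_eq_right (by linarith)
      rw [this, deriv_const]
    rcases lt_or_gt_of_ne hrρ with hlt | hgt
    · have e0 := h0 r hlt.le
      have d3 : deriv h r = 0 := by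
        have : deriv h r = deriv (fun _ => (0:ℝ)) r := by
          apply Filter.EventuallyEq.deriv_eq
          filter_upwards [isOpen_Iio.mem_nhds hlt] with s hs
          exact h0 s (le_of_lt hs)
        rw [this, deriv_const]
      have hup : 0 < u r θ := by linarith
      rw [if_pos hlt, if_pos hup]
      have : den lp lm (fun s φ => min (u s φ) (h s)) (r, θ) = 0 := by
        simp only [den, gradSq, d1, d2, d3, min_eq_right hle.le]
        simp [e0]
      rw [this]
      have h2 := PLip.gradSq_nonneg u (r, θ)
      have : lp ≤ den lp lm u (r, θ) := by
        simp only [den, if_pos hup, if_neg hup.not_gt]; linarith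
      nlinarith
    · have d3 : deriv h r = a / r := (hd r hgt).deriv
      have hhp : 0 < u r θ := lt_of_le_of_lt (hh r hgt) hle
      have hn : ¬ (h r < 0) := not_lt.2 (hh r hgt)
      have e1 : deriv (fun s => max (u s θ - h s) 0) r = deriv (fun s => u s θ) r - a / r := by
        rw [max_zero_deriv_of_pos (g := fun s => u s θ - h s) hc hpos,
          deriv_fun_sub hu1 (hd r hgt).differentiableAt, d3]
      rw [if_neg (not_lt.2 hgt.le), e1]
      simp only [den, gradSq, d1, d2, d3, min_eq_right hle.le, if_pos hhp, if_neg hhp.not_gt, if_neg hn]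
      have hb : (if 0 < h r then lp else 0) ≤ lp := by split_ifs <;> linarith
      set X := deriv (fun s => u s θ) r
      set Y := deriv (fun φ => u r φ) θ
      have h3 : 0 ≤ Y ^ 2 / r ^ 2 := by positivity
      have h4 : ((a / r) ^ 2 + 0 ^ 2 / r ^ 2 + (if 0 < h r then lp else 0) + 0 - (X ^ 2 + Y ^ 2 / r ^ 2 + lp + 0))
          ≤ (a / r) ^ 2 - X ^ 2 := by simp; linarith
      refine (mul_le_mul_of_nonneg_right h4 hr.le).trans ?_
      have h5 : (a / r) * r = a := by field_simp
      have h6 : ((a / r) ^ 2 - X ^ 2) * r - (-2 * a * (X - a / r)) = - (a / r - X) ^ 2 * r := by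
        have : a = (a / r) * r := h5.symm
        generalize a / r = q at *
        subst this
        ring
      have h7 : 0 ≤ (a / r - X) ^ 2 * r := by positivity
      linarith

lemma nondeg {l lp lm K R c : ℝ} {u : ℝ → ℝ → ℝ} (hl : 0 < l) (hlp : 0 ≤ lp) (hlm : 0 ≤ lm)
    (hu : PLip l K u) (hm : PMin l lp lm u) (hv : ∀ θ, u 0 θ = 0) (hR : 0 < R) (hR1 : R ≤ 1) (hc : 0 < c)
    (hcK : 12 * c * K < lp) (hb : ∀ θ, u R θ ≤ c * R * Real.log 2) :
    ∀ r ∈ Icc 0 (R / 2), ∀ θ, u r θ ≤ 0 := by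
  have hK := hu.K_nonneg
  set ρ := R / 2 with hρdef
  have hρ : 0 < ρ := by positivity
  set a := c * R with hadef
  have ha : 0 < a := by positivity
  set h : ℝ → ℝ := fun s => a * (Real.log (max s ρ) - Real.log ρ) with hh
  have h_zero : ∀ s, s ≤ ρ → h s = 0 := by
    intro s hs; simp [hh, max_eq_right hs]
  have h_nonneg : ∀ s, 0 ≤ h s := by
    intro s
    have := Real.log_le_log hρ (le_max_right s ρ)
    simp only [hh]; apply mul_nonneg ha.le; linarith
  have h_der : ∀ s, ρ < s → HasDerivAt h (a / s) s := by
    intro s hs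
    have := ((hasDerivAt_log_max hρ hs).sub_const (Real.log ρ)).const_mul a
    rwa [mul_one_div] at this
  have h_lip : ∀ x y, |h x - h y| ≤ 2 * c * |x - y| := by
    intro x y
    have e : h x - h y = a * (Real.log (max x ρ) - Real.log (max y ρ)) := by simp only [hh]; ring
    rw [e, abs_mul, abs_of_pos ha]
    refine (mul_le_mul_of_nonneg_left (log_max_lip hρ x y) ha.le).trans (le_of_eq ?_)
    rw [hadef, hρdef]; field_simp
  have h_R : h R = a * Real.log 2 := by
    simp only [hh]
    rw [max_eq_left (by rw [hρdef]; linarith), ← Real.log_div hR.ne' hρ.ne']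
    congr 2; rw [hρdef]; field_simp
  set w : ℝ → ℝ → ℝ := fun r θ => min (u r θ) (h r) with hw
  set g : ℝ → ℝ → ℝ := fun r θ => max (u r θ - h r) 0 with hg
  have hdiff : ∀ r s θ, |(u r θ - h r) - (u s θ - h s)| ≤ (K + 2 * c) * |r - s| := by
    intro r s θ
    have h1 := hu.rad r s θ
    have h2 := h_lip r s
    have : (u r θ - h r) - (u s θ - h s) = (u r θ - u s θ) - (h r - h s) := by ring
    rw [this]
    refine (abs_sub _ _).trans ?_
    linarith
  have hgP : PLip l (K + 2 * c) g := by
    refine ⟨fun r θ => by simp only [hg, hu.per], fun r s θ => ?_, fun r θ φ => ?_⟩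
    · exact (abs_max_sub_max_le_abs _ _ 0).trans (hdiff r s θ)
    · refine (abs_max_sub_max_le_abs _ _ 0).trans ?_
      have h1 := hu.ang r θ φ
      have : (u r θ - h r) - (u r φ - h r) = u r θ - u r φ := by ring
      rw [this]
      have : 0 ≤ 2 * c * |r| * |θ - φ| := by positivity
      nlinarith
  have hwP : PLip l (K + 2 * c) w := by
    refine ⟨fun r θ => by simp only [hw, hu.per], fun r s θ => ?_, fun r θ φ => ?_⟩
    · refine (abs_min_sub_min_le_max _ _ _ _).trans (max_le ?_ ?_)
      · have h1 := hu.rad r s θ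
        have : 0 ≤ 2 * c * |r - s| := by positivity
        nlinarith
      · have h1 := h_lip r s
        have : 0 ≤ K * |r - s| := by positivity
        nlinarith
    · refine (abs_min_sub_min_le_max _ _ _ _).trans (max_le ?_ ?_)
      · have h1 := hu.ang r θ φ
        have : 0 ≤ 2 * c * |r| * |θ - φ| := by positivity
        nlinarith
      · rw [sub_self, abs_zero]; positivity
  have hmin := hm R hR hR1 w _ hwP (fun θ => by
    simp only [hw]; exact min_eq_left (by rw [h_R]; exact hb θ))
  set G : ℝ × ℝ → ℝ := fun p => if p.1 < ρ then -lp * (if 0 < u p.1 p.2 then p.1 else 0)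
        else -2 * a * deriv (fun s => g s p.2) p.1 with hG
  have hGm : Measurable G := by
    refine Measurable.ite (measurableSet_lt measurable_fst measurable_const) ?_ ?_
    · exact (Measurable.ite (measurableSet_lt measurable_const hu.meas) measurable_fst measurable_const).const_mul _
    · exact hgP.meas_dr.const_mul _
  have hGb0 : ∀ r θ, 0 < r → r < R → |G (r, θ)| ≤ lp * R + 2 * a * (K + 2 * c) := by
    intro r θ hr0 hrR
    have p1 : 0 ≤ lp * R := by positivity
    have p2 : 0 ≤ 2 * a * (K + 2 * c) := by positivity
    simp only [hG]
    split_ifs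
    · rw [abs_mul, abs_neg, abs_of_nonneg hlp, abs_of_pos hr0]; nlinarith
    · simp; linarith
    · have := hgP.dr_le r θ
      rw [abs_mul, abs_mul, abs_of_pos ha]
      norm_num
      nlinarith
  have hGb : ∀ p ∈ Om l R, |G p| ≤ lp * R + 2 * a * (K + 2 * c) := by
    rintro ⟨r, θ⟩ ⟨⟨hr0, hrR⟩, _⟩
    exact hGb0 r θ hr0 hrR
  have hGi := intOn_Om hGm hGb
  have h1 : 0 ≤ ∫ p in Om l R, G p := by
    have e := Jfun_sub (R := R) hlp hlm hu hwP
    have : ∫ p in Om l R, (den lp lm w p - den lp lm u p) * p.1 ≤ ∫ p in Om l R, G p := by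
      refine setIntegral_mono_on_ae ?_ hGi (measurableSet_Om l R) ?_
      · have := (hwP.intOn hlp hlm R).sub (hu.intOn hlp hlm R)
        refine this.congr_fun (fun p _ => ?_) (measurableSet_Om l R)
        simp only [Pi.sub_apply]; ring
      · filter_upwards [hu.ae_diff_r, hu.ae_diff_t, hwP.ae_diff_r, hwP.ae_diff_t, ae_fst_ne ρ]
          with p a1 a2 a3 a4 a5 hp
        obtain ⟨r, θ⟩ := p
        obtain ⟨⟨hr0, hrR⟩, _⟩ := hp
        exact min_comp_pt hlp hlm hr0 a5 h_zero (fun s _ => h_nonneg s) h_der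
          ((lip_of fun x y => hdiff x y θ).continuous) ((hu.cont_t r).sub continuous_const) a1 a2 a3 a4
    linarith
  rw [fub_tr hl.le hR.le hGi] at h1
  -- the inner integral
  have inner : ∀ s ∈ Ioc 0 ρ, ∀ θ, 3 * K * ∫ r in (0:ℝ)..R, G (r, θ) ≤ -((lp - 12 * c * K) * s) * max (u s θ) 0 := by
    intro s hs θ
    have hUl : ∀ x y, |u x θ - u y θ| ≤ K * |x - y| := fun x y => hu.rad x y θ
    have hUc : Continuous fun x => u x θ := hu.cont_r θ
    have hi1 : ∀ b, 0 ≤ b → IntervalIntegrable (fun r => if 0 < u r θ then r else 0) volume 0 b := by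
      intro b hb
      refine bm_int (Measurable.ite (measurableSet_lt measurable_const hUc.measurable) measurable_id' measurable_const) hb (C := b) ?_
      rintro x ⟨hx, hx'⟩
      split_ifs
      · rw [abs_of_pos hx]; exact hx'.le
      · simp [hb]
    have hac := lip_ac (fun x y => hgP.rad x y θ) ρ R
    have eA : ∫ r in (0:ℝ)..ρ, G (r, θ) = -lp * ∫ r in (0:ℝ)..ρ, (if 0 < u r θ then r else 0) := by
      rw [← intervalIntegral.integral_const_mul, intervalIntegral.integral_of_le hρ.le, intervalIntegral.integral_of_le hρ.le,
        integral_Ioc_eq_integral_Ioo, integral_Ioc_eq_integral_Ioo]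
      refine setIntegral_congr_fun measurableSet_Ioo fun r hr => ?_
      simp only [hG, if_pos hr.2]
    have hρR : ρ ≤ R := by rw [hρdef]; linarith
    have eB : ∫ r in ρ..R, G (r, θ) = -2 * a * (g R θ - g ρ θ) := by
      rw [← hac.integral_deriv_eq_sub, ← intervalIntegral.integral_const_mul, intervalIntegral.integral_of_le hρR, intervalIntegral.integral_of_le hρR]
      refine setIntegral_congr_fun measurableSet_Ioc fun r hr => ?_
      simp only [hG, if_neg (not_lt.2 hr.1.le)]
    have hGint : ∀ x y, 0 ≤ x → x ≤ y → y ≤ R → IntervalIntegrable (fun r => G (r, θ)) volume x y := by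
      intro x y hx hxy hy
      refine bm_int (hGm.comp (measurable_id.prodMk measurable_const)) hxy (C := lp * R + 2 * a * (K + 2 * c)) ?_
      intro r hr
      exact hGb0 r θ (lt_of_le_of_lt hx hr.1) (lt_of_lt_of_le hr.2 hy)
    rw [← intervalIntegral.integral_add_adjacent_intervals (hGint 0 ρ le_rfl hρ.le hρR) (hGint ρ R hρ.le hρR le_rfl), eA, eB]
    have g1 : g R θ = 0 := by simp only [hg]; exact max_eq_right (by rw [h_R]; linarith [hb θ])
    have g2 : g ρ θ = max (u ρ θ) 0 := by simp only [hg]; rw [h_zero ρ le_rfl, sub_zero]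
    rw [g1, g2]
    have t1 := radial_trace hρ hUl (hv θ) hK
    have t2 := radial_trace hs.1 hUl (hv θ) hK
    have t3 : ∫ r in (0:ℝ)..s, (if 0 < u r θ then r else 0) ≤ ∫ r in (0:ℝ)..ρ, (if 0 < u r θ then r else 0) := by
      refine intervalIntegral.integral_mono_interval le_rfl hs.1.le hs.2 ?_ (hi1 ρ hρ.le)
      refine (ae_restrict_iff' measurableSet_Ioc).2 (Filter.Eventually.of_forall fun r hr => ?_)
      simp only [Pi.zero_apply]; split_ifs
      · exact hr.1.le
      · exact le_rfl
    set A := ∫ r in (0:ℝ)..ρ, (if 0 < u r θ then r else 0)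
    have t4 := mul_le_mul_of_nonneg_left t3 (by positivity : 0 ≤ 3 * K)
    have ea : a = 2 * c * ρ := by rw [hadef, hρdef]; ring
    have t5 : 2 * a * max (u ρ θ) 0 ≤ 12 * c * K * A := by
      rw [ea]; nlinarith
    have t6 : (lp - 12 * c * K) * (s * max (u s θ) 0) ≤ (lp - 12 * c * K) * (3 * K * A) :=
      mul_le_mul_of_nonneg_left (by linarith) (by linarith)
    have t7 := mul_le_mul_of_nonneg_left t5 (by positivity : 0 ≤ 3 * K)
    nlinarith
  have main : ∀ s ∈ Ioc 0 ρ, ∀ θ, max (u s θ) 0 = 0 := by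
    intro s hs θ
    refine cont_zero hl (g := fun θ => max (u s θ) 0) ((hu.cont_t s).max continuous_const)
      (fun x => by simp only [hu.per]) (fun x => le_max_right _ _) ?_ θ
    have hcont : Continuous fun θ => max (u s θ) 0 := (hu.cont_t s).max continuous_const
    have := intervalIntegral.integral_mono_on hl.le ((fub_tr_int hl.le hR.le hGi).const_mul (3 * K))
      ((hcont.intervalIntegrable 0 l).const_mul (-((lp - 12 * c * K) * s))) (fun θ _ => inner s hs θ)
    rw [intervalIntegral.integral_const_mul, intervalIntegral.integral_const_mul] at this
    have q : 0 < (lp - 12 * c * K) * s := mul_pos (by linarith) hs.1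
    have q2 : 0 ≤ 3 * K * ∫ x in (0:ℝ)..l, ∫ r in (0:ℝ)..R, G (r, x) := by positivity
    by_contra hcon
    push Not at hcon
    have := mul_pos q hcon
    linarith
  intro r hr θ
  rcases hr.1.eq_or_lt with h0 | h0
  · rw [← h0, hv]
  · have := main r ⟨h0, hr.2⟩ θ
    exact max_eq_right_iff.1 this

end

section

open MeasureTheory Set

lemma mv_step {l lp K ε a b t : ℝ} {u : ℝ → ℝ → ℝ} (hl : 0 < l) (hlp : 0 ≤ lp)
    (hu : PLip l K u) (hm : PMin l lp 0 u) (hε1 : ε ≤ 1)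
    (hneg : ∀ r ∈ Icc 0 ε, ∀ θ, u r θ ≤ 0) (ha : 0 < a) (hab : a < b) (hb : b ≤ ε) (ht : 0 < t) :
    0 ≤ 2 * ((∫ θ in (0:ℝ)..l, u b θ) - ∫ θ in (0:ℝ)..l, u a θ) + t * (l * ((b - a) / a)) := by
  have hK := hu.K_nonneg
  have hbp : 0 < b := ha.trans hab
  set η : ℝ → ℝ := fun r => Real.log b - Real.log (max r a) with hη
  have ηl : ∀ x y, |η x - η y| ≤ 1 / a * |x - y| := by
    intro x y
    have : η x - η y = -(Real.log (max x a) - Real.log (max y a)) := by simp only [hη]; ring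
    rw [this, abs_neg]; exact log_max_lip ha x y
  have ηd : ∀ r, a < r → HasDerivAt η (-(1 / r)) r := fun r hr =>
    (hasDerivAt_log_max ha hr).const_sub _
  have ηd0 : ∀ r, r < a → HasDerivAt η 0 r := by
    intro r hr
    refine (hasDerivAt_const r (Real.log b - Real.log a)).congr_of_eventuallyEq ?_
    filter_upwards [isOpen_Iio.mem_nhds hr] with s hs
    simp only [hη]; rw [max_eq_right (le_of_lt hs)]
  have ηn : ∀ r ≤ b, 0 ≤ η r := by
    intro r hr
    have := Real.log_le_log (lt_max_of_lt_right ha : 0 < max r a) (max_le hr hab.le)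
    simp only [hη]; linarith
  set w : ℝ → ℝ → ℝ := fun r θ => u r θ - t * η r with hw
  have hwP : PLip l (K + t / a) w := by
    refine ⟨fun r θ => by simp only [hw, hu.per], fun r s θ => ?_, fun r θ φ => ?_⟩
    · have : w r θ - w s θ = (u r θ - u s θ) - t * (η r - η s) := by simp only [hw]; ring
      rw [this]
      refine (abs_sub _ _).trans ?_
      rw [abs_mul, abs_of_pos ht]
      have h1 := hu.rad r s θ
      have h2 := mul_le_mul_of_nonneg_left (ηl r s) ht.le
      have : (K + t / a) * |r - s| = K * |r - s| + t * (1 / a * |r - s|) := by ring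
      linarith
    · have : w r θ - w r φ = u r θ - u r φ := by simp only [hw]; ring
      rw [this]
      have h1 := hu.ang r θ φ
      have : 0 ≤ t / a * |r| * |θ - φ| := by positivity
      nlinarith
  have hmin := hm b hbp (hb.trans hε1) w _ hwP (fun θ => by
    simp only [hw, hη, max_eq_left hab.le]; simp)
  set G : ℝ × ℝ → ℝ := fun p => if p.1 ≤ a then 0 else 2 * t * deriv (fun s => u s p.2) p.1 + t ^ 2 / a with hG
  have hGm : Measurable G := by
    refine Measurable.ite (measurableSet_le measurable_fst measurable_const) measurable_const ?_
    exact (hu.meas_dr.const_mul _).add_const _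
  have hGb0 : ∀ r θ, |G (r, θ)| ≤ 2 * t * K + t ^ 2 / a := by
    intro r θ
    simp only [hG]
    have p : 0 ≤ t ^ 2 / a := by positivity
    split_ifs
    · rw [abs_zero]; positivity
    · refine (abs_add_le _ _).trans ?_
      rw [abs_of_nonneg p, abs_mul, abs_of_pos (by positivity : 0 < 2 * t)]
      have := mul_le_mul_of_nonneg_left (hu.dr_le r θ) (by positivity : 0 ≤ 2 * t)
      linarith
  have hGi : IntegrableOn G (Om l b) := intOn_Om hGm (fun p _ => hGb0 p.1 p.2)
  have h1 : 0 ≤ ∫ p in Om l b, G p := by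
    have e := Jfun_sub (R := b) hlp le_rfl hu hwP
    have : ∫ p in Om l b, (den lp 0 w p - den lp 0 u p) * p.1 ≤ ∫ p in Om l b, G p := by
      refine setIntegral_mono_on_ae ?_ hGi (measurableSet_Om l b) ?_
      · have := (hwP.intOn hlp le_rfl b).sub (hu.intOn hlp (le_refl 0) b)
        refine this.congr_fun (fun p _ => ?_) (measurableSet_Om l b)
        simp only [Pi.sub_apply]; ring
      · filter_upwards [hu.ae_diff_r, ae_fst_ne a]
          with p a1 a5 hp
        obtain ⟨r, θ⟩ := p
        obtain ⟨⟨hr0, hrR⟩, _⟩ := hp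
        simp only at hr0 hrR a1 a5
        have n1 : u r θ ≤ 0 := hneg r ⟨hr0.le, (hrR.le).trans hb⟩ θ
        have n2 : w r θ ≤ 0 := by
          have := mul_nonneg ht.le (ηn r hrR.le)
          simp only [hw]; linarith
        have dt : deriv (fun φ => w r φ) θ = deriv (fun φ => u r φ) θ := by
          simp only [hw]; rw [deriv_sub_const_fun]
        rcases lt_or_gt_of_ne a5 with hlt | hgt
        · have dr : deriv (fun s => w s θ) r = deriv (fun s => u s θ) r := by
            simp only [hw]
            rw [deriv_fun_sub a1 ((ηd0 r hlt).const_mul t).differentiableAt, ((ηd0 r hlt).const_mul t).deriv]; simp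
          have : den lp 0 w (r, θ) = den lp 0 u (r, θ) := by
            simp only [den, gradSq, dr, dt, if_neg n1.not_gt, if_neg n2.not_gt]; simp
          rw [this]; simp [hG, hlt.le]
        · have dr : deriv (fun s => w s θ) r = deriv (fun s => u s θ) r + t / r := by
            simp only [hw]
            rw [deriv_fun_sub a1 ((ηd r hgt).const_mul t).differentiableAt, ((ηd r hgt).const_mul t).deriv]; ring
          have : (den lp 0 w (r, θ) - den lp 0 u (r, θ)) * r = 2 * t * deriv (fun s => u s θ) r + t ^ 2 / r := by
            simp only [den, gradSq, dr, dt, if_neg n1.not_gt, if_neg n2.not_gt]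
            simp; field_simp; ring
          rw [this]; simp only [hG, if_neg (not_le.2 hgt)]
          have : t ^ 2 / r ≤ t ^ 2 / a := by gcongr
          linarith
    linarith
  rw [fub_tr hl.le hbp.le hGi] at h1
  have inner : ∀ θ, ∫ r in (0:ℝ)..b, G (r, θ) = 2 * t * (u b θ - u a θ) + t ^ 2 / a * (b - a) := by
    intro θ
    have hac := lip_ac (fun x y => hu.rad x y θ) a b
    have hGint : ∀ x y, x ≤ y → IntervalIntegrable (fun r => G (r, θ)) volume x y := fun x y hxy =>
      bm_int (hGm.comp (measurable_id.prodMk measurable_const)) hxy (fun r _ => hGb0 r θ)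
    rw [← intervalIntegral.integral_add_adjacent_intervals (hGint 0 a ha.le) (hGint a b hab.le)]
    have eA : ∫ r in (0:ℝ)..a, G (r, θ) = 0 := by
      rw [intervalIntegral.integral_of_le ha.le]
      refine setIntegral_eq_zero_of_forall_eq_zero fun r hr => ?_
      simp only [hG, if_pos hr.2]
    have eB : ∫ r in a..b, G (r, θ) = ∫ r in a..b, (2 * t * deriv (fun s => u s θ) r + t ^ 2 / a) := by
      rw [intervalIntegral.integral_of_le hab.le, intervalIntegral.integral_of_le hab.le]
      refine setIntegral_congr_fun measurableSet_Ioc fun r hr => ?_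
      simp only [hG, if_neg (not_le.2 hr.1)]
    rw [eA, eB, intervalIntegral.integral_add (hac.intervalIntegrable_deriv.const_mul _) (by simp),
      intervalIntegral.integral_const_mul, hac.integral_deriv_eq_sub]
    simp; ring
  simp only [inner] at h1
  have i1 : ∀ r, IntervalIntegrable (fun θ => u r θ) volume 0 l := fun r => (hu.cont_t r).intervalIntegrable 0 l
  rw [intervalIntegral.integral_add (((i1 b).sub (i1 a)).const_mul _) (by simp), intervalIntegral.integral_const_mul,
    intervalIntegral.integral_sub (i1 b) (i1 a)] at h1
  simp at h1
  have : 0 ≤ t * (2 * ((∫ θ in (0:ℝ)..l, u b θ) - ∫ θ in (0:ℝ)..l, u a θ) + t * (l * ((b - a) / a))) := by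
    convert h1 using 1; ring
  exact nonneg_of_mul_nonneg_right this ht

lemma mv {l lp K ε : ℝ} {u : ℝ → ℝ → ℝ} (hl : 0 < l) (hlp : 0 ≤ lp)
    (hu : PLip l K u) (hm : PMin l lp 0 u) (hv : ∀ θ, u 0 θ = 0) (hε1 : ε ≤ 1)
    (hneg : ∀ r ∈ Icc 0 ε, ∀ θ, u r θ ≤ 0) : ∀ r ∈ Icc 0 ε, ∀ θ, u r θ = 0 := by
  intro b hb θ
  have hK := hu.K_nonneg
  rcases hb.1.eq_or_lt with h0 | h0
  · rw [← h0, hv]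
  have i1 : ∀ r, IntervalIntegrable (fun θ => u r θ) volume 0 l := fun r => (hu.cont_t r).intervalIntegrable 0 l
  have h1 : ∀ a, 0 < a → a < b → (∫ θ in (0:ℝ)..l, u a θ) ≤ ∫ θ in (0:ℝ)..l, u b θ := by
    intro a ha hab
    by_contra hc
    push Not at hc
    set D := (∫ θ in (0:ℝ)..l, u a θ) - ∫ θ in (0:ℝ)..l, u b θ with hD
    have hDp : 0 < D := by rw [hD]; linarith
    set C := l * ((b - a) / a) with hC
    have hCp : 0 < C := by rw [hC]; exact mul_pos hl (div_pos (by linarith) ha)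
    have := mv_step hl hlp hu hm hε1 hneg ha hab hb.2 (div_pos hDp hCp)
    rw [← hC, div_mul_cancel₀ _ hCp.ne'] at this
    linarith
  have h2 : 0 ≤ ∫ θ in (0:ℝ)..l, u b θ := by
    by_contra hc
    push Not at hc
    set D := ∫ θ in (0:ℝ)..l, u b θ with hD
    have hp : 0 < l * (K + 1) := by positivity
    set a := min (b / 2) (-D / (2 * (l * (K + 1)))) with ha
    have ha0 : 0 < a := lt_min (by linarith) (div_pos (by linarith) (by linarith))
    have hab : a < b := (min_le_left _ _).trans_lt (by linarith)
    have h3 := h1 a ha0 hab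
    have h4 : ∫ θ in (0:ℝ)..l, (-K * a) ≤ ∫ θ in (0:ℝ)..l, u a θ := by
      refine intervalIntegral.integral_mono_on hl.le (by simp) (i1 a) fun x _ => ?_
      have := hu.rad a 0 x
      rw [hv, sub_zero, sub_zero, abs_of_pos ha0] at this
      have := neg_le_of_abs_le this
      linarith
    simp at h4
    have h5 : a ≤ -D / (2 * (l * (K + 1))) := min_le_right _ _
    rw [le_div_iff₀ (by linarith)] at h5
    nlinarith [mul_pos ha0 hl]
  have := cont_zero hl (g := fun θ => - u b θ) (hu.cont_t b).neg (fun x => by simp only [hu.per])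
    (fun x => by have := hneg b hb x; linarith) (by simp only [intervalIntegral.integral_neg]; linarith) θ
  simpa using this

end

section

open MeasureTheory Set

lemma inv_ac {δ r0 : ℝ} (hδ : 0 < δ) (h : δ ≤ r0) : AbsolutelyContinuousOnInterval (fun r : ℝ => r⁻¹) δ r0 := by
  have : LipschitzOnWith (1 / δ ^ 2).toNNReal (fun r : ℝ => r⁻¹) (uIcc δ r0) := by
    refine LipschitzOnWith.of_dist_le_mul fun x hx y hy => ?_
    rw [uIcc_of_le h] at hx hy
    have hx0 : 0 < x := hδ.trans_le hx.1
    have hy0 : 0 < y := hδ.trans_le hy.1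
    rw [Real.coe_toNNReal _ (by positivity), Real.dist_eq, Real.dist_eq]
    have : x⁻¹ - y⁻¹ = (y - x) / (x * y) := by field_simp
    rw [this, abs_div, abs_sub_comm, abs_of_pos (mul_pos hx0 hy0), div_eq_inv_mul, one_div]
    gcongr
    rw [sq]; exact mul_le_mul hx.1 hy.1 hδ.le hx0.le
  exact this.absolutelyContinuousOnInterval

lemma inv_sq_ac {δ r0 : ℝ} (hδ : 0 < δ) (h : δ ≤ r0) : AbsolutelyContinuousOnInterval (fun r : ℝ => (r ^ 2)⁻¹) δ r0 := by
  have := (inv_ac hδ h).fun_mul (inv_ac hδ h)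
  convert this using 2
  rw [sq, mul_inv]

lemma deriv_inv_sq {r : ℝ} (hr : r ≠ 0) : deriv (fun r : ℝ => (r ^ 2)⁻¹) r = -2 * (r ^ 3)⁻¹ := by
  have h := (hasDerivAt_pow 2 r).fun_inv (by positivity)
  rw [h.deriv]; field_simp; norm_num; ring

/-- homogeneous energy of the trace at radius `r` -/
def EE (l lp lm : ℝ) (u : ℝ → ℝ → ℝ) (r : ℝ) : ℝ :=
  ∫ θ in (0:ℝ)..l, ((u r θ / r) ^ 2 + (den lp lm u (r, θ) - (deriv (fun s => u s θ) r) ^ 2))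

lemma sq_le_of_abs {x K : ℝ} (h : |x| ≤ K) : x ^ 2 ≤ K ^ 2 :=
  sq_le_sq' (neg_le_of_abs_le h) (le_of_abs_le h)

lemma weiss_bound {l lp lm K γ r0 δ : ℝ} {u : ℝ → ℝ → ℝ} (hl : 0 < l) (hlp : 0 ≤ lp) (hlm : 0 ≤ lm)
    (hu : PLip l K u) (hv : ∀ θ, u 0 θ = 0) (hδ : 0 < δ) (hδr : δ < r0)
    (H : ∀ r ∈ Ioo 0 r0, Jfun l lp lm u r + γ * r ^ 2 ≤ r ^ 2 / 2 * EE l lp lm u r) :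
    2 * γ * Real.log (r0 / δ) ≤ Jfun l lp lm u r0 / r0 ^ 2 + l * K ^ 2 := by
  have hK := hu.K_nonneg
  have hr0 : 0 < r0 := hδ.trans hδr
  have hub : ∀ r θ, 0 < r → |u r θ| ≤ K * r := by
    intro r θ hr
    have := hu.rad r 0 θ
    rwa [hv, sub_zero, sub_zero, abs_of_pos hr] at this
  have hqb : ∀ r θ, 0 < r → (u r θ / r) ^ 2 ≤ K ^ 2 := by
    intro r θ hr
    apply sq_le_of_abs
    rw [abs_div, abs_of_pos hr, div_le_iff₀ hr]; exact hub r θ hr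
  have hdb : ∀ r θ, (deriv (fun s => u s θ) r) ^ 2 ≤ K ^ 2 := fun r θ => sq_le_of_abs (hu.dr_le r θ)
  set ei : ℝ → ℝ := fun r => ∫ θ in (0:ℝ)..l, den lp lm u (r, θ) * r with hei
  have hI := hu.intOn hlp hlm r0
  have heii : IntervalIntegrable ei volume 0 r0 := fub_rt_int hl.le hr0.le hI
  set m : ℝ → ℝ := fun r => ∫ s in (0:ℝ)..r, ei s with hm
  have hmJ : ∀ r, 0 ≤ r → m r = Jfun l lp lm u r := by
    intro r hr
    rw [Jfun_eq, fub_rt hl.le hr (hu.intOn hlp hlm r)]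
  have hmac : AbsolutelyContinuousOnInterval m δ r0 := by
    have h1 := heii.absolutelyContinuousOnInterval_intervalIntegral (c := 0) (by simp)
    exact h1.mono (by rw [uIcc_of_le hδr.le, uIcc_of_le hr0.le]; exact Icc_subset_Icc_left hδ.le)
  have hmd := heii.ae_hasDerivAt_integral
  have hg := inv_sq_ac hδ hδr.le
  have k1 := hmac.integral_deriv_mul_eq_sub hg
  -- the function F
  set F : ℝ × ℝ → ℝ := fun p => if p.1 ≤ δ then 0 else
    ((u p.1 p.2 / p.1) ^ 2 - (deriv (fun s => u s p.2) p.1) ^ 2) / p.1 with hF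
  have hFm : Measurable F := by
    refine Measurable.ite (measurableSet_le measurable_fst measurable_const) measurable_const ?_
    exact ((((hu.meas.div measurable_fst).pow_const 2).sub (hu.meas_dr.pow_const 2))).div measurable_fst
  have hFb : ∀ r θ, |F (r, θ)| ≤ K ^ 2 / δ := by
    intro r θ
    simp only [hF]
    split_ifs with h
    · rw [abs_zero]; positivity
    · push Not at h
      have hr : 0 < r := hδ.trans h
      rw [abs_div, abs_of_pos hr]
      have h1 := hqb r θ hr
      have h2 := hdb r θ
      have h3 : |(u r θ / r) ^ 2 - (deriv (fun s => u s θ) r) ^ 2| ≤ K ^ 2 := by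
        rw [abs_le]; constructor <;> nlinarith [sq_nonneg (u r θ / r), sq_nonneg (deriv (fun s => u s θ) r)]
      exact div_le_div₀ (by positivity) h3 hδ h.le
  have hFi : IntegrableOn F (Om l r0) := intOn_Om hFm (fun p _ => hFb p.1 p.2)
  have hFr : ∀ θ x y, x ≤ y → IntervalIntegrable (fun r => F (r, θ)) volume x y := fun θ x y hxy =>
    bm_int (hFm.comp (measurable_id.prodMk measurable_const)) hxy (fun r _ => hFb r θ)
  have hFt : ∀ r, IntervalIntegrable (fun θ => F (r, θ)) volume 0 l := fun r =>
    bm_int (hFm.comp (measurable_const.prodMk measurable_id)) hl.le (fun θ _ => hFb r θ)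
  have hHi := fub_rt_int hl.le hr0.le hFi
  have hHi' : IntervalIntegrable (fun r => ∫ θ in (0:ℝ)..l, F (r, θ)) volume δ r0 :=
    hHi.mono_set (by rw [uIcc_of_le hδr.le, uIcc_of_le hr0.le]; exact Icc_subset_Icc_left hδ.le)
  have k2 : ∫ r in δ..r0, ∫ θ in (0:ℝ)..l, F (r, θ) = ∫ θ in (0:ℝ)..l, ∫ r in (0:ℝ)..r0, F (r, θ) := by
    rw [← fub_tr hl.le hr0.le hFi, fub_rt hl.le hr0.le hFi]
    have h1 : IntervalIntegrable (fun r => ∫ θ in (0:ℝ)..l, F (r, θ)) volume 0 δ :=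
      hHi.mono_set (by rw [uIcc_of_le hδ.le, uIcc_of_le hr0.le]; exact Icc_subset_Icc_right hδr.le)
    rw [← intervalIntegral.integral_add_adjacent_intervals h1 hHi']
    have : ∫ r in (0:ℝ)..δ, ∫ θ in (0:ℝ)..l, F (r, θ) = 0 := by
      rw [intervalIntegral.integral_of_le hδ.le]
      refine setIntegral_eq_zero_of_forall_eq_zero fun r hr => ?_
      simp only [hF, if_pos hr.2]; simp
    rw [this, zero_add]
  have k3 : ∀ θ, ∫ r in (0:ℝ)..r0, F (r, θ) ≤ K ^ 2 := by
    intro θ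
    rw [← intervalIntegral.integral_add_adjacent_intervals (hFr θ 0 δ hδ.le) (hFr θ δ r0 hδr.le)]
    have e1 : ∫ r in (0:ℝ)..δ, F (r, θ) = 0 := by
      rw [intervalIntegral.integral_of_le hδ.le]
      refine setIntegral_eq_zero_of_forall_eq_zero fun r hr => ?_
      simp only [hF, if_pos hr.2]
    rw [e1, zero_add]
    have hlu : ∀ x y, |u x θ - u y θ| ≤ K * |x - y| := fun x y => hu.rad x y θ
    have hau := lip_ac hlu δ r0
    have hau2 := hau.fun_mul hau
    have k := hau2.integral_deriv_mul_eq_sub hg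
    have hIntg : IntervalIntegrable (fun x => deriv (fun x => u x θ * u x θ) x * (x ^ 2)⁻¹ +
      (u x θ * u x θ) * deriv (fun r : ℝ => (r ^ 2)⁻¹) x) volume δ r0 :=
      (hau2.intervalIntegrable_deriv.mul_continuousOn hg.continuousOn).add
      (hg.intervalIntegrable_deriv.continuousOn_mul hau2.continuousOn)
    have hle : ∫ r in δ..r0, F (r, θ) ≤ ∫ x in δ..r0, -(deriv (fun x => u x θ * u x θ) x * (x ^ 2)⁻¹ +
      (u x θ * u x θ) * deriv (fun r : ℝ => (r ^ 2)⁻¹) x) := by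
      rw [intervalIntegral.integral_of_le hδr.le, intervalIntegral.integral_of_le hδr.le]
      refine setIntegral_mono_on_ae ?_ ?_ measurableSet_Ioc ?_
      · exact (intervalIntegrable_iff_integrableOn_Ioc_of_le hδr.le).1 (hFr θ δ r0 hδr.le)
      · exact (intervalIntegrable_iff_integrableOn_Ioc_of_le hδr.le).1 hIntg.neg
      · filter_upwards [(lip_of hlu).ae_differentiableAt_real] with r hd hr
        have hr' : 0 < r := hδ.trans hr.1
        rw [deriv_inv_sq hr'.ne', (hd.hasDerivAt.fun_mul hd.hasDerivAt).deriv]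
        simp only [hF, if_neg (not_le.2 hr.1)]
        set X := deriv (fun s => u s θ) r
        set U := u r θ
        have : -((X * U + U * X) * (r ^ 2)⁻¹ + U * U * (-2 * (r ^ 3)⁻¹)) - ((U / r) ^ 2 - X ^ 2) / r = (U / r - X) ^ 2 / r := by
          field_simp; ring
        have h2 : 0 ≤ (U / r - X) ^ 2 / r := by positivity
        linarith
    rw [intervalIntegral.integral_neg, k] at hle
    have h1 := hqb δ θ hδ
    have h2 : 0 ≤ u r0 θ * u r0 θ * (r0 ^ 2)⁻¹ := mul_nonneg (mul_self_nonneg _) (by positivity)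
    have h3 : (u δ θ / δ) ^ 2 = u δ θ * u δ θ * (δ ^ 2)⁻¹ := by field_simp
    linarith
  have k4 : ∫ r in δ..r0, ∫ θ in (0:ℝ)..l, F (r, θ) ≤ l * K ^ 2 := by
    rw [k2]
    have := intervalIntegral.integral_mono_on hl.le (fub_tr_int hl.le hr0.le hFi)
      (by simp : IntervalIntegrable (fun _ => K ^ 2) volume 0 l) (fun θ _ => k3 θ)
    simpa using this
  have hIntg : IntervalIntegrable (fun x => deriv m x * (x ^ 2)⁻¹ +
      m x * deriv (fun r : ℝ => (r ^ 2)⁻¹) x) volume δ r0 :=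
    (hmac.intervalIntegrable_deriv.mul_continuousOn hg.continuousOn).add
      (hg.intervalIntegrable_deriv.continuousOn_mul hmac.continuousOn)
  have hinv : IntervalIntegrable (fun r => 2 * γ * (1 / r)) volume δ r0 := by
    have := (inv_ac hδ hδr.le).continuousOn.intervalIntegrable (μ := volume)
    simpa only [one_div] using this.const_mul (2 * γ)
  have k5 : ∫ r in δ..r0, 2 * γ * (1 / r) ≤ ∫ r in δ..r0, ((deriv m r * (r ^ 2)⁻¹ +
      m r * deriv (fun r : ℝ => (r ^ 2)⁻¹) r) + ∫ θ in (0:ℝ)..l, F (r, θ)) := by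
    rw [intervalIntegral.integral_of_le hδr.le, intervalIntegral.integral_of_le hδr.le]
    refine setIntegral_mono_on_ae ?_ ?_ measurableSet_Ioc ?_
    · exact (intervalIntegrable_iff_integrableOn_Ioc_of_le hδr.le).1 hinv
    · exact (intervalIntegrable_iff_integrableOn_Ioc_of_le hδr.le).1 (hIntg.add hHi')
    · filter_upwards [hmd, Measure.ae_ne volume r0] with r hd hne hr
      have hr' : 0 < r := hδ.trans hr.1
      have hlt : r < r0 := lt_of_le_of_ne hr.2 hne
      have hd' := (hd (by rw [uIcc_of_le hr0.le]; exact ⟨hr'.le, hr.2⟩) 0 (by simp)).deriv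
      rw [hd', deriv_inv_sq hr'.ne', hmJ r hr'.le]
      have hH := H r ⟨hr', hlt⟩
      have hdm : Measurable fun θ => den lp lm u (r, θ) := (hu.meas_den lp lm).comp (measurable_const.prodMk measurable_id)
      have hdi : IntervalIntegrable (fun θ => den lp lm u (r, θ)) volume 0 l := by
        refine bm_int hdm hl.le (C := 2 * K ^ 2 + lp + lm) fun θ _ => ?_
        rw [abs_of_nonneg (PLip.den_nonneg hlp hlm _)]; exact hu.den_le hlp hlm _
      have e2 : ∫ θ in (0:ℝ)..l, F (r, θ) = (EE l lp lm u r - ∫ θ in (0:ℝ)..l, den lp lm u (r, θ)) / r := by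
        have : EE l lp lm u r = (∫ θ in (0:ℝ)..l, den lp lm u (r, θ)) + r * ∫ θ in (0:ℝ)..l, F (r, θ) := by
          rw [EE, ← intervalIntegral.integral_const_mul, ← intervalIntegral.integral_add hdi ((hFt r).const_mul r)]
          congr 1; funext θ
          simp only [hF, if_neg (not_le.2 hr.1)]; field_simp; ring
        rw [this]; field_simp; ring
      rw [e2]
      have e3 : ei r = r * ∫ θ in (0:ℝ)..l, den lp lm u (r, θ) := by
        simp only [hei]; rw [intervalIntegral.integral_mul_const]; ring
      rw [e3]
      set J := Jfun l lp lm u r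
      set E := EE l lp lm u r
      set D := ∫ θ in (0:ℝ)..l, den lp lm u (r, θ)
      have : (r * D * (r ^ 2)⁻¹ + J * (-2 * (r ^ 3)⁻¹) + (E - D) / r) - 2 * γ * (1 / r) =
        (2 / r ^ 3) * (r ^ 2 / 2 * E - (J + γ * r ^ 2)) := by field_simp; ring
      have h2 : 0 ≤ (2 / r ^ 3) * (r ^ 2 / 2 * E - (J + γ * r ^ 2)) := mul_nonneg (by positivity) (by linarith)
      linarith
  rw [intervalIntegral.integral_const_mul, integral_one_div_of_pos hδ hr0, intervalIntegral.integral_add hIntg hHi', k1, hmJ r0 hr0.le,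
    hmJ δ hδ.le] at k5
  have h1 : 0 ≤ Jfun l lp lm u δ * (δ ^ 2)⁻¹ := by
    refine mul_nonneg ?_ (by positivity)
    rw [Jfun_eq]
    exact setIntegral_nonneg (measurableSet_Om l δ) fun p hp => mul_nonneg (PLip.den_nonneg hlp hlm p) hp.1.1.le
  rw [div_eq_mul_inv (Jfun l lp lm u r0)]
  linarith

lemma weiss {l lp lm K γ r0 : ℝ} {u : ℝ → ℝ → ℝ} (hl : 0 < l) (hlp : 0 ≤ lp) (hlm : 0 ≤ lm)
    (hu : PLip l K u) (hv : ∀ θ, u 0 θ = 0) (hr0 : 0 < r0) (hγ : 0 < γ) :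
    ∃ r ∈ Ioo 0 r0, EE l lp lm u r / 2 < Jfun l lp lm u r / r ^ 2 + γ := by
  by_contra hc
  push Not at hc
  have H : ∀ r ∈ Ioo 0 r0, Jfun l lp lm u r + γ * r ^ 2 ≤ r ^ 2 / 2 * EE l lp lm u r := by
    intro r hr
    have hr' := hr.1
    have := mul_le_mul_of_nonneg_left (hc r hr) (by positivity : 0 ≤ r ^ 2)
    have e : r ^ 2 * (Jfun l lp lm u r / r ^ 2 + γ) = Jfun l lp lm u r + γ * r ^ 2 := by field_simp
    linarith
  set C := Jfun l lp lm u r0 / r0 ^ 2 + l * K ^ 2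
  set δ := r0 * Real.exp (-(|C| + 1) / (2 * γ)) with hδ
  have hδ0 : 0 < δ := by positivity
  have hlt : δ < r0 := by
    rw [hδ]
    have : Real.exp (-(|C| + 1) / (2 * γ)) < 1 := by
      rw [Real.exp_lt_one_iff]
      apply div_neg_of_neg_of_pos <;> [skip; positivity]
      have := abs_nonneg C; linarith
    nlinarith
  have := weiss_bound hl hlp hlm hu hv hδ0 hlt H
  have e : Real.log (r0 / δ) = (|C| + 1) / (2 * γ) := by
    rw [hδ, div_mul_eq_div_div, div_self hr0.ne', one_div, ← Real.exp_neg, Real.log_exp]; ring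
  rw [e] at this
  have e2 : 2 * γ * ((|C| + 1) / (2 * γ)) = |C| + 1 := by field_simp
  rw [e2] at this
  have := le_abs_self C
  linarith

end

section

open MeasureTheory Set Filter

/-- one-homogeneous extension -/
def zU (f : ℝ → ℝ) (r θ : ℝ) : ℝ := r * f θ

/-- Lipschitz bounded periodic functions of one variable -/
structure TLip (l K : ℝ) (f : ℝ → ℝ) : Prop where
  per : ∀ θ, f (θ + l) = f θ
  lip : ∀ x y, |f x - f y| ≤ K * |x - y|
  bd : ∀ x, |f x| ≤ K

lemma TLip.K_nonneg {l K : ℝ} {f : ℝ → ℝ} (h : TLip l K f) : 0 ≤ K := (abs_nonneg _).trans (h.bd 0)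
lemma TLip.cont {l K : ℝ} {f : ℝ → ℝ} (h : TLip l K f) : Continuous f := (lip_of h.lip).continuous
lemma TLip.d_le {l K : ℝ} {f : ℝ → ℝ} (h : TLip l K f) (x : ℝ) : |deriv f x| ≤ K := deriv_le_of h.K_nonneg h.lip x

lemma TLip.zU {l K : ℝ} {f : ℝ → ℝ} (h : TLip l K f) : PLip l K (zU f) := by
  refine ⟨fun r θ => by simp only [_root_.zU, h.per], fun r s θ => ?_, fun r θ φ => ?_⟩
  · have : _root_.zU f r θ - _root_.zU f s θ = (r - s) * f θ := by simp only [_root_.zU]; ring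
    rw [this, abs_mul, mul_comm]
    exact mul_le_mul_of_nonneg_right (h.bd θ) (abs_nonneg _)
  · have : _root_.zU f r θ - _root_.zU f r φ = r * (f θ - f φ) := by simp only [_root_.zU]; ring
    rw [this, abs_mul]
    have := mul_le_mul_of_nonneg_left (h.lip θ φ) (abs_nonneg r)
    linarith

lemma PLip.trace {l K r : ℝ} {u : ℝ → ℝ → ℝ} (h : PLip l K u) (hv : ∀ θ, u 0 θ = 0) (hr : 0 < r) :
    TLip l K (fun θ => u r θ / r) := by
  refine ⟨fun θ => by simp only [h.per], fun x y => ?_, fun x => ?_⟩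
  · rw [← sub_div, abs_div, abs_of_pos hr, div_le_iff₀ hr]
    have := h.ang r x y
    rw [abs_of_pos hr] at this; linarith
  · rw [abs_div, abs_of_pos hr, div_le_iff₀ hr]
    have := h.rad r 0 x
    rwa [hv, sub_zero, sub_zero, abs_of_pos hr] at this

/-- density of the homogeneous energy -/
def hden (lp lm : ℝ) (f : ℝ → ℝ) (θ : ℝ) : ℝ :=
  f θ ^ 2 + deriv f θ ^ 2 + (if 0 < f θ then lp else 0) + (if f θ < 0 then lm else 0)

def HE (l lp lm : ℝ) (f : ℝ → ℝ) : ℝ := ∫ θ in (0:ℝ)..l, hden lp lm f θ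

lemma den_zU (lp lm : ℝ) (f : ℝ → ℝ) {r : ℝ} (hr : 0 < r) (θ : ℝ) : den lp lm (zU f) (r, θ) = hden lp lm f θ := by
  have h1 : deriv (fun s => s * f θ) r = f θ := by simp
  have h2 : deriv (fun φ => r * f φ) θ = r * deriv f θ := by simp
  simp only [den, gradSq, hden, zU, h1, h2]
  have e1 : (0 < r * f θ) ↔ 0 < f θ := by simp [hr]
  have e2 : (r * f θ < 0) ↔ f θ < 0 := by
    constructor
    · intro h; by_contra hc; push Not at hc; have := mul_nonneg hr.le hc; linarith
    · intro h; exact mul_neg_of_pos_of_neg hr h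
  simp only [e1, e2]
  field_simp

lemma Jfun_zU {l lp lm K : ℝ} (hl : 0 < l) (hlp : 0 ≤ lp) (hlm : 0 ≤ lm) {f : ℝ → ℝ} (h : TLip l K f) :
    Jfun l lp lm (zU f) 1 = HE l lp lm f / 2 := by
  rw [Jfun_eq, fub_tr hl.le zero_le_one (h.zU.intOn hlp hlm 1), HE, ← intervalIntegral.integral_div]
  congr 1; funext θ
  have : ∫ r in (0:ℝ)..1, den lp lm (zU f) (r, θ) * r = ∫ r in (0:ℝ)..1, hden lp lm f θ * r := by
    rw [intervalIntegral.integral_of_le zero_le_one, intervalIntegral.integral_of_le zero_le_one]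
    refine setIntegral_congr_fun measurableSet_Ioc fun r hr => ?_
    simp only [den_zU lp lm f hr.1]
  rw [this, intervalIntegral.integral_const_mul, integral_id]; ring

lemma EE_eq (l lp lm : ℝ) (u : ℝ → ℝ → ℝ) {r : ℝ} (hr : 0 < r) :
    EE l lp lm u r = HE l lp lm (fun θ => u r θ / r) := by
  unfold EE HE
  congr 1; funext θ
  have h2 : deriv (fun φ => u r φ / r) θ = deriv (fun φ => u r φ) θ / r := by simp
  have e1 : (0 < u r θ / r) ↔ 0 < u r θ := by simp [hr]
  have e2 : (u r θ / r < 0) ↔ u r θ < 0 := by rw [div_lt_iff₀ hr, zero_mul]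
  simp only [den, gradSq, hden, h2, e1, e2, div_pow]; ring

/-- lower semicontinuity, gradient part -/
lemma lsc_grad {l K γ : ℝ} (hl : 0 < l) {f : ℝ → ℝ} (hf : TLip l K f) (hγ : 0 < γ) :
    ∃ ε > 0, ∀ g, TLip l K g → (∀ θ, |g θ - f θ| ≤ ε) →
      ∫ θ in (0:ℝ)..l, deriv f θ ^ 2 ≤ (∫ θ in (0:ℝ)..l, deriv g θ ^ 2) + γ := by
  have hK := hf.K_nonneg
  set φ : ℕ → ℝ → ℝ := fun n θ => (f (θ + 1 / (n + 1 : ℝ)) - f θ) / (1 / (n + 1 : ℝ)) with hφ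
  have hpos : ∀ n : ℕ, (0:ℝ) < 1 / (n + 1 : ℝ) := fun n => Nat.one_div_pos_of_nat
  have hφc : ∀ n, Continuous (φ n) := fun n => by
    have := hf.cont
    simp only [hφ]; fun_prop
  have hφb : ∀ n θ, |φ n θ| ≤ K := by
    intro n θ
    simp only [hφ]
    rw [abs_div, abs_of_pos (hpos n), div_le_iff₀ (hpos n)]
    have := hf.lip (θ + 1 / (n + 1 : ℝ)) θ
    rwa [add_sub_cancel_left, abs_of_pos (hpos n)] at this
  have hm' : ∀ g : ℝ → ℝ, Measurable (deriv g) := fun g => measurable_deriv g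
  have hlim : Tendsto (fun n => ∫ θ in (0:ℝ)..l, (deriv f θ - φ n θ) ^ 2) atTop (nhds (∫ θ in (0:ℝ)..l, (0:ℝ))) := by
    refine intervalIntegral.tendsto_integral_filter_of_dominated_convergence (fun _ => (2 * K) ^ 2) ?_ ?_ (by simp) ?_
    · exact Eventually.of_forall fun n => (((hm' f).sub (hφc n).measurable).pow_const 2).aestronglyMeasurable
    · refine Eventually.of_forall fun n => Eventually.of_forall fun θ _ => ?_
      rw [Real.norm_eq_abs, abs_of_nonneg (sq_nonneg _)]
      apply sq_le_of_abs
      refine (abs_sub _ _).trans ?_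
      linarith [hf.d_le θ, hφb n θ]
    · filter_upwards [(lip_of hf.lip).ae_differentiableAt_real] with θ hd _
      have h1 := hd.hasDerivAt.tendsto_slope_zero_right
      have h2 : Tendsto (fun n : ℕ => 1 / (n + 1 : ℝ)) atTop (nhdsWithin 0 (Ioi 0)) := by
        rw [tendsto_nhdsWithin_iff]
        exact ⟨tendsto_one_div_add_atTop_nhds_zero_nat, Eventually.of_forall hpos⟩
      have h3 := h1.comp h2
      have h4 : Tendsto (fun n => φ n θ) atTop (nhds (deriv f θ)) := by
        refine h3.congr fun n => ?_
        simp only [hφ, Function.comp, smul_eq_mul]; exact (div_eq_inv_mul _ _).symm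
      have h5 := (tendsto_const_nhds (x := deriv f θ)).sub h4
      have h6 := h5.pow 2
      simpa using h6
  simp only [intervalIntegral.integral_zero] at hlim
  obtain ⟨n, hn⟩ := (hlim.eventually (gt_mem_nhds (half_pos hγ))).exists
  set h := 1 / (n + 1 : ℝ) with hh
  have hhp : 0 < h := hpos n
  have hφl : ∀ x y, |φ n x - φ n y| ≤ (2 * K / h) * |x - y| := by
    intro x y
    have : φ n x - φ n y = ((f (x + h) - f (y + h)) - (f x - f y)) / h := by simp only [hφ, ← hh]; ring
    rw [this, abs_div, abs_of_pos hhp, div_le_iff₀ hhp]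
    refine (abs_sub _ _).trans ?_
    have h1 := hf.lip (x + h) (y + h)
    have h2 := hf.lip x y
    rw [add_sub_add_right_eq_sub] at h1
    have : 2 * K / h * |x - y| * h = 2 * K * |x - y| := by field_simp
    linarith
  set C := 2 * (l * (2 * K / h)) with hC
  have hCp : 0 ≤ C := by positivity
  refine ⟨γ / (2 * (C + 1)), by positivity, fun g hg hgf => ?_⟩
  set ε := γ / (2 * (C + 1)) with hε
  have hi : ∀ g : ℝ → ℝ, TLip l K g → IntervalIntegrable (fun θ => deriv g θ ^ 2) volume 0 l := fun g hg =>
    bm_int ((hm' g).pow_const 2) hl.le (C := K ^ 2) fun θ _ => by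
      rw [abs_of_nonneg (sq_nonneg _)]; exact sq_le_of_abs (hg.d_le θ)
  have hi2 : ∀ g : ℝ → ℝ, TLip l K g → IntervalIntegrable (fun θ => deriv g θ * φ n θ) volume 0 l := fun g hg =>
    bm_int ((hm' g).mul (hφc n).measurable) hl.le (C := K * K) fun θ _ => by
      rw [Pi.mul_apply, abs_mul]; exact mul_le_mul (hg.d_le θ) (hφb n θ) (abs_nonneg _) hK
  have hi3 : IntervalIntegrable (fun θ => φ n θ ^ 2) volume 0 l := ((hφc n).pow 2).intervalIntegrable 0 l
  -- integration by parts
  have hibp : ∀ g : ℝ → ℝ, TLip l K g → ∫ θ in (0:ℝ)..l, deriv g θ * φ n θ = - ∫ θ in (0:ℝ)..l, g θ * deriv (φ n) θ := by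
    intro g hg
    have a1 := lip_ac hg.lip 0 l
    have a2 := lip_ac hφl 0 l
    have := a1.integral_deriv_mul_eq_sub a2
    rw [intervalIntegral.integral_add (hi2 g hg) (a2.intervalIntegrable_deriv.continuousOn_mul a1.continuousOn)] at this
    have e1 : g l = g 0 := by have := hg.per 0; rwa [zero_add] at this
    have e2 : φ n l = φ n 0 := by
      have h1 := hf.per 0
      have h2 := hf.per (0 + h)
      simp only [hφ, ← hh]
      rw [zero_add] at h1; rw [h1, ← h2]; congr 3; ring
    rw [e1, e2] at this; linarith
  have hdiff : |(∫ θ in (0:ℝ)..l, deriv g θ * φ n θ) - ∫ θ in (0:ℝ)..l, deriv f θ * φ n θ| ≤ ε * (l * (2 * K / h)) := by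
    rw [hibp g hg, hibp f hf]
    have a2 := (lip_ac hφl 0 l).intervalIntegrable_deriv
    have i1 := a2.continuousOn_mul hg.cont.continuousOn
    have i2 := a2.continuousOn_mul hf.cont.continuousOn
    have : -(∫ θ in (0:ℝ)..l, g θ * deriv (φ n) θ) - -(∫ θ in (0:ℝ)..l, f θ * deriv (φ n) θ) =
      - ∫ θ in (0:ℝ)..l, (g θ - f θ) * deriv (φ n) θ := by
      have : ∀ θ, (g θ - f θ) * deriv (φ n) θ = g θ * deriv (φ n) θ - f θ * deriv (φ n) θ := fun θ => by ring
      simp only [this]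
      rw [intervalIntegral.integral_sub i1 i2]; ring
    rw [this, abs_neg]
    have := intervalIntegral.norm_integral_le_of_norm_le_const (a := 0) (b := l) (C := ε * (2 * K / h)) (f := fun θ => (g θ - f θ) * deriv (φ n) θ) (fun θ _ => by
      rw [Real.norm_eq_abs, abs_mul]
      exact mul_le_mul (hgf θ) (deriv_le_of (by positivity) hφl θ) (abs_nonneg _) (by positivity))
    rw [Real.norm_eq_abs, sub_zero, abs_of_pos hl] at this
    linarith
  have hA : 0 ≤ (∫ θ in (0:ℝ)..l, deriv g θ ^ 2) - 2 * (∫ θ in (0:ℝ)..l, deriv g θ * φ n θ) + ∫ θ in (0:ℝ)..l, φ n θ ^ 2 := by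
    rw [← intervalIntegral.integral_const_mul, ← intervalIntegral.integral_sub (hi g hg) ((hi2 g hg).const_mul 2),
      ← intervalIntegral.integral_add ((hi g hg).sub ((hi2 g hg).const_mul 2)) hi3]
    refine intervalIntegral.integral_nonneg hl.le fun θ _ => ?_
    nlinarith [sq_nonneg (deriv g θ - φ n θ)]
  have hB : ∫ θ in (0:ℝ)..l, (deriv f θ - φ n θ) ^ 2 = (∫ θ in (0:ℝ)..l, deriv f θ ^ 2) - 2 * (∫ θ in (0:ℝ)..l, deriv f θ * φ n θ) + ∫ θ in (0:ℝ)..l, φ n θ ^ 2 := by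
    rw [← intervalIntegral.integral_const_mul, ← intervalIntegral.integral_sub (hi f hf) ((hi2 f hf).const_mul 2),
      ← intervalIntegral.integral_add ((hi f hf).sub ((hi2 f hf).const_mul 2)) hi3]
    congr 1; funext θ; ring
  rw [hB] at hn
  have hd := abs_le.1 hdiff
  have : 2 * (ε * (l * (2 * K / h))) ≤ γ / 2 := by
    have : 2 * (ε * (l * (2 * K / h))) = ε * C := by rw [hC]; ring
    rw [this, hε, div_mul_eq_mul_div, div_le_iff₀ (by positivity)]
    nlinarith
  linarith [hd.1, hd.2]

lemma lsc_area {l c γ : ℝ} (hl : 0 < l) (hc : 0 ≤ c) {f : ℝ → ℝ} (hf : Continuous f) (hγ : 0 < γ) :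
    ∃ ε > 0, ∀ g : ℝ → ℝ, Continuous g → (∀ θ, |g θ - f θ| ≤ ε) →
      ∫ θ in (0:ℝ)..l, (if 0 < f θ then c else 0) ≤ (∫ θ in (0:ℝ)..l, (if 0 < g θ then c else 0)) + γ := by
  have hm : ∀ (g : ℝ → ℝ) (a : ℝ), Continuous g → Measurable fun θ => if a < g θ then c else 0 := fun g a hg =>
    Measurable.ite (measurableSet_lt measurable_const hg.measurable) measurable_const measurable_const
  have hb : ∀ (g : ℝ → ℝ) (a θ : ℝ), |if a < g θ then c else 0| ≤ c := by
    intro g a θ; split_ifs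
    · rw [abs_of_nonneg hc]
    · simpa using hc
  have hlim : Tendsto (fun n : ℕ => ∫ θ in (0:ℝ)..l, (if 1 / (n + 1 : ℝ) < f θ then c else 0)) atTop
      (nhds (∫ θ in (0:ℝ)..l, (if 0 < f θ then c else 0))) := by
    refine intervalIntegral.tendsto_integral_filter_of_dominated_convergence (fun _ => c) ?_ ?_ (by simp) ?_
    · exact Eventually.of_forall fun n => (hm f _ hf).aestronglyMeasurable
    · exact Eventually.of_forall fun n => Eventually.of_forall fun θ _ => hb f _ θ
    · refine Eventually.of_forall fun θ _ => ?_
      refine tendsto_const_nhds.congr' ?_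
      by_cases h : 0 < f θ
      · filter_upwards [tendsto_one_div_add_atTop_nhds_zero_nat.eventually (gt_mem_nhds h)] with n hn
        rw [if_pos h, if_pos hn]
      · refine Eventually.of_forall fun n => ?_
        have : (0:ℝ) < 1 / (n + 1 : ℝ) := Nat.one_div_pos_of_nat
        have h' : ¬ (1 / (n + 1 : ℝ) < f θ) := by intro hh; apply h; linarith
        simp only [if_neg h, if_neg h']
  obtain ⟨n, hn⟩ := (hlim.eventually (lt_mem_nhds (sub_lt_self _ hγ))).exists
  refine ⟨1 / (n + 1 : ℝ), Nat.one_div_pos_of_nat, fun g hg hgf => ?_⟩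
  have : ∫ θ in (0:ℝ)..l, (if 1 / (n + 1 : ℝ) < f θ then c else 0) ≤ ∫ θ in (0:ℝ)..l, (if 0 < g θ then c else 0) := by
    refine intervalIntegral.integral_mono_on hl.le (bm_int (hm f _ hf) hl.le (fun θ _ => hb f _ θ))
      (bm_int (hm g _ hg) hl.le (fun θ _ => hb g _ θ)) fun θ _ => ?_
    have h1 := neg_le_of_abs_le (hgf θ)
    split_ifs <;> linarith
  linarith

lemma HE_split {l lp lm K : ℝ} (hl : 0 < l) {f : ℝ → ℝ} (hf : TLip l K f) :
    HE l lp lm f = (∫ θ in (0:ℝ)..l, f θ ^ 2) + (∫ θ in (0:ℝ)..l, deriv f θ ^ 2)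
      + (∫ θ in (0:ℝ)..l, (if 0 < f θ then lp else 0)) + ∫ θ in (0:ℝ)..l, (if f θ < 0 then lm else 0) := by
  have i1 : IntervalIntegrable (fun θ => f θ ^ 2) volume 0 l := (hf.cont.pow 2).intervalIntegrable 0 l
  have i2 : IntervalIntegrable (fun θ => deriv f θ ^ 2) volume 0 l := 
    bm_int ((measurable_deriv f).pow_const 2) hl.le (C := K ^ 2) fun θ _ => by
      rw [abs_of_nonneg (sq_nonneg _)]; exact sq_le_of_abs (hf.d_le θ)
  have i3 : IntervalIntegrable (fun θ => if 0 < f θ then lp else 0) volume 0 l :=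
    bm_int (Measurable.ite (measurableSet_lt measurable_const hf.cont.measurable) measurable_const measurable_const)
      hl.le (C := |lp|) fun θ _ => by split_ifs <;> simp
  have i4 : IntervalIntegrable (fun θ => if f θ < 0 then lm else 0) volume 0 l :=
    bm_int (Measurable.ite (measurableSet_lt hf.cont.measurable measurable_const) measurable_const measurable_const)
      hl.le (C := |lm|) fun θ _ => by split_ifs <;> simp
  unfold HE hden
  rw [intervalIntegral.integral_add ((i1.add i2).add i3) i4, intervalIntegral.integral_add (i1.add i2) i3, intervalIntegral.integral_add i1 i2]

lemma HE_lsc {l lp lm K γ : ℝ} (hl : 0 < l) (hlp : 0 ≤ lp) (hlm : 0 ≤ lm) {f : ℝ → ℝ} (hf : TLip l K f) (hγ : 0 < γ) :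
    ∃ ε > 0, ∀ g, TLip l K g → (∀ θ, |g θ - f θ| ≤ ε) → HE l lp lm f ≤ HE l lp lm g + γ := by
  have hK := hf.K_nonneg
  have hγ4 : 0 < γ / 4 := by positivity
  obtain ⟨e1, he1, H1⟩ := lsc_grad hl hf hγ4
  obtain ⟨e2, he2, H2⟩ := lsc_area hl hlp hf.cont hγ4
  obtain ⟨e3, he3, H3⟩ := lsc_area (f := fun θ => - f θ) hl hlm hf.cont.neg hγ4
  set e4 := γ / (8 * (l * (K + 1))) with he4
  have he4p : 0 < e4 := by positivity
  refine ⟨min (min e1 e2) (min e3 e4), by positivity, fun g hg hgf => ?_⟩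
  have b1 : ∀ θ, |g θ - f θ| ≤ e1 := fun θ => (hgf θ).trans ((min_le_left _ _).trans (min_le_left _ _))
  have b2 : ∀ θ, |g θ - f θ| ≤ e2 := fun θ => (hgf θ).trans ((min_le_left _ _).trans (min_le_right _ _))
  have b3 : ∀ θ, |g θ - f θ| ≤ e3 := fun θ => (hgf θ).trans ((min_le_right _ _).trans (min_le_left _ _))
  have b4 : ∀ θ, |g θ - f θ| ≤ e4 := fun θ => (hgf θ).trans ((min_le_right _ _).trans (min_le_right _ _))
  have c1 := H1 g hg b1
  have c2 := H2 g hg.cont b2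
  have c3 := H3 (fun θ => - g θ) hg.cont.neg (fun θ => by
    have := b3 θ
    rw [abs_sub_comm] at this
    have e : -g θ - -f θ = f θ - g θ := by ring
    rw [e]; exact this)
  have c4 : ∫ θ in (0:ℝ)..l, f θ ^ 2 ≤ ∫ θ in (0:ℝ)..l, (g θ ^ 2 + 2 * K * e4) := by
    refine intervalIntegral.integral_mono_on hl.le ((hf.cont.pow 2).intervalIntegrable 0 l)
      (((hg.cont.pow 2).add continuous_const).intervalIntegrable 0 l) fun θ _ => ?_
    have h1 := abs_le.1 (hf.bd θ)
    have h2 := abs_le.1 (hg.bd θ)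
    have h3 := abs_le.1 (b4 θ)
    have h4 : |f θ ^ 2 - g θ ^ 2| ≤ 2 * K * e4 := by
      have : f θ ^ 2 - g θ ^ 2 = (f θ + g θ) * (f θ - g θ) := by ring
      rw [this, abs_mul]
      refine mul_le_mul ?_ ?_ (abs_nonneg _) (by positivity)
      · rw [abs_le]; constructor <;> linarith
      · rw [abs_sub_comm]; exact b4 θ
    linarith [le_of_abs_le h4]
  have ig2 : IntervalIntegrable (fun θ => g θ ^ 2) volume 0 l := (hg.cont.pow 2).intervalIntegrable 0 l
  rw [intervalIntegral.integral_add ig2 (by simp)] at c4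
  simp only [intervalIntegral.integral_const, sub_zero, smul_eq_mul] at c4
  have c5 : l * (2 * K * e4) ≤ γ / 4 := by
    have : l * (K + 1) * e4 = γ / 8 := by rw [he4]; field_simp
    nlinarith [mul_pos hl he4p]
  simp only [Left.neg_pos_iff] at c3
  rw [HE_split hl hf, HE_split hl hg]
  linarith

end

section

open MeasureTheory Set Filter

/-- the homogeneous extension of `f` minimizes on the unit ball -/
def HMin (l lp lm : ℝ) (f : ℝ → ℝ) : Prop :=
  ∀ (w : ℝ → ℝ → ℝ) (K : ℝ), PLip l K w → (∀ θ, w 1 θ = f θ) →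
    Jfun l lp lm (zU f) 1 ≤ Jfun l lp lm w 1

lemma tlip_compact {l K : ℝ} (hl : 0 < l) {F : ℕ → ℝ → ℝ} (hF : ∀ n, TLip l K (F n)) :
    ∃ f, TLip l K f ∧ ∀ ε > 0, ∀ N, ∃ k ≥ N, ∀ θ, |F k θ - f θ| ≤ ε := by
  have hK := (hF 0).K_nonneg
  set U : Ultrafilter ℕ := hyperfilter ℕ with hU
  have hlim : ∀ θ, ∃ y, Tendsto (fun n => F n θ) U (nhds y) := by
    intro θ
    have := isCompact_Icc.ultrafilter_le_nhds (s := Icc (-K) K) (U.map fun n => F n θ) (by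
      rw [Ultrafilter.coe_map, le_principal_iff]
      exact Filter.mem_map.2 (Filter.univ_mem' fun n => abs_le.1 ((hF n).bd θ)))
    obtain ⟨y, -, hy⟩ := this
    exact ⟨y, hy⟩
  choose f hf using hlim
  have hfT : TLip l K f := by
    refine ⟨fun θ => ?_, fun x y => ?_, fun x => ?_⟩
    · refine tendsto_nhds_unique (hf (θ + l)) ((hf θ).congr fun n => ((hF n).per θ).symm)
    · exact le_of_tendsto ((hf x).sub (hf y)).abs (Eventually.of_forall fun n => (hF n).lip x y)
    · exact le_of_tendsto (hf x).abs (Eventually.of_forall fun n => (hF n).bd x)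
  refine ⟨f, hfT, fun ε hε N => ?_⟩
  set h := ε / (3 * (K + 1)) with hh
  have hhp : 0 < h := by positivity
  have hKh : K * h ≤ ε / 3 := by
    have : (K + 1) * h = ε / 3 := by rw [hh]; field_simp
    nlinarith
  set M := ⌈l / h⌉₊ + 1 with hM
  have ev : ∀ᶠ n in (U : Filter ℕ), ∀ j ∈ Finset.range M, |F n (j * h) - f (j * h)| ≤ ε / 3 := by
    rw [Finset.eventually_all]
    intro j _
    have := (tendsto_iff_dist_tendsto_zero.1 (hf (j * h))).eventually (gt_mem_nhds (by positivity : 0 < ε / 3))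
    exact this.mono fun n hn => by rw [Real.dist_eq] at hn; exact hn.le
  have hUtop : (U : Filter ℕ) ≤ atTop := by rw [hU]; exact Nat.hyperfilter_le_atTop
  obtain ⟨k, hk1, hk2⟩ := (ev.and (hUtop (eventually_ge_atTop N))).exists
  refine ⟨k, hk2, ?_⟩
  have key : ∀ θ ∈ Ico 0 l, |F k θ - f θ| ≤ ε := by
    intro θ hθ
    set j := ⌊θ / h⌋₊ with hj
    have h1 : (j : ℝ) ≤ θ / h := Nat.floor_le (div_nonneg hθ.1 hhp.le)
    have h2 : θ / h < j + 1 := Nat.lt_floor_add_one _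
    rw [le_div_iff₀ hhp] at h1
    rw [div_lt_iff₀ hhp] at h2
    have hjM : j ∈ Finset.range M := by
      rw [Finset.mem_range, hM]
      have h3 : j ≤ ⌈l / h⌉₊ := by
        rw [hj]
        refine Nat.floor_le_of_le ?_
        refine le_trans ?_ (Nat.le_ceil _)
        exact div_le_div_of_nonneg_right hθ.2.le hhp.le
      omega
    have h3 := hk1 j hjM
    have h4 : |θ - j * h| ≤ h := by rw [abs_le]; constructor <;> linarith
    have h5 := ((hF k).lip θ (j * h)).trans (mul_le_mul_of_nonneg_left h4 hK)
    have h6 := (hfT.lip (j * h) θ)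
    rw [abs_sub_comm (j * h : ℝ)] at h6
    have h7 := h6.trans (mul_le_mul_of_nonneg_left h4 hK)
    have e : F k θ - f θ = (F k θ - F k (j * h)) + (F k (j * h) - f (j * h)) + (f (j * h) - f θ) := by ring
    rw [e]
    refine (abs_add_three _ _ _).trans ?_
    linarith
  intro θ
  have hp : Function.Periodic (fun θ => |F k θ - f θ|) l := fun x => by simp only [(hF k).per, hfT.per]
  obtain ⟨y, hy, hxy⟩ := hp.exists_mem_Ico₀ hl θ
  exact hxy ▸ key y hy

/-- perturbing the boundary values costs little -/
lemma bdry_comp {l lp lm K Kw δ ε : ℝ} (hl : 0 < l) (hlp : 0 ≤ lp) (hlm : 0 ≤ lm) {f g : ℝ → ℝ} (hf : TLip l K f)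
    (hg : TLip l K g) {w : ℝ → ℝ → ℝ} (hw : PLip l Kw w) (hwf : ∀ θ, w 1 θ = f θ) (hδ : 0 < δ) (hδ2 : δ ≤ 1 / 2)
    (hε : 0 < ε) (hεδ : ε ≤ δ) (hfg : ∀ θ, |g θ - f θ| ≤ ε) :
    ∃ w' K', PLip l K' w' ∧ (∀ θ, w' 1 θ = g θ) ∧
      Jfun l lp lm w' 1 ≤ Jfun l lp lm w 1 + l * (δ * ((Kw + 1) ^ 2 + (Kw + 4 * K) ^ 2 + lp + lm)) := by
  have hK := hf.K_nonneg
  have hKw := hw.K_nonneg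
  set η : ℝ → ℝ := fun r => max ((r - (1 - δ)) / δ) 0 with hη
  set d : ℝ → ℝ := fun θ => g θ - f θ with hd
  have hdl : ∀ x y, |d x - d y| ≤ 2 * K * |x - y| := by
    intro x y
    have : d x - d y = (g x - g y) - (f x - f y) := by simp only [hd]; ring
    rw [this]
    refine (abs_sub _ _).trans ?_
    linarith [hg.lip x y, hf.lip x y]
  have ηl : ∀ x y, |η x - η y| ≤ 1 / δ * |x - y| := by
    intro x y
    refine (abs_max_sub_max_le_abs _ _ 0).trans ?_
    have : (x - (1 - δ)) / δ - (y - (1 - δ)) / δ = 1 / δ * (x - y) := by ring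
    rw [this, abs_mul, abs_of_pos (by positivity : 0 < 1 / δ)]
  have ηn : ∀ r, 0 ≤ η r := fun r => le_max_right _ _
  have ηb : ∀ r, η r ≤ 1 / δ * |r| := by
    intro r
    refine max_le ?_ (by positivity)
    rw [div_eq_inv_mul, one_div]
    have : r - (1 - δ) ≤ |r| := by linarith [le_abs_self r]
    exact mul_le_mul_of_nonneg_left this (by positivity)
  have η1 : ∀ r, r ≤ 1 → η r ≤ 1 := by
    intro r hr
    refine max_le ?_ zero_le_one
    rw [div_le_one hδ]; linarith
  set w' : ℝ → ℝ → ℝ := fun r θ => w r θ + η r * d θ with hw'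
  have hrad : ∀ r s θ, |w' r θ - w' s θ| ≤ (Kw + ε / δ) * |r - s| := by
    intro r s θ
    have : w' r θ - w' s θ = (w r θ - w s θ) + (η r - η s) * d θ := by simp only [hw']; ring
    rw [this]
    refine (abs_add_le _ _).trans ?_
    rw [abs_mul]
    have h1 := mul_le_mul (ηl r s) (hfg θ) (abs_nonneg _) (by positivity)
    have h2 := hw.rad r s θ
    have : (Kw + ε / δ) * |r - s| = Kw * |r - s| + 1 / δ * |r - s| * ε := by ring
    linarith
  have hang : ∀ r θ φ, |w' r θ - w' r φ| ≤ (Kw * |r| + η r * (2 * K)) * |θ - φ| := by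
    intro r θ φ
    have : w' r θ - w' r φ = (w r θ - w r φ) + η r * (d θ - d φ) := by simp only [hw']; ring
    rw [this]
    refine (abs_add_le _ _).trans ?_
    rw [abs_mul, abs_of_nonneg (ηn r)]
    have h1 := mul_le_mul_of_nonneg_left (hdl θ φ) (ηn r)
    have h2 := hw.ang r θ φ
    linarith
  have hP : PLip l (Kw + ε / δ + 1 / δ * (2 * K)) w' := by
    refine ⟨fun r θ => by simp only [hw', hd, hw.per, hf.per, hg.per], fun r s θ => ?_, fun r θ φ => ?_⟩
    · refine (hrad r s θ).trans (mul_le_mul_of_nonneg_right ?_ (abs_nonneg _))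
      have : 0 ≤ 1 / δ * (2 * K) := by positivity
      linarith
    · refine (hang r θ φ).trans (mul_le_mul_of_nonneg_right ?_ (abs_nonneg _))
      have h1 := mul_le_mul_of_nonneg_right (ηb r) (by positivity : 0 ≤ 2 * K)
      have h2 : 0 ≤ ε / δ * |r| := by positivity
      nlinarith
  refine ⟨w', _, hP, fun θ => ?_, ?_⟩
  · simp only [hw', hη, hd]
    rw [hwf]
    have : (1 - (1 - δ)) / δ = 1 := by field_simp; ring
    rw [this]; simp
  set C := (Kw + 1) ^ 2 + (Kw + 4 * K) ^ 2 + lp + lm with hC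
  have hCp : 0 ≤ C := by positivity
  have e := Jfun_sub (R := 1) hlp hlm hw hP
  set G : ℝ × ℝ → ℝ := fun p => if p.1 ≤ 1 - δ then 0 else C with hG
  have hGm : Measurable G := Measurable.ite (measurableSet_le measurable_fst measurable_const) measurable_const measurable_const
  have hGb : ∀ r θ, |G (r, θ)| ≤ C := by
    intro r θ; simp only [hG]; split_ifs
    · simpa using hCp
    · rw [abs_of_nonneg hCp]
  have hGi : IntegrableOn G (Om l 1) := intOn_Om hGm (fun p _ => hGb p.1 p.2)
  have hle : ∫ p in Om l 1, (den lp lm w' p - den lp lm w p) * p.1 ≤ ∫ p in Om l 1, G p := by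
    refine setIntegral_mono_on_ae ?_ hGi (measurableSet_Om l 1) ?_
    · have := (hP.intOn hlp hlm 1).sub (hw.intOn hlp hlm 1)
      refine this.congr_fun (fun p _ => ?_) (measurableSet_Om l 1)
      simp only [Pi.sub_apply]; ring
    · filter_upwards [ae_fst_ne (1 - δ)] with p hne hp
      obtain ⟨r, θ⟩ := p
      obtain ⟨⟨hr0, hr1⟩, -⟩ := hp
      simp only at hne hr0 hr1
      rcases lt_or_gt_of_ne hne with hlt | hgt
      · have : den lp lm w' (r, θ) = den lp lm w (r, θ) := by
          apply den_congr
          filter_upwards [isOpen_Iio.mem_nhds hlt] with s hs φ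
          have : η s = 0 := by
            simp only [hη]; apply max_eq_right
            apply div_nonpos_of_nonpos_of_nonneg _ hδ.le
            simp only [mem_Iio] at hs; linarith
          simp only [hw', this]; ring
        rw [this]; simp [hG, hlt.le]
      · simp only [hG, if_neg (not_le.2 hgt)]
        have a1 : |deriv (fun s => w' s θ) r| ≤ Kw + 1 := by
          refine (deriv_le_of (by positivity) (fun x y => hrad x y θ) r).trans ?_
          have : ε / δ ≤ 1 := by rw [div_le_one hδ]; exact hεδ
          linarith
        have a2 : |deriv (fun φ => w' r φ) θ| ≤ (Kw + 4 * K) * r := by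
          refine (deriv_le_of (by have := ηn r; positivity) (fun x y => hang r x y) θ).trans ?_
          rw [abs_of_pos hr0]
          have := η1 r hr1.le
          nlinarith
        have a3 := sq_le_of_abs a1
        have a4 : (deriv (fun φ => w' r φ) θ) ^ 2 / r ^ 2 ≤ (Kw + 4 * K) ^ 2 := by
          rw [div_le_iff₀ (by positivity), ← mul_pow]; exact sq_le_of_abs a2
        have a5 : den lp lm w' (r, θ) ≤ C := by
          simp only [den, gradSq, hC]
          have i1 : (if 0 < w' r θ then lp else 0) ≤ lp := by split_ifs <;> linarith
          have i2 : (if w' r θ < 0 then lm else 0) ≤ lm := by split_ifs <;> linarith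
          linarith
        have a6 := PLip.den_nonneg (u := w) hlp hlm (r, θ)
        nlinarith
  rw [fub_tr hl.le zero_le_one hGi] at hle
  have inner : ∀ θ, ∫ r in (0:ℝ)..1, G (r, θ) = δ * C := by
    intro θ
    have hGint : ∀ x y, x ≤ y → IntervalIntegrable (fun r => G (r, θ)) volume x y := fun x y hxy =>
      bm_int (hGm.comp (measurable_id.prodMk measurable_const)) hxy (fun r _ => hGb r θ)
    rw [← intervalIntegral.integral_add_adjacent_intervals (hGint 0 (1 - δ) (by linarith)) (hGint (1 - δ) 1 (by linarith))]
    have eA : ∫ r in (0:ℝ)..(1 - δ), G (r, θ) = 0 := by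
      rw [intervalIntegral.integral_of_le (by linarith)]
      refine setIntegral_eq_zero_of_forall_eq_zero fun r hr => ?_
      simp only [hG, if_pos hr.2]
    have eB : ∫ r in (1 - δ)..1, G (r, θ) = ∫ r in (1 - δ)..1, C := by
      rw [intervalIntegral.integral_of_le (by linarith), intervalIntegral.integral_of_le (by linarith)]
      refine setIntegral_congr_fun measurableSet_Ioc fun r hr => ?_
      simp only [hG, if_neg (not_le.2 hr.1)]
    rw [eA, eB]; simp
  simp only [inner] at hle
  simp only [intervalIntegral.integral_const, sub_zero, smul_eq_mul] at hle
  linarith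

theorem blowup {l lp lm K : ℝ} {u : ℝ → ℝ → ℝ} (hl : 0 < l) (hlp : 0 ≤ lp) (hlm : 0 ≤ lm) (hu : PLip l K u)
    (hm : PMin l lp lm u) (hv : ∀ θ, u 0 θ = 0) :
    ∃ f, TLip l K f ∧ HMin l lp lm f ∧ ∀ ε > 0, ∃ r ∈ Ioo 0 1, ∀ θ, |u r θ / r - f θ| ≤ ε := by
  have hw := fun n : ℕ => weiss hl hlp hlm hu hv (r0 := 1) one_pos (Nat.one_div_pos_of_nat (n := n) : 0 < 1 / ((n:ℝ) + 1))
  choose r hr hgap using hw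
  have hT : ∀ n, TLip l K (fun θ => u (r n) θ / r n) := fun n => hu.trace hv (hr n).1
  obtain ⟨f, hf, hconv⟩ := tlip_compact hl hT
  refine ⟨f, hf, ?_, fun ε hε => ?_⟩
  swap
  · obtain ⟨k, -, hk⟩ := hconv ε hε 0
    exact ⟨r k, hr k, hk⟩
  intro w Kw hwP hwf
  refine le_of_forall_pos_le_add fun γ hγ => ?_
  have hγ3 : 0 < γ / 3 := by positivity
  obtain ⟨e1, he1, hlsc⟩ := HE_lsc hl hlp hlm hf hγ3
  set C := (Kw + 1) ^ 2 + (Kw + 4 * K) ^ 2 + lp + lm with hC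
  have hCp : 0 ≤ C := by positivity
  set δ := min (1 / 2) (γ / 3 / (l * (C + 1))) with hδ
  have hδp : 0 < δ := by positivity
  have hδC : l * (δ * C) ≤ γ / 3 := by
    have h1 : δ ≤ γ / 3 / (l * (C + 1)) := min_le_right _ _
    rw [le_div_iff₀ (by positivity)] at h1
    nlinarith [mul_pos hδp hl]
  obtain ⟨N, hN⟩ := exists_nat_one_div_lt hγ3
  obtain ⟨k, hkN, hk⟩ := hconv (min e1 δ) (by positivity) N
  set g : ℝ → ℝ := fun θ => u (r k) θ / r k with hg
  have h1 := hlsc g (hT k) (fun θ => (hk θ).trans (min_le_left _ _))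
  obtain ⟨w', K', hw'P, hw'g, hJw'⟩ := bdry_comp hl hlp hlm hf (hT k) hwP hwf hδp (min_le_left _ _) hδp le_rfl
    (fun θ => (hk θ).trans (min_le_right _ _))
  have h2 := hgap k
  rw [EE_eq l lp lm u (hr k).1] at h2
  have h3 : 1 / ((k:ℝ) + 1) ≤ 1 / ((N:ℝ) + 1) := by
    apply one_div_le_one_div_of_le (by positivity)
    have : (N:ℝ) ≤ k := by exact_mod_cast hkN
    linarith
  have h4 := (PMin.scU hl.le hlp hlm hu hm (hr k).1 (hr k).2.le) 1 one_pos le_rfl w' K' hw'P (fun θ => by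
    rw [hw'g]; simp only [hg, scU, mul_one])
  rw [Jfun_scU hl.le hlp hlm hu (hr k).1 zero_le_one, mul_one] at h4
  rw [Jfun_zU hl hlp hlm hf]
  linarith

end

section

open MeasureTheory Set Filter

/-- periodic extension of the restriction of `g` to `[0,l)` -/
def pext (l : ℝ) (g : ℝ → ℝ) (θ : ℝ) : ℝ := g (l * Int.fract (θ / l))

lemma pext_per {l : ℝ} (hl : 0 < l) (g : ℝ → ℝ) (θ : ℝ) : pext l g (θ + l) = pext l g θ := by
  unfold pext
  rw [add_div, div_self hl.ne', Int.fract_add_one]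

lemma pext_eq {l : ℝ} (hl : 0 < l) (g : ℝ → ℝ) {θ : ℝ} (h : θ ∈ Ico 0 l) : pext l g θ = g θ := by
  unfold pext
  rw [Int.fract_eq_self.2 ⟨div_nonneg h.1 hl.le, (div_lt_one hl).2 h.2⟩]
  congr 1; field_simp

lemma pext_lip {l L : ℝ} (hl : 0 < l) (hL : 0 ≤ L) {g : ℝ → ℝ} (hg : ∀ x y, |g x - g y| ≤ L * |x - y|)
    (h0 : g 0 = g l) (x y : ℝ) : |pext l g x - pext l g y| ≤ L * |x - y| := by
  wlog hxy : x ≤ y with H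
  · rw [abs_sub_comm, abs_sub_comm x y]; exact H hl hL hg h0 y x (le_of_not_ge hxy)
  unfold pext
  set x' := l * Int.fract (x / l) with hx'
  set y' := l * Int.fract (y / l) with hy'
  have ex : x = x' + l * ⌊x / l⌋ := by
    rw [hx', ← mul_add, Int.fract_add_floor]; field_simp
  have ey : y = y' + l * ⌊y / l⌋ := by
    rw [hy', ← mul_add, Int.fract_add_floor]; field_simp
  have hx0 : 0 ≤ x' := mul_nonneg hl.le (Int.fract_nonneg _)
  have hy0 : 0 ≤ y' := mul_nonneg hl.le (Int.fract_nonneg _)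
  have hx1 : x' ≤ l := mul_le_of_le_one_right hl.le (Int.fract_lt_one _).le
  have hmn : ⌊x / l⌋ ≤ ⌊y / l⌋ := Int.floor_le_floor (div_le_div_of_nonneg_right hxy hl.le)
  rcases hmn.eq_or_lt with h | h
  · have : x - y = x' - y' := by rw [h] at ex; linarith
    rw [this]; exact hg _ _
  · have h1 : (⌊x / l⌋ : ℝ) + 1 ≤ ⌊y / l⌋ := by exact_mod_cast h
    have h2 := mul_le_mul_of_nonneg_left h1 hl.le
    have h3 := hg x' l
    have h4 := hg 0 y'
    rw [abs_sub_comm x' l, abs_of_nonneg (sub_nonneg.2 hx1)] at h3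
    rw [zero_sub, abs_neg, abs_of_nonneg hy0] at h4
    rw [abs_sub_comm x y, abs_of_nonneg (sub_nonneg.2 hxy)]
    have h5 : g x' - g y' = (g x' - g l) + (g 0 - g y') := by rw [h0]; ring
    rw [h5]
    refine (abs_add_le _ _).trans ?_
    have h6 : (l - x') + y' ≤ y - x := by linarith
    have := mul_le_mul_of_nonneg_left h6 hL
    linarith

lemma HMin.rot {l lp lm K : ℝ} (hl : 0 < l) (hlp : 0 ≤ lp) (hlm : 0 ≤ lm) {f : ℝ → ℝ} (hf : TLip l K f)
    (hm : HMin l lp lm f) (a : ℝ) : HMin l lp lm (fun θ => f (θ + a)) := by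
  intro w K' hw hw1
  have := hm (rotU w (-a)) K' (hw.rotU _) (by
    intro θ
    unfold rotU at *
    rw [hw1]; simp)
  rwa [Jfun_rotU hl.le hlp hlm hw zero_le_one, ← Jfun_rotU (a := a) hl.le hlp hlm hf.zU zero_le_one] at this

lemma HMin.neg {l lp lm : ℝ} {f : ℝ → ℝ} (hm : HMin l lp lm f) : HMin l lm lp (fun θ => - f θ) := by
  intro w K' hw hw1
  have := hm (negU w) K' hw.negU (by
    intro θ
    unfold negU at *
    rw [hw1]; simp)
  have h2 := Jfun_negU (l := l) (lp := lm) (lm := lp) w 1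
  rw [h2, ← Jfun_negU] at this
  convert this using 2
  ext r θ; simp [zU, negU]

lemma TLip.rot {l K : ℝ} {f : ℝ → ℝ} (hf : TLip l K f) (a : ℝ) : TLip l K (fun θ => f (θ + a)) :=
  ⟨fun θ => by
    have := hf.per (θ + a)
    rw [← this]; congr 1; ring, fun x y => by simpa using hf.lip (x + a) (y + a), fun x => hf.bd _⟩

lemma TLip.neg {l K : ℝ} {f : ℝ → ℝ} (hf : TLip l K f) : TLip l K (fun θ => - f θ) :=
  ⟨fun θ => by simp only [hf.per], fun x y => by
    have : -f x - -f y = f y - f x := by ring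
    rw [this, abs_sub_comm]; exact hf.lip x y, fun x => by rw [abs_neg]; exact hf.bd x⟩

def bmp (r : ℝ) : ℝ := max 0 (min r 1) * (1 - max 0 (min r 1))

lemma bmp_lip (r s : ℝ) : |bmp r - bmp s| ≤ |r - s| := by
  unfold bmp
  set a := max 0 (min r 1) with ha
  set b := max 0 (min s 1) with hb
  have h1 : |a - b| ≤ |r - s| := by
    rw [ha, hb]; grind
  have e : a * (1 - a) - b * (1 - b) = (a - b) * (1 - a - b) := by ring
  have ha0 : 0 ≤ a := le_max_left _ _
  have hb0 : 0 ≤ b := le_max_left _ _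
  have ha1 : a ≤ 1 := max_le zero_le_one (min_le_right _ _)
  have hb1 : b ≤ 1 := max_le zero_le_one (min_le_right _ _)
  rw [e, abs_mul]
  have h2 : |1 - a - b| ≤ 1 := by rw [abs_le]; constructor <;> linarith
  calc _ ≤ |a - b| * 1 := mul_le_mul_of_nonneg_left h2 (abs_nonneg _)
    _ ≤ _ := by linarith

lemma bmp_eq {r : ℝ} (h0 : 0 ≤ r) (h1 : r ≤ 1) : bmp r = r * (1 - r) := by
  unfold bmp; rw [min_eq_left h1, max_eq_right h0]

/-- competitor for inner first variation -/
def fvU (f g : ℝ → ℝ) (t r θ : ℝ) : ℝ := r * f θ + t * (bmp r * g θ)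

lemma fvU_PLip {l K K' : ℝ} {f g : ℝ → ℝ} (hf : TLip l K f) (hg : TLip l K' g) (t : ℝ) :
    PLip l (K + |t| * K') (fvU f g t) := by
  refine ⟨fun r θ => by simp only [fvU, hf.per, hg.per], fun r s θ => ?_, fun r θ φ => ?_⟩
  · have : fvU f g t r θ - fvU f g t s θ = (r - s) * f θ + t * ((bmp r - bmp s) * g θ) := by
      simp only [fvU]; ring
    rw [this]
    refine (abs_add_le _ _).trans ?_
    rw [abs_mul, abs_mul, abs_mul]
    have h1 := mul_le_mul_of_nonneg_left (hf.bd θ) (abs_nonneg (r - s))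
    have h2 := mul_le_mul (bmp_lip r s) (hg.bd θ) (abs_nonneg _) (abs_nonneg _)
    have h3 := mul_le_mul_of_nonneg_left h2 (abs_nonneg t)
    linarith
  · have : fvU f g t r θ - fvU f g t r φ = r * (f θ - f φ) + t * (bmp r * (g θ - g φ)) := by
      simp only [fvU]; ring
    rw [this]
    refine (abs_add_le _ _).trans ?_
    rw [abs_mul, abs_mul, abs_mul]
    have h0 : |bmp r| ≤ |r| := by
      have := bmp_lip r 0
      simpa [bmp] using this
    have h1 := mul_le_mul_of_nonneg_left (hf.lip θ φ) (abs_nonneg r)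
    have h2 := mul_le_mul h0 (hg.lip θ φ) (abs_nonneg _) (abs_nonneg _)
    have h3 := mul_le_mul_of_nonneg_left h2 (abs_nonneg t)
    linarith

lemma sign_pert {a b m : ℝ} (h : a ≠ a + b → m ≤ |a|) (hb : |b| < m) : (0 < a + b ↔ 0 < a) ∧ (a + b < 0 ↔ a < 0) := by
  by_cases hh : a = a + b
  · rw [← hh]; simp
  · have := h hh
    rw [abs_lt] at hb
    rcases abs_cases a with ⟨h1, h2⟩ | ⟨h1, h2⟩ <;> constructor <;> constructor <;> intro h3 <;> linarith

lemma fv_den {f g : ℝ → ℝ} {lp lm t m r θ : ℝ} (hr : r ∈ Ioo 0 1) (hf : DifferentiableAt ℝ f θ)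
    (hg : DifferentiableAt ℝ g θ) (hs : g θ ≠ 0 → m ≤ |f θ|) (hm0 : 0 < m) (ht : |t| * |g θ| < m) :
    (den lp lm (fvU f g t) (r, θ) - den lp lm (zU f) (r, θ)) * r =
      2 * t * ((r - 2 * r ^ 2) * (f θ * g θ) + (r - r ^ 2) * (deriv f θ * deriv g θ))
      + t ^ 2 * ((r - 4 * r ^ 2 + 4 * r ^ 3) * g θ ^ 2 + (r - 2 * r ^ 2 + r ^ 3) * deriv g θ ^ 2) := by
  have hr0 := hr.1
  rw [den_zU lp lm f hr.1]
  have h1 : deriv (fun s => fvU f g t s θ) r = f θ + t * (1 - 2 * r) * g θ := by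
    have : (fun s => fvU f g t s θ) =ᶠ[nhds r] fun s => s * f θ + t * (s * (1 - s) * g θ) := by
      filter_upwards [isOpen_Ioo.mem_nhds hr] with s hs
      rw [fvU, bmp_eq hs.1.le hs.2.le]
    rw [this.deriv_eq]
    have hd : HasDerivAt (fun s : ℝ => s * f θ + t * (s * (1 - s) * g θ))
        (1 * f θ + t * ((1 * (1 - r) + r * (0 - 1)) * g θ)) r := by
      refine ((hasDerivAt_id r).mul_const _).add (HasDerivAt.const_mul t (HasDerivAt.mul_const (HasDerivAt.mul (hasDerivAt_id r) ?_) _))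
      exact (hasDerivAt_const r (1:ℝ)).sub (hasDerivAt_id r)
    rw [hd.deriv]; ring
  have h2 : deriv (fun φ => fvU f g t r φ) θ = r * (deriv f θ + t * (1 - r) * deriv g θ) := by
    have hd : HasDerivAt (fun φ => fvU f g t r φ) (r * deriv f θ + t * (bmp r * deriv g θ)) θ :=
      (hf.hasDerivAt.const_mul r).add ((hg.hasDerivAt.const_mul (bmp r)).const_mul t)
    rw [hd.deriv, bmp_eq hr.1.le hr.2.le]; ring
  have h3 : fvU f g t r θ = r * (f θ + t * (1 - r) * g θ) := by
    rw [fvU, bmp_eq hr.1.le hr.2.le]; ring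
  have h4 := sign_pert (a := f θ) (b := t * (1 - r) * g θ) (m := m) (by
    intro h; apply hs; intro h0; apply h; simp [h0]) (by
    rw [abs_mul, abs_mul, abs_of_pos (by linarith [hr.2] : 0 < 1 - r)]
    have : |t| * (1 - r) * |g θ| ≤ |t| * |g θ| := by
      have := mul_nonneg (mul_nonneg (abs_nonneg t) hr.1.le) (abs_nonneg (g θ))
      linarith
    linarith)
  have e1 : (0 < r * (f θ + t * (1 - r) * g θ)) ↔ 0 < f θ := by
    rw [← h4.1]; simp [hr0]
  have e2 : (r * (f θ + t * (1 - r) * g θ) < 0) ↔ f θ < 0 := by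
    rw [← h4.2]
    constructor
    · intro h; by_contra hc; push Not at hc; have := mul_nonneg hr.1.le hc; linarith
    · intro h; exact mul_neg_of_pos_of_neg hr.1 h
  simp only [den, gradSq, hden, h1, h2, h3, e1, e2]
  field_simp
  ring

lemma fv_step {l lp lm K K' : ℝ} (hl : 0 < l) (hlp : 0 ≤ lp) (hlm : 0 ≤ lm) {f g : ℝ → ℝ} (hf : TLip l K f)
    (hm : HMin l lp lm f) (hg : TLip l K' g) {m t : ℝ} (hm0 : 0 < m) (hs : ∀ θ, g θ ≠ 0 → m ≤ |f θ|)
    (ht : |t| * K' < m) :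
    0 ≤ (t / 3) * (∫ θ in (0:ℝ)..l, (deriv f θ * deriv g θ - f θ * g θ)) + t ^ 2 * (l * K' ^ 2) := by
  have h0 := hm (fvU f g t) _ (fvU_PLip hf hg t) (fun θ => by simp [fvU, bmp])
  have hW := fvU_PLip hf hg t
  rw [← sub_nonneg, Jfun_sub hlp hlm hf.zU hW] at h0
  have hIntg : IntegrableOn (fun p : ℝ × ℝ => (den lp lm (fvU f g t) p - den lp lm (zU f) p) * p.1) (Om l 1) := by
    have := (hW.intOn hlp hlm 1).sub (hf.zU.intOn hlp hlm 1)
    refine this.congr_fun (fun p _ => ?_) (measurableSet_Om l 1)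
    simp only [Pi.sub_apply]; ring
  rw [fub_tr hl.le zero_le_one hIntg] at h0
  have hfm := hf.cont.measurable
  have hgm := hg.cont.measurable
  have hK' := hg.K_nonneg
  have hK := hf.K_nonneg
  have hI1 : IntervalIntegrable (fun θ => deriv f θ * deriv g θ - f θ * g θ) volume 0 l := by
    refine bm_int (((measurable_deriv f).mul (measurable_deriv g)).sub (hfm.mul hgm)) hl.le (C := K * K' + K * K') ?_
    intro x _
    refine (abs_sub _ _).trans ?_
    rw [Pi.mul_apply, Pi.mul_apply, abs_mul, abs_mul]
    exact add_le_add (mul_le_mul (hf.d_le x) (hg.d_le x) (abs_nonneg _) hK)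
      (mul_le_mul (hf.bd x) (hg.bd x) (abs_nonneg _) hK)
  have hI : IntervalIntegrable (fun θ => (t / 3) * (deriv f θ * deriv g θ - f θ * g θ) + t ^ 2 * K' ^ 2) volume 0 l :=
    (hI1.const_mul _).add intervalIntegrable_const
  have hle : (∫ θ in (0:ℝ)..l, ∫ r in (0:ℝ)..1, (den lp lm (fvU f g t) (r, θ) - den lp lm (zU f) (r, θ)) * r) ≤
      ∫ θ in (0:ℝ)..l, ((t / 3) * (deriv f θ * deriv g θ - f θ * g θ) + t ^ 2 * K' ^ 2) := by
    refine intervalIntegral.integral_mono_ae hl.le (fub_tr_int hl.le zero_le_one hIntg) hI ?_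
    filter_upwards [(lip_of hf.lip).ae_differentiableAt_real, (lip_of hg.lip).ae_differentiableAt_real] with θ h1 h2
    have e : ∫ r in (0:ℝ)..1, (den lp lm (fvU f g t) (r, θ) - den lp lm (zU f) (r, θ)) * r =
      ∫ r in (0:ℝ)..1, (2 * t * ((r - 2 * r ^ 2) * (f θ * g θ) + (r - r ^ 2) * (deriv f θ * deriv g θ))
      + t ^ 2 * ((r - 4 * r ^ 2 + 4 * r ^ 3) * g θ ^ 2 + (r - 2 * r ^ 2 + r ^ 3) * deriv g θ ^ 2)) := by
      rw [intervalIntegral.integral_of_le zero_le_one, intervalIntegral.integral_of_le zero_le_one,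
        integral_Ioc_eq_integral_Ioo, integral_Ioc_eq_integral_Ioo]
      refine setIntegral_congr_fun measurableSet_Ioo fun r hr => ?_
      exact fv_den hr h1 h2 (hs θ) hm0 (lt_of_le_of_lt (mul_le_mul_of_nonneg_left (hg.bd θ) (abs_nonneg t)) ht)
    rw [e]
    have e2 : ∫ r in (0:ℝ)..1, (2 * t * ((r - 2 * r ^ 2) * (f θ * g θ) + (r - r ^ 2) * (deriv f θ * deriv g θ))
      + t ^ 2 * ((r - 4 * r ^ 2 + 4 * r ^ 3) * g θ ^ 2 + (r - 2 * r ^ 2 + r ^ 3) * deriv g θ ^ 2))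
      = (t / 3) * (deriv f θ * deriv g θ - f θ * g θ) + t ^ 2 * (g θ ^ 2 / 6 + deriv g θ ^ 2 / 12) := by
      set p := f θ * g θ
      set q := deriv f θ * deriv g θ
      set x := g θ ^ 2
      set y := deriv g θ ^ 2
      have hder : ∀ r ∈ uIcc (0:ℝ) 1, HasDerivAt (fun r : ℝ => 2 * t * ((r ^ 2 / 2 - 2 * (r ^ 3 / 3)) * p + (r ^ 2 / 2 - r ^ 3 / 3) * q)
          + t ^ 2 * ((r ^ 2 / 2 - 4 * (r ^ 3 / 3) + 4 * (r ^ 4 / 4)) * x + (r ^ 2 / 2 - 2 * (r ^ 3 / 3) + r ^ 4 / 4) * y))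
          (2 * t * ((r - 2 * r ^ 2) * p + (r - r ^ 2) * q)
      + t ^ 2 * ((r - 4 * r ^ 2 + 4 * r ^ 3) * x + (r - 2 * r ^ 2 + r ^ 3) * y)) r := by
        intro r _
        have a2 : HasDerivAt (fun r : ℝ => r ^ 2 / 2) r r := by
          exact ((hasDerivAt_pow 2 r).div_const 2).congr_deriv (by push_cast; ring)
        have a3 : HasDerivAt (fun r : ℝ => r ^ 3 / 3) (r ^ 2) r := by
          exact ((hasDerivAt_pow 3 r).div_const 3).congr_deriv (by push_cast; ring)
        have a4 : HasDerivAt (fun r : ℝ => r ^ 4 / 4) (r ^ 3) r := by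
          exact ((hasDerivAt_pow 4 r).div_const 4).congr_deriv (by push_cast; ring)
        exact ((((a2.sub (a3.const_mul 2)).mul_const p).add ((a2.sub a3).mul_const q)).const_mul (2 * t)).add
          (((((a2.sub (a3.const_mul 4)).add (a4.const_mul 4)).mul_const x).add
            (((a2.sub (a3.const_mul 2)).add a4).mul_const y)).const_mul (t ^ 2))
      rw [intervalIntegral.integral_eq_sub_of_hasDerivAt hder (Continuous.intervalIntegrable (by fun_prop) _ _)]
      ring
    rw [e2]
    have h3 := sq_le_of_abs (hg.bd θ)
    have h4 := sq_le_of_abs (hg.d_le θ)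
    have h5 : g θ ^ 2 / 6 + deriv g θ ^ 2 / 12 ≤ K' ^ 2 := by nlinarith [sq_nonneg K']
    have := mul_le_mul_of_nonneg_left h5 (sq_nonneg t)
    linarith
  rw [intervalIntegral.integral_add (hI1.const_mul _) intervalIntegrable_const, intervalIntegral.integral_const_mul,
    intervalIntegral.integral_const] at hle
  simp only [smul_eq_mul, sub_zero] at hle
  linarith

lemma fv {l lp lm K K' : ℝ} (hl : 0 < l) (hlp : 0 ≤ lp) (hlm : 0 ≤ lm) {f g : ℝ → ℝ} (hf : TLip l K f)
    (hm : HMin l lp lm f) (hg : TLip l K' g) {m : ℝ} (hm0 : 0 < m) (hs : ∀ θ, g θ ≠ 0 → m ≤ |f θ|) :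
    ∫ θ in (0:ℝ)..l, (deriv f θ * deriv g θ - f θ * g θ) = 0 := by
  set X := ∫ θ in (0:ℝ)..l, (deriv f θ * deriv g θ - f θ * g θ)
  have hK' := hg.K_nonneg
  set C := l * K' ^ 2
  have hC : 0 ≤ C := by positivity
  by_contra hX
  have hX' : 0 < |X| := abs_pos.2 hX
  obtain ⟨s, hs0, hs1, hs2⟩ : ∃ s : ℝ, 0 < s ∧ s * K' < m ∧ s * (3 * C) < |X| := by
    refine ⟨min (m / (K' + 1)) (|X| / (3 * C + 1)) , by positivity, ?_, ?_⟩
    · have h1 := min_le_left (m / (K' + 1)) (|X| / (3 * C + 1))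
      have h2 := mul_le_mul_of_nonneg_right h1 hK'
      refine h2.trans_lt ?_
      rw [div_mul_eq_mul_div, div_lt_iff₀ (by positivity)]
      nlinarith
    · have h1 := min_le_right (m / (K' + 1)) (|X| / (3 * C + 1))
      have h2 := mul_le_mul_of_nonneg_right h1 (by positivity : 0 ≤ 3 * C)
      refine h2.trans_lt ?_
      rw [div_mul_eq_mul_div, div_lt_iff₀ (by positivity)]
      nlinarith
  have h1 := fv_step hl hlp hlm hf hm hg (t := s) hm0 hs (by rwa [abs_of_pos hs0])
  have h2 := fv_step hl hlp hlm hf hm hg (t := -s) hm0 hs (by rwa [abs_neg, abs_of_pos hs0])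
  change 0 ≤ s / 3 * X + s ^ 2 * C at h1
  change 0 ≤ -s / 3 * X + (-s) ^ 2 * C at h2
  have h3 : |X| * (s / 3) ≤ s ^ 2 * C := by
    rcases abs_cases X with ⟨h, _⟩ | ⟨h, _⟩ <;> rw [h] <;> nlinarith
  nlinarith

end

section

open MeasureTheory Set Filter

lemma sin_lip (x y : ℝ) : |Real.sin x - Real.sin y| ≤ 1 * |x - y| := by
  have := Real.lipschitzWith_sin.dist_le_mul x y
  simpa [Real.dist_eq] using this
lemma cos_lip (x y : ℝ) : |Real.cos x - Real.cos y| ≤ 1 * |x - y| := by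
  have := Real.lipschitzWith_cos.dist_le_mul x y
  simpa [Real.dist_eq] using this

def hat (c β x : ℝ) : ℝ := Real.sin (max 0 (min x c)) * Real.sin (β - c)
  + Real.sin c * (Real.sin (β - max c (min x β)) - Real.sin (β - c))

lemma hat_lip (c β x y : ℝ) : |hat c β x - hat c β y| ≤ 2 * |x - y| := by
  have e : hat c β x - hat c β y = (Real.sin (max 0 (min x c)) - Real.sin (max 0 (min y c))) * Real.sin (β - c)
    + Real.sin c * (Real.sin (β - max c (min x β)) - Real.sin (β - max c (min y β))) := by unfold hat; ring
  rw [e]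
  refine (abs_add_le _ _).trans ?_
  rw [abs_mul, abs_mul]
  have h1 := sin_lip (max 0 (min x c)) (max 0 (min y c))
  have h2 := sin_lip (β - max c (min x β)) (β - max c (min y β))
  have h3 : |max 0 (min x c) - max 0 (min y c)| ≤ |x - y| := by grind
  have h4 : |(β - max c (min x β)) - (β - max c (min y β))| ≤ |x - y| := by grind
  have h5 := mul_le_mul (h1.trans (by linarith : _ ≤ |x - y|)) (Real.abs_sin_le_one (β - c)) (abs_nonneg _) (abs_nonneg _)
  have h6 := mul_le_mul (Real.abs_sin_le_one c) (h2.trans (by linarith : _ ≤ |x - y|)) (abs_nonneg _) zero_le_one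
  linarith

lemma hat_bd (c β x : ℝ) : |hat c β x| ≤ 3 := by
  unfold hat
  refine (abs_add_le _ _).trans ?_
  rw [abs_mul, abs_mul]
  have h1 := mul_le_mul (Real.abs_sin_le_one (max 0 (min x c))) (Real.abs_sin_le_one (β - c)) (abs_nonneg _) zero_le_one
  have h2 := abs_sub (Real.sin (β - max c (min x β))) (Real.sin (β - c))
  have h3 := Real.abs_sin_le_one (β - c)
  have h4 := Real.abs_sin_le_one (β - max c (min x β))
  have h6 := mul_le_mul (Real.abs_sin_le_one c) (h2.trans (by linarith : _ ≤ (2:ℝ))) (abs_nonneg _) zero_le_one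
  linarith

lemma hat_l {c β x : ℝ} (h1 : x ∈ Icc 0 c) (h2 : c ≤ β) : hat c β x = Real.sin x * Real.sin (β - c) := by
  unfold hat
  rw [min_eq_left h1.2, max_eq_right h1.1, min_eq_left (h1.2.trans h2), max_eq_left h1.2]; ring
lemma hat_m {c β x : ℝ} (h0 : 0 ≤ c) (h1 : x ∈ Icc c β) : hat c β x = Real.sin c * Real.sin (β - x) := by
  unfold hat
  rw [min_eq_right h1.1, max_eq_right h0, min_eq_left h1.2, max_eq_right h1.1]; ring
lemma hat_r {c β x : ℝ} (h0 : 0 ≤ c) (h1 : c ≤ β) (h : β ≤ x) : hat c β x = 0 := by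
  unfold hat
  rw [min_eq_right (h1.trans h), max_eq_right h0, min_eq_right h, max_eq_right h1]; simp

lemma TLip.fract {l K : ℝ} {f : ℝ → ℝ} (hl : 0 < l) (hf : TLip l K f) (θ : ℝ) : f (l * Int.fract (θ / l)) = f θ := by
  have hp : Function.Periodic f l := hf.per
  have : l * Int.fract (θ / l) = θ - ⌊θ / l⌋ * l := by
    rw [Int.fract]; field_simp
  rw [this]; exact hp.sub_int_mul_eq _

lemma hat_TLip {l c β : ℝ} (hl : 0 < l) (h0 : 0 ≤ c) (h1 : c ≤ β) (h2 : β ≤ l) : TLip l 3 (pext l (hat c β)) :=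
  ⟨pext_per hl _, fun x y => by
    have := pext_lip hl (by norm_num : (0:ℝ) ≤ 2) (hat_lip c β) (by
      rw [hat_r h0 h1 h2, hat_l ⟨le_rfl, h0⟩ h1]; simp) x y
    have := abs_nonneg (x - y)
    linarith, fun x => hat_bd _ _ _⟩

lemma ibp_piece {l K a b : ℝ} {f v v' g : ℝ → ℝ} (hf : TLip l K f) (hab : a ≤ b) (hv : ∀ x y, |v x - v y| ≤ 1 * |x - y|)
    (hv' : ∀ x, HasDerivAt v (v' x) x) {k : ℝ} (hg : ∀ x ∈ Ioo a b, g x = -k * v' x ∧ deriv g x = k * v x) :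
    ∫ x in a..b, (deriv f x * deriv g x - f x * g x) = k * (f b * v b - f a * v a) := by
  have h := (lip_ac hf.lip a b).integral_deriv_mul_eq_sub (lip_ac hv a b)
  rw [← h, ← intervalIntegral.integral_const_mul, intervalIntegral.integral_of_le hab,
    intervalIntegral.integral_of_le hab, integral_Ioc_eq_integral_Ioo, integral_Ioc_eq_integral_Ioo]
  refine setIntegral_congr_fun measurableSet_Ioo fun x hx => ?_
  simp only [(hg x hx).1, (hg x hx).2, (hv' x).deriv]
  ring

lemma tp0 {l lp lm K : ℝ} (hl : 0 < l) (hlp : 0 ≤ lp) (hlm : 0 ≤ lm) {f : ℝ → ℝ} (hf : TLip l K f)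
    (hm : HMin l lp lm f) {c β : ℝ} (hc : 0 ≤ c) (hcβ : c ≤ β) (hβl : β ≤ l)
    (hne : ∀ x ∈ Icc 0 β, f x ≠ 0) :
    f c * Real.sin β = f 0 * Real.sin (β - c) + f β * Real.sin c := by
  have hβ0 : 0 ≤ β := hc.trans hcβ
  obtain ⟨x0, hx0, hmin⟩ := isCompact_Icc.exists_isMinOn (nonempty_Icc.2 hβ0) (hf.cont.abs.continuousOn (s := Icc 0 β))
  have hg := hat_TLip hl hc hcβ hβl
  set g := pext l (hat c β) with hgdef
  have key := fv hl hlp hlm hf hm hg (abs_pos.2 (hne x0 hx0)) (by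
    intro θ hθ
    rw [← hf.fract hl θ]
    apply hmin
    refine ⟨mul_nonneg hl.le (Int.fract_nonneg _), ?_⟩
    by_contra hc'
    exact hθ (hat_r hc hcβ (not_le.1 hc').le))
  have hK := hf.K_nonneg
  have hI : ∀ a b : ℝ, a ≤ b → IntervalIntegrable (fun θ => deriv f θ * deriv g θ - f θ * g θ) volume a b := by
    intro a b hab
    refine bm_int (((measurable_deriv f).mul (measurable_deriv g)).sub (hf.cont.measurable.mul hg.cont.measurable)) hab (C := K * 3 + K * 3) ?_
    intro x _
    refine (abs_sub _ _).trans ?_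
    rw [Pi.mul_apply, Pi.mul_apply, abs_mul, abs_mul]
    exact add_le_add (mul_le_mul (hf.d_le x) (hg.d_le x) (abs_nonneg _) hK)
      (mul_le_mul (hf.bd x) (hg.bd x) (abs_nonneg _) hK)
  have hge : ∀ x ∈ Ioo 0 l, g x = hat c β x := fun x hx => pext_eq hl _ ⟨hx.1.le, hx.2⟩
  rw [← intervalIntegral.integral_add_adjacent_intervals (hI 0 c hc) (hI c l (hcβ.trans hβl)),
    ← intervalIntegral.integral_add_adjacent_intervals (hI c β hcβ) (hI β l hβl)] at key
  have p1 := ibp_piece (g := g) (v := Real.cos) (v' := fun x => - Real.sin x) (k := Real.sin (β - c)) hf hc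
    cos_lip Real.hasDerivAt_cos (by
      intro x hx
      have h1 : g =ᶠ[nhds x] fun x => Real.sin x * Real.sin (β - c) := by
        filter_upwards [isOpen_Ioo.mem_nhds hx] with s hs
        rw [hge s ⟨hs.1, hs.2.trans_le (hcβ.trans hβl)⟩, hat_l ⟨hs.1.le, hs.2.le⟩ hcβ]
      refine ⟨by rw [h1.self_of_nhds]; ring, ?_⟩
      rw [h1.deriv_eq, ((Real.hasDerivAt_sin x).mul_const _).deriv]; ring)
  have hd : ∀ x, HasDerivAt (fun x => β - x) (-1) x := fun x => by
    simpa using (hasDerivAt_id x).const_sub β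
  have p2 := ibp_piece (g := g) (v := fun x => Real.cos (β - x)) (v' := fun x => Real.sin (β - x)) (k := - Real.sin c) hf hcβ
    (fun x y => by
      have := cos_lip (β - x) (β - y)
      have e : (β - x) - (β - y) = y - x := by ring
      rwa [e, abs_sub_comm y x] at this) (fun x => by
      have := (hd x).cos
      convert this using 1; ring) (by
      intro x hx
      have h1 : g =ᶠ[nhds x] fun x => Real.sin c * Real.sin (β - x) := by
        filter_upwards [isOpen_Ioo.mem_nhds hx] with s hs
        rw [hge s ⟨hc.trans_lt hs.1, hs.2.trans_le hβl⟩, hat_m hc ⟨hs.1.le, hs.2.le⟩]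
      refine ⟨by rw [h1.self_of_nhds]; ring, ?_⟩
      rw [h1.deriv_eq, ((hd x).sin.const_mul _).deriv]; ring)
  have p3 := ibp_piece (g := g) (v := fun x => 0) (v' := fun x => 0) (k := 0) hf hβl
    (fun x y => by simp) (fun x => hasDerivAt_const x 0) (by
      intro x hx
      have h1 : g =ᶠ[nhds x] fun x => 0 := by
        filter_upwards [isOpen_Ioo.mem_nhds hx] with s hs
        rw [hge s ⟨hβ0.trans_lt hs.1, hs.2⟩, hat_r hc hcβ hs.1.le]
      refine ⟨by rw [h1.self_of_nhds]; ring, ?_⟩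
      rw [h1.deriv_eq]; simp)
  rw [p1, p2, p3] at key
  simp only [sub_self, Real.cos_zero] at key
  have e : Real.sin β = Real.sin (β - c) * Real.cos c + Real.cos (β - c) * Real.sin c := by
    rw [← Real.sin_add]; congr 1; ring
  rw [e]; linarith

lemma tp {l lp lm K : ℝ} (hl : 0 < l) (hlp : 0 ≤ lp) (hlm : 0 ≤ lm) {f : ℝ → ℝ} (hf : TLip l K f)
    (hm : HMin l lp lm f) {α c β : ℝ} (hc : α ≤ c) (hcβ : c ≤ β) (hβl : β - α ≤ l)
    (hne : ∀ x ∈ Icc α β, f x ≠ 0) :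
    f c * Real.sin (β - α) = f α * Real.sin (β - c) + f β * Real.sin (c - α) := by
  have := tp0 hl hlp hlm (hf.rot α) (hm.rot hl hlp hlm hf α) (c := c - α) (β := β - α) (by linarith) (by linarith) hβl (by
    intro x hx; exact hne _ ⟨by linarith [hx.1], by linarith [hx.2]⟩)
  simpa using this

end

section

open MeasureTheory Set Filter

lemma zero_of_Ioo {G : ℝ → ℝ} {a c : ℝ} (hG : Continuous G) (hac : a < c) (h : ∀ x ∈ Ioo a c, G x = 0) :
    ∀ x ∈ Icc a c, G x = 0 := by
  have hcl : IsClosed {x | G x = 0} := isClosed_eq hG continuous_const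
  have := closure_minimal (s := Ioo a c) (fun x hx => h x hx) hcl
  rw [closure_Ioo hac.ne] at this
  exact this

lemma exists_zero {l lp lm K : ℝ} (hl : 0 < l) (hlp : 0 ≤ lp) (hlm : 0 ≤ lm) {f : ℝ → ℝ} (hf : TLip l K f)
    (hm : HMin l lp lm f) : ∃ x, f x = 0 := by
  by_contra hcon
  push Not at hcon
  -- reduce to a positive function
  have main : ∀ (lp lm : ℝ) (f : ℝ → ℝ), 0 ≤ lp → 0 ≤ lm → TLip l K f → HMin l lp lm f → (∀ x, 0 < f x) → False := by
    intro lp lm f hlp hlm hf hm hpos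
    obtain ⟨c, hc, hmin⟩ := isCompact_Icc.exists_isMinOn (nonempty_Icc.2 hl.le) (hf.cont.continuousOn (s := Icc 0 l))
    have hmin' : ∀ x, f c ≤ f x := by
      intro x
      rw [← hf.fract hl x]
      exact hmin ⟨mul_nonneg hl.le (Int.fract_nonneg _), mul_le_of_le_one_right hl.le (Int.fract_lt_one _).le⟩
    have hpi := Real.pi_pos
    obtain ⟨h, h0, h1, h2⟩ : ∃ h : ℝ, 0 < h ∧ 2 * h ≤ l ∧ h ≤ 1 :=
      ⟨min (l / 2) 1, by positivity, by have := min_le_left (l / 2) 1; linarith, min_le_right _ _⟩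
    have hpi3 := Real.pi_gt_three
    have key := tp hl hlp hlm hf hm (α := c - h) (c := c) (β := c + h) (by linarith) (by linarith) (by linarith)
      (fun x _ => (hpos x).ne')
    have e1 : c + h - (c - h) = 2 * h := by ring
    have e2 : c + h - c = h := by ring
    have e3 : c - (c - h) = h := by ring
    rw [e1, e2, e3, Real.sin_two_mul] at key
    have hs : 0 < Real.sin h := Real.sin_pos_of_pos_of_lt_pi h0 (by linarith)
    have hco : Real.cos h < 1 := by
      have := Real.cos_lt_cos_of_nonneg_of_le_pi_div_two le_rfl (by linarith : h ≤ Real.pi / 2) h0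
      simpa using this
    have k2 : 2 * f c * Real.cos h = f (c - h) + f (c + h) := by
      apply mul_right_cancel₀ hs.ne'; linarith
    have := mul_lt_mul_of_pos_left hco (hpos c)
    linarith [hmin' (c - h), hmin' (c + h)]
  rcases lt_or_gt_of_ne (hcon 0) with h | h
  · refine main lm lp _ hlm hlp hf.neg hm.neg fun x => ?_
    by_contra hx
    have hx' : 0 ≤ f x := by simpa using hx
    obtain ⟨y, hy⟩ := mem_range_of_exists_le_of_exists_ge hf.cont ⟨0, h.le⟩ ⟨x, hx'⟩
    exact hcon y hy
  · refine main lp lm _ hlp hlm hf hm fun x => ?_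
    by_contra hx
    obtain ⟨y, hy⟩ := mem_range_of_exists_le_of_exists_ge hf.cont ⟨x, not_lt.1 hx⟩ ⟨0, h.le⟩
    exact hcon y hy

lemma comp_arc {l lp lm K : ℝ} (hl : 0 < l) (hl2 : l < 2 * Real.pi) (hlp : 0 ≤ lp) (hlm : 0 ≤ lm) {f : ℝ → ℝ}
    (hf : TLip l K f) (hm : HMin l lp lm f) {θ0 : ℝ} (h0 : f θ0 ≠ 0) :
    ∃ a A, A ≠ 0 ∧ a < θ0 ∧ θ0 < a + Real.pi ∧ Real.pi ≤ l ∧ (∀ x ∈ Ioo a (a + Real.pi), f x ≠ 0) ∧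
      ∀ x ∈ Icc a (a + Real.pi), f x = A * Real.sin (x - a) := by
  obtain ⟨z, hz⟩ := exists_zero hl hlp hlm hf hm
  have hp : Function.Periodic f l := hf.per
  have hcl : IsClosed {x | f x = 0} := isClosed_eq hf.cont continuous_const
  set S := {x | f x = 0} ∩ Iic θ0 with hS
  set T := {x | f x = 0} ∩ Ici θ0 with hT
  have hSn : S.Nonempty := by
    obtain ⟨y, hy, hzy⟩ := hp.exists_mem_Ico hl z (θ0 - l)
    exact ⟨y, by simp [← hzy, hz], by have := hy.2; simp at this; exact this.le⟩
  have hTn : T.Nonempty := by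
    obtain ⟨y, hy, hzy⟩ := hp.exists_mem_Ico hl z θ0
    exact ⟨y, by simp [← hzy, hz], hy.1⟩
  have hSb : BddAbove S := ⟨θ0, fun x hx => hx.2⟩
  have hTb : BddBelow T := ⟨θ0, fun x hx => hx.2⟩
  have haS := (hcl.inter isClosed_Iic).csSup_mem hSn hSb
  have hbT := (hcl.inter isClosed_Ici).csInf_mem hTn hTb
  set a := sSup S with ha
  set b := sInf T with hb
  have hfa : f a = 0 := haS.1
  have hfb : f b = 0 := hbT.1
  have haθ : a < θ0 := lt_of_le_of_ne haS.2 (fun h => h0 (h ▸ hfa))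
  have hθb : θ0 < b := lt_of_le_of_ne hbT.2 (fun h => h0 (h ▸ hfb))
  have hne : ∀ x ∈ Ioo a b, f x ≠ 0 := by
    intro x hx hfx
    rcases le_total x θ0 with h | h
    · exact absurd (le_csSup hSb ⟨hfx, h⟩) (not_le.2 hx.1)
    · exact absurd (csInf_le hTb ⟨hfx, h⟩) (not_le.2 hx.2)
  have hfal : f (a + l) = 0 := by rw [hf.per, hfa]
  have hbl : b ≤ a + l := by
    rcases le_total θ0 (a + l) with h | h
    · exact csInf_le hTb ⟨hfal, h⟩
    · have := le_csSup hSb (show a + l ∈ S from ⟨hfal, h⟩)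
      linarith
  have hfc := hf.cont
  have F1 : ∀ c β, a < c → c ≤ β → β < b → f c * Real.sin (β - a) = f β * Real.sin (c - a) := by
    intro c β hac hcβ hβb
    have := zero_of_Ioo (G := fun α => f c * Real.sin (β - α) - f α * Real.sin (β - c) - f β * Real.sin (c - α))
      (by fun_prop) hac (by
        intro α hα
        have := tp hl hlp hlm hf hm (α := α) hα.2.le hcβ (by linarith [hα.1]) (fun x hx => hne x ⟨by linarith [hα.1, hx.1], by linarith [hx.2]⟩)
        linarith) a ⟨le_rfl, hac.le⟩
    simp only [hfa] at this
    linarith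
  have hsin : Real.sin (b - a) = 0 := by
    have := zero_of_Ioo (G := fun β => f θ0 * Real.sin (β - a) - f β * Real.sin (θ0 - a))
      (by fun_prop) hθb (by
        intro β hβ
        have := F1 θ0 β haθ hβ.1.le hβ.2
        linarith) b ⟨hθb.le, le_rfl⟩
    simp only [hfb] at this
    have h2 : f θ0 * Real.sin (b - a) = 0 := by linarith
    exact (mul_eq_zero.1 h2).resolve_left h0
  have hba : b = a + Real.pi := by
    have h1 := (Real.sin_eq_zero_iff_of_lt_of_lt (x := b - a - Real.pi) (by linarith) (by linarith)).1 (by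
      rw [Real.sin_sub_pi, hsin, neg_zero])
    linarith
  have hpi := Real.pi_pos
  have hM : f (a + Real.pi / 2) ≠ 0 := hne _ ⟨by linarith, by linarith⟩
  rw [hba] at hne hfb hθb hbl F1
  refine ⟨a, f (a + Real.pi / 2), hM, haθ, hθb, by linarith, hne, ?_⟩
  intro x hx
  have e : a + Real.pi / 2 - a = Real.pi / 2 := by ring
  rcases hx.1.eq_or_lt with h | h
  · rw [← h, hfa]; simp
  rcases hx.2.eq_or_lt with h' | h'
  · rw [h', hfb]; simp
  rcases le_total x (a + Real.pi / 2) with h2 | h2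
  · have := F1 x _ h h2 (by linarith)
    rwa [e, Real.sin_pi_div_two, mul_one] at this
  · have := F1 _ x (by linarith) h2 h'
    rw [e, Real.sin_pi_div_two, mul_one] at this
    exact this.symm

lemma classify {l lp lm K : ℝ} (hl : 0 < l) (hl2 : l < 2 * Real.pi) (hlp : 0 ≤ lp) (hlm : 0 ≤ lm) {f : ℝ → ℝ}
    (hf : TLip l K f) (hm : HMin l lp lm f) {θ0 : ℝ} (h0 : f θ0 ≠ 0) :
    ∃ k A, A ≠ 0 ∧ Real.pi ≤ l ∧ ∀ θ ∈ Icc 0 l, f (θ + k) = A * max (Real.cos (θ - l / 2)) 0 := by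
  obtain ⟨a, A, hA, -, -, hpl, hne, hfA⟩ := comp_arc hl hl2 hlp hlm hf hm h0
  have hpi := Real.pi_pos
  have hfa : f a = 0 := by rw [hfA a ⟨le_rfl, by linarith⟩]; simp
  have hfp : f (a + Real.pi) = 0 := by rw [hfA _ ⟨by linarith, le_rfl⟩]; simp
  have hfl : f (a + l) = 0 := by rw [hf.per, hfa]
  have hz : ∀ x ∈ Icc (a + Real.pi) (a + l), f x = 0 := by
    intro x hx
    by_contra hx0
    obtain ⟨a', A', -, h1, h2, -, hne', -⟩ := comp_arc hl hl2 hlp hlm hf hm hx0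
    have k1 : a + Real.pi ≤ a' := by
      by_contra hc
      exact hne' _ ⟨not_le.1 hc, by linarith [hx.1]⟩ hfp
    have k2 : a' + Real.pi ≤ a + l := by
      by_contra hc
      exact hne' _ ⟨by linarith [hx.2], not_le.1 hc⟩ hfl
    linarith
  refine ⟨a + Real.pi / 2 - l / 2, A, hA, hpl, ?_⟩
  intro θ hθ
  have h1 := hθ.1
  have h2 := hθ.2
  rcases le_total (θ - l / 2) (Real.pi / 2) with h3 | h3
  · rcases le_total (-(Real.pi / 2)) (θ - l / 2) with h4 | h4
    · rw [hfA _ ⟨by linarith, by linarith⟩, max_eq_left (Real.cos_nonneg_of_neg_pi_div_two_le_of_le h4 h3),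
        ← Real.sin_add_pi_div_two]
      congr 2; ring
    · rw [← hf.per, hz _ ⟨by linarith, by linarith⟩, max_eq_right, mul_zero]
      rw [← Real.cos_neg]
      exact Real.cos_nonpos_of_pi_div_two_le_of_le (by linarith) (by linarith)
  · rw [hz _ ⟨by linarith, by linarith⟩, max_eq_right, mul_zero]
    exact Real.cos_nonpos_of_pi_div_two_le_of_le (by linarith) (by linarith)

end

section

open MeasureTheory Set Filter

def Wz (l : ℝ) (ζ : ℝ → ℝ) (r θ : ℝ) : ℝ := r * Real.cos (θ - l / 2) + ζ r
def chi (l : ℝ) (ζ : ℝ → ℝ) (p : ℝ × ℝ) : ℝ := if 0 < Wz l ζ p.1 p.2 then 1 else 0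
def wU (l A : ℝ) (ζ : ℝ → ℝ) (r θ : ℝ) : ℝ := A * pext l (fun φ => max (Wz l ζ r φ) 0) θ

section
variable {l L A : ℝ} {ζ : ℝ → ℝ}

lemma Wz_rad (hζ : ∀ x y, |ζ x - ζ y| ≤ L * |x - y|) (θ r s : ℝ) :
    |Wz l ζ r θ - Wz l ζ s θ| ≤ (1 + L) * |r - s| := by
  have e : Wz l ζ r θ - Wz l ζ s θ = (r - s) * Real.cos (θ - l / 2) + (ζ r - ζ s) := by unfold Wz; ring
  rw [e]
  refine (abs_add_le _ _).trans ?_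
  rw [abs_mul]
  have := mul_le_mul_of_nonneg_left (Real.abs_cos_le_one (θ - l / 2)) (abs_nonneg (r - s))
  linarith [hζ r s]

lemma Wz_ang (ζ : ℝ → ℝ) (r θ φ : ℝ) : |Wz l ζ r θ - Wz l ζ r φ| ≤ |r| * |θ - φ| := by
  have e : Wz l ζ r θ - Wz l ζ r φ = r * (Real.cos (θ - l / 2) - Real.cos (φ - l / 2)) := by unfold Wz; ring
  rw [e, abs_mul]
  have := cos_lip (θ - l / 2) (φ - l / 2)
  rw [sub_sub_sub_cancel_right, one_mul] at this
  exact mul_le_mul_of_nonneg_left this (abs_nonneg _)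

lemma wU_PLip (hl : 0 < l) (hA : 0 ≤ A) (hL : 0 ≤ L) (hζ : ∀ x y, |ζ x - ζ y| ≤ L * |x - y|) :
    PLip l (A * (1 + L)) (wU l A ζ) := by
  refine ⟨fun r θ => by simp only [wU, pext_per hl], fun r s θ => ?_, fun r θ φ => ?_⟩
  · unfold wU pext
    rw [← mul_sub, abs_mul, abs_of_nonneg hA, mul_assoc]
    refine mul_le_mul_of_nonneg_left ?_ hA
    exact max_lip (fun x y => Wz_rad hζ (l * Int.fract (θ / l)) x y) r s
  · unfold wU
    rw [← mul_sub, abs_mul, abs_of_nonneg hA, mul_assoc, mul_assoc]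
    refine mul_le_mul_of_nonneg_left ?_ hA
    have h1 := pext_lip hl (abs_nonneg r) (max_lip (fun x y => Wz_ang (l := l) ζ r x y)) (by
      have : Wz l ζ r 0 = Wz l ζ r l := by
        unfold Wz
        rw [← Real.cos_neg (0 - l / 2)]; congr 3; ring
      rw [this]) θ φ
    have := mul_nonneg (abs_nonneg r) (abs_nonneg (θ - φ))
    nlinarith

lemma Wz_cont_r (hc : Continuous ζ) (θ : ℝ) : Continuous fun r => Wz l ζ r θ := by unfold Wz; fun_prop
lemma Wz_cont_t (ζ : ℝ → ℝ) (r : ℝ) : Continuous fun θ => Wz l ζ r θ := by unfold Wz; fun_prop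

lemma Wz_dr {r : ℝ} (hd : DifferentiableAt ℝ ζ r) (θ : ℝ) :
    deriv (fun r => Wz l ζ r θ) r = Real.cos (θ - l / 2) + deriv ζ r := by
  have : HasDerivAt (fun r => Wz l ζ r θ) (1 * Real.cos (θ - l / 2) + deriv ζ r) r :=
    ((hasDerivAt_id r).mul_const _).add hd.hasDerivAt
  rw [this.deriv, one_mul]

lemma Wz_dt (ζ : ℝ → ℝ) (r θ : ℝ) :
    deriv (fun θ => Wz l ζ r θ) θ = - (r * Real.sin (θ - l / 2)) := by
  have : HasDerivAt (fun θ => Wz l ζ r θ) (r * (- Real.sin (θ - l / 2) * 1)) θ :=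
    ((((hasDerivAt_id θ).sub_const (l / 2)).cos).const_mul r).add_const _
  rw [this.deriv]; ring

lemma chi_nonneg (l : ℝ) (ζ : ℝ → ℝ) (p : ℝ × ℝ) : 0 ≤ chi l ζ p := by unfold chi; split_ifs <;> norm_num
lemma chi_le (l : ℝ) (ζ : ℝ → ℝ) (p : ℝ × ℝ) : chi l ζ p ≤ 1 := by unfold chi; split_ifs <;> norm_num

lemma Wp_dr (hc : Continuous ζ) {r : ℝ} (hd : DifferentiableAt ℝ ζ r) (θ : ℝ) :
    deriv (fun r => max (Wz l ζ r θ) 0) r = chi l ζ (r, θ) * (Real.cos (θ - l / 2) + deriv ζ r) := by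
  unfold chi
  split_ifs with h
  · rw [max_zero_deriv_of_pos (Wz_cont_r hc θ) h, Wz_dr hd, one_mul]
  · rw [max_zero_deriv_of_nonpos (g := fun r => Wz l ζ r θ) (not_lt.1 h), zero_mul]

lemma Wp_dt (ζ : ℝ → ℝ) (r θ : ℝ) :
    deriv (fun θ => max (Wz l ζ r θ) 0) θ = - (chi l ζ (r, θ) * (r * Real.sin (θ - l / 2))) := by
  unfold chi
  split_ifs with h
  · rw [max_zero_deriv_of_pos (Wz_cont_t ζ r) h, Wz_dt, one_mul]
  · rw [max_zero_deriv_of_nonpos (not_lt.1 h), zero_mul, neg_zero]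

lemma den_wU (hl : 0 < l) (hA : 0 < A) (hc : Continuous ζ) {lp lm r θ : ℝ} (hr : 0 < r) (hθ : θ ∈ Ioo 0 l)
    (hd : DifferentiableAt ℝ ζ r) :
    den lp lm (wU l A ζ) (r, θ) = (A ^ 2 + lp) * chi l ζ (r, θ)
      + A ^ 2 * (2 * Real.cos (θ - l / 2) * deriv ζ r * chi l ζ (r, θ)) + A ^ 2 * (deriv ζ r ^ 2 * chi l ζ (r, θ)) := by
  have hθ' : θ ∈ Ico 0 l := ⟨hθ.1.le, hθ.2⟩
  have h0 : ∀ s, wU l A ζ s θ = A * max (Wz l ζ s θ) 0 := fun s => by unfold wU; rw [pext_eq hl _ hθ']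
  have h1 : deriv (fun s => wU l A ζ s θ) r = A * (chi l ζ (r, θ) * (Real.cos (θ - l / 2) + deriv ζ r)) := by
    simp only [h0]
    rw [← Wp_dr hc hd]
    exact deriv_const_mul_field A
  have h2 : deriv (fun φ => wU l A ζ r φ) θ = A * - (chi l ζ (r, θ) * (r * Real.sin (θ - l / 2))) := by
    rw [← Wp_dt]
    have : (fun φ => wU l A ζ r φ) =ᶠ[nhds θ] fun φ => A * max (Wz l ζ r φ) 0 := by
      filter_upwards [isOpen_Ioo.mem_nhds hθ] with s hs
      unfold wU; rw [pext_eq hl _ ⟨hs.1.le, hs.2⟩]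
    rw [this.deriv_eq]
    exact deriv_const_mul_field A
  unfold den gradSq
  simp only [h1, h2]
  simp only [h0]
  have hs := Real.sin_sq_add_cos_sq (θ - l / 2)
  have hnn : ¬ A * max (Wz l ζ r θ) 0 < 0 := not_lt.2 (mul_nonneg hA.le (le_max_right _ _))
  rw [if_neg hnn]
  by_cases h : 0 < Wz l ζ r θ
  · have hx : chi l ζ (r, θ) = 1 := if_pos h
    rw [hx, if_pos (mul_pos hA (lt_max_of_lt_left h))]
    have e : (A * -(1 * (r * Real.sin (θ - l / 2)))) ^ 2 / r ^ 2 = A ^ 2 * Real.sin (θ - l / 2) ^ 2 := by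
      field_simp
    rw [e]
    linear_combination A ^ 2 * hs
  · have hx : chi l ζ (r, θ) = 0 := if_neg h
    rw [hx, max_eq_right (not_lt.1 h)]
    simp
end

end

section

open MeasureTheory Set Filter

def ar (l : ℝ) (ζ : ℝ → ℝ) : ℝ := ∫ p in Om l 1, chi l ζ p * p.1
def PP (l : ℝ) : ℝ := ∫ θ in (0:ℝ)..l, 2 * Real.cos (θ - l / 2) * max (Real.cos (θ - l / 2)) 0
def Phi (l : ℝ) (ζ : ℝ → ℝ) : ℝ := ∫ r in (0:ℝ)..1, max (r * Real.cos (l / 2) + ζ r) 0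
def I3 (l : ℝ) (ζ : ℝ → ℝ) : ℝ := ∫ p in Om l 1, deriv ζ p.1 ^ 2 * chi l ζ p * p.1

section
variable {l L A : ℝ} {ζ : ℝ → ℝ}

lemma chi_meas (hc : Continuous ζ) (l : ℝ) : Measurable (chi l ζ) := by
  unfold chi
  refine Measurable.ite (measurableSet_lt measurable_const ?_) measurable_const measurable_const
  have : Continuous fun p : ℝ × ℝ => Wz l ζ p.1 p.2 := by unfold Wz; fun_prop
  exact this.measurable

lemma mul_chi_int (hc : Continuous ζ) (l : ℝ) {F : ℝ × ℝ → ℝ} (hF : Measurable F) {C : ℝ}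
    (hC : ∀ p, |F p| ≤ C) : IntegrableOn (fun p => F p * chi l ζ p * p.1) (Om l 1) := by
  refine intOn_Om (C := C) ((hF.mul (chi_meas hc l)).mul measurable_fst) ?_
  rintro p ⟨⟨h1, h2⟩, -⟩
  rw [abs_mul, abs_mul, abs_of_pos h1, abs_of_nonneg (chi_nonneg l ζ p)]
  have hC0 : 0 ≤ C := (abs_nonneg _).trans (hC p)
  calc |F p| * chi l ζ p * p.1 ≤ C * 1 * 1 := by
        have := chi_le l ζ p
        have := chi_nonneg l ζ p
        have := hC p
        gcongr
    _ = C := by ring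

lemma stepA_pt (hL : 0 ≤ L) (hζ : ∀ x y, |ζ x - ζ y| ≤ L * |x - y|) (h1 : ζ 1 = 0) (θ : ℝ) :
    ∫ r in (0:ℝ)..1, (2 * Real.cos (θ - l / 2) * deriv ζ r * chi l ζ (r, θ) * r
      + 2 * (Real.cos (θ - l / 2) * max (Wz l ζ r θ) 0) + 2 * (Real.cos (θ - l / 2) ^ 2 * chi l ζ (r, θ) * r)) =
    2 * Real.cos (θ - l / 2) * max (Real.cos (θ - l / 2)) 0 := by
  have hc : Continuous ζ := (lip_of hζ).continuous
  have hid : ∀ x y : ℝ, |x - y| ≤ 1 * |x - y| := fun x y => by simp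
  have h := (lip_ac (max_lip (fun x y => Wz_rad (l := l) hζ θ x y)) 0 1).integral_deriv_mul_eq_sub
    (lip_ac (f := fun x => x) hid 0 1)
  have h2 : Wz l ζ 1 θ = Real.cos (θ - l / 2) := by unfold Wz; rw [h1]; ring
  rw [h2, mul_one, mul_zero, sub_zero] at h
  rw [← h, ← intervalIntegral.integral_const_mul]
  refine intervalIntegral.integral_congr_ae ?_
  filter_upwards [(lip_of hζ).ae_differentiableAt_real] with r hr _
  rw [Wp_dr hc hr]
  have : deriv (fun x : ℝ => x) r = 1 := by simp
  rw [this]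
  ring

lemma stepB_pt (ζ : ℝ → ℝ) (r : ℝ) :
    ∫ θ in (0:ℝ)..l, (Real.cos (θ - l / 2) * max (Wz l ζ r θ) 0 - Real.sin (θ - l / 2) ^ 2 * chi l ζ (r, θ) * r) =
    2 * Real.sin (l / 2) * max (r * Real.cos (l / 2) + ζ r) 0 := by
  have hs : ∀ x y : ℝ, |Real.sin (x - l / 2) - Real.sin (y - l / 2)| ≤ 1 * |x - y| := fun x y => by
    simpa using sin_lip (x - l / 2) (y - l / 2)
  have h := (lip_ac hs 0 l).integral_deriv_mul_eq_sub (lip_ac (max_lip (fun x y => Wz_ang (l := l) ζ r x y)) 0 l)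
  have e1 : Wz l ζ r l = r * Real.cos (l / 2) + ζ r := by
    unfold Wz; congr 3; ring
  have e2 : Wz l ζ r 0 = r * Real.cos (l / 2) + ζ r := by
    unfold Wz; rw [zero_sub, Real.cos_neg]
  have e3 : l - l / 2 = l / 2 := by ring
  rw [e1, e2, e3, zero_sub, Real.sin_neg] at h
  have : 2 * Real.sin (l / 2) * max (r * Real.cos (l / 2) + ζ r) 0 =
    Real.sin (l / 2) * max (r * Real.cos (l / 2) + ζ r) 0 - -Real.sin (l / 2) * max (r * Real.cos (l / 2) + ζ r) 0 := by ring
  rw [this, ← h]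
  congr 1; funext θ
  rw [Wp_dt]
  have : HasDerivAt (fun θ => Real.sin (θ - l / 2)) (Real.cos (θ - l / 2) * 1) θ :=
    ((hasDerivAt_id θ).sub_const (l / 2)).sin
  rw [this.deriv]
  ring

lemma Jw (hl : 0 < l) (hA : 0 < A) {lp lm : ℝ} (hlp : 0 ≤ lp) (hlm : 0 ≤ lm) (hL : 0 ≤ L)
    (hζ : ∀ x y, |ζ x - ζ y| ≤ L * |x - y|) (h1 : ζ 1 = 0) :
    Jfun l lp lm (wU l A ζ) 1 = (lp - A ^ 2) * ar l ζ
      + A ^ 2 * (PP l - 4 * Real.sin (l / 2) * Phi l ζ + I3 l ζ) := by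
  have hc : Continuous ζ := (lip_of hζ).continuous
  have hdm : Measurable fun p : ℝ × ℝ => deriv ζ p.1 := (measurable_deriv ζ).comp measurable_fst
  have hcm : Measurable fun p : ℝ × ℝ => Real.cos (p.2 - l / 2) := by fun_prop
  have hsm : Measurable fun p : ℝ × ℝ => Real.sin (p.2 - l / 2) := by fun_prop
  have hdL : ∀ x, |deriv ζ x| ≤ L := deriv_le_of hL hζ
  have i1 : IntegrableOn (fun p => chi l ζ p * p.1) (Om l 1) := by
    simpa using mul_chi_int hc l (F := fun _ => 1) measurable_const (C := 1) (by simp)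
  have i2 : IntegrableOn (fun p : ℝ × ℝ => 2 * Real.cos (p.2 - l / 2) * deriv ζ p.1 * chi l ζ p * p.1) (Om l 1) := by
    refine mul_chi_int hc l (F := fun p => 2 * Real.cos (p.2 - l / 2) * deriv ζ p.1) ((hcm.const_mul 2).mul hdm) (C := 2 * 1 * L) ?_
    intro p
    rw [abs_mul, abs_mul, abs_two]
    have a1 := Real.abs_cos_le_one (p.2 - l / 2)
    have a2 := hdL p.1
    gcongr
  have i3 : IntegrableOn (fun p : ℝ × ℝ => deriv ζ p.1 ^ 2 * chi l ζ p * p.1) (Om l 1) := by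
    refine mul_chi_int hc l (F := fun p => deriv ζ p.1 ^ 2) (hdm.pow_const 2) (C := L ^ 2) ?_
    intro p
    rw [abs_of_nonneg (sq_nonneg _)]
    exact sq_le_of_abs (hdL p.1)
  have ic : IntegrableOn (fun p : ℝ × ℝ => Real.cos (p.2 - l / 2) ^ 2 * chi l ζ p * p.1) (Om l 1) := by
    refine mul_chi_int hc l (F := fun p => Real.cos (p.2 - l / 2) ^ 2) (hcm.pow_const 2) (C := 1) ?_
    intro p
    rw [abs_of_nonneg (sq_nonneg _)]
    exact Real.cos_sq_le_one _
  have is : IntegrableOn (fun p : ℝ × ℝ => Real.sin (p.2 - l / 2) ^ 2 * chi l ζ p * p.1) (Om l 1) := by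
    refine mul_chi_int hc l (F := fun p => Real.sin (p.2 - l / 2) ^ 2) (hsm.pow_const 2) (C := 1) ?_
    intro p
    rw [abs_of_nonneg (sq_nonneg _)]
    exact Real.sin_sq_le_one _
  have ig : IntegrableOn (fun p : ℝ × ℝ => Real.cos (p.2 - l / 2) * max (Wz l ζ p.1 p.2) 0) (Om l 1) := by
    have hcont : Continuous fun p : ℝ × ℝ => Real.cos (p.2 - l / 2) * max (Wz l ζ p.1 p.2) 0 := by unfold Wz; fun_prop
    have hcomp : IsCompact (Icc (0:ℝ) 1 ×ˢ Icc (0:ℝ) l) := isCompact_Icc.prod isCompact_Icc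
    exact (hcont.continuousOn.integrableOn_compact hcomp).mono_set (prod_mono Ioo_subset_Icc_self Ioo_subset_Icc_self)
  have j1 : IntegrableOn (fun p : ℝ × ℝ => (A ^ 2 + lp) * (chi l ζ p * p.1)
      + A ^ 2 * (2 * Real.cos (p.2 - l / 2) * deriv ζ p.1 * chi l ζ p * p.1)) (Om l 1) :=
    Integrable.add (i1.const_mul _) (i2.const_mul _)
  have j2 : IntegrableOn (fun p : ℝ × ℝ => 2 * Real.cos (p.2 - l / 2) * deriv ζ p.1 * chi l ζ p * p.1
      + 2 * (Real.cos (p.2 - l / 2) * max (Wz l ζ p.1 p.2) 0)) (Om l 1) :=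
    Integrable.add i2 (ig.const_mul 2)
  have j3 : IntegrableOn (fun p : ℝ × ℝ => 2 * Real.cos (p.2 - l / 2) * deriv ζ p.1 * chi l ζ p * p.1
      + 2 * (Real.cos (p.2 - l / 2) * max (Wz l ζ p.1 p.2) 0)
      + 2 * (Real.cos (p.2 - l / 2) ^ 2 * chi l ζ p * p.1)) (Om l 1) :=
    Integrable.add j2 (ic.const_mul 2)
  have j4 : IntegrableOn (fun p : ℝ × ℝ => Real.cos (p.2 - l / 2) * max (Wz l ζ p.1 p.2) 0
      - Real.sin (p.2 - l / 2) ^ 2 * chi l ζ p * p.1) (Om l 1) := Integrable.sub ig is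
  -- energy in terms of pieces
  have hJ : Jfun l lp lm (wU l A ζ) 1 = (A ^ 2 + lp) * ar l ζ
      + A ^ 2 * (∫ p in Om l 1, 2 * Real.cos (p.2 - l / 2) * deriv ζ p.1 * chi l ζ p * p.1) + A ^ 2 * I3 l ζ := by
    rw [Jfun_eq, ar, I3, ← integral_const_mul, ← integral_const_mul, ← integral_const_mul,
      ← integral_add (i1.const_mul _) (i2.const_mul _), ← integral_add j1 (i3.const_mul _)]
    refine setIntegral_congr_ae (measurableSet_Om l 1) ?_
    have hq : Measure.QuasiMeasurePreserving (Prod.fst : ℝ × ℝ → ℝ) volume volume := by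
      rw [Measure.volume_eq_prod]; exact Measure.quasiMeasurePreserving_fst
    filter_upwards [hq.ae (lip_of hζ).ae_differentiableAt_real] with p hp hpO
    obtain ⟨r, θ⟩ := p
    rw [den_wU hl hA hc hpO.1.1 hpO.2 hp]
    ring
  have hA2 : (∫ p in Om l 1, 2 * Real.cos (p.2 - l / 2) * deriv ζ p.1 * chi l ζ p * p.1)
      + 2 * (∫ p in Om l 1, Real.cos (p.2 - l / 2) * max (Wz l ζ p.1 p.2) 0)
      + 2 * (∫ p in Om l 1, Real.cos (p.2 - l / 2) ^ 2 * chi l ζ p * p.1) = PP l := by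
    rw [← integral_const_mul, ← integral_const_mul, ← integral_add i2 (ig.const_mul _),
      ← integral_add j2 (ic.const_mul _), fub_tr hl.le zero_le_one j3]
    unfold PP
    congr 1; funext θ
    exact stepA_pt hL hζ h1 θ
  have hB : (∫ p in Om l 1, Real.cos (p.2 - l / 2) * max (Wz l ζ p.1 p.2) 0)
      - (∫ p in Om l 1, Real.sin (p.2 - l / 2) ^ 2 * chi l ζ p * p.1) = 2 * Real.sin (l / 2) * Phi l ζ := by
    rw [← integral_sub ig is, fub_rt hl.le zero_le_one j4, Phi, ← intervalIntegral.integral_const_mul]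
    congr 1; funext r
    exact stepB_pt ζ r
  have hC : (∫ p in Om l 1, Real.sin (p.2 - l / 2) ^ 2 * chi l ζ p * p.1)
      + (∫ p in Om l 1, Real.cos (p.2 - l / 2) ^ 2 * chi l ζ p * p.1) = ar l ζ := by
    rw [← integral_add is ic, ar]
    congr 1; funext p
    rw [← add_mul, ← add_mul, Real.sin_sq_add_cos_sq, one_mul]
  rw [hJ]
  linear_combination A ^ 2 * hA2 - 2 * A ^ 2 * hB - 2 * A ^ 2 * hC
end

end

section

open MeasureTheory Set Filter

lemma plane_ineq {l lp lm K A L : ℝ} (hl : 0 < l) (hl2 : l < 2 * Real.pi) (hpl : Real.pi ≤ l) (hlp : 0 ≤ lp) (hlm : 0 ≤ lm)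
    (hA : 0 < A) {f : ℝ → ℝ} (hf : TLip l K f) (hm : HMin l lp lm f)
    (hfA : ∀ θ ∈ Icc 0 l, f θ = A * max (Real.cos (θ - l / 2)) 0) {ζ : ℝ → ℝ} (hL : 0 ≤ L)
    (hζ : ∀ x y, |ζ x - ζ y| ≤ L * |x - y|) (h1 : ζ 1 = 0) :
    0 ≤ (lp - A ^ 2) * (ar l ζ - ar l (fun _ => 0)) + A ^ 2 * (I3 l ζ - 4 * Real.sin (l / 2) * Phi l ζ) := by
  have hfr : ∀ θ, f θ = A * max (Real.cos (l * Int.fract (θ / l) - l / 2)) 0 := by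
    intro θ
    rw [← hf.fract hl θ]
    exact hfA _ ⟨mul_nonneg hl.le (Int.fract_nonneg _), mul_le_of_le_one_right hl.le (Int.fract_lt_one _).le⟩
  have h := hm (wU l A ζ) _ (wU_PLip hl hA.le hL hζ) (by
    intro θ
    rw [hfr θ]
    simp only [wU, pext, Wz, h1, one_mul, add_zero])
  have h0 : Jfun l lp lm (zU f) 1 = Jfun l lp lm (wU l A (fun _ => 0)) 1 := by
    refine Jfun_congr fun s hs θ => ?_
    simp only [zU, hfr θ, wU, pext, Wz, add_zero]
    have : max (s * Real.cos (l * Int.fract (θ / l) - l / 2)) 0 = s * max (Real.cos (l * Int.fract (θ / l) - l / 2)) 0 := by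
      rw [mul_max_of_nonneg _ _ hs.1.le, mul_zero]
    rw [this]; ring
  rw [h0, Jw hl hA hlp hlm hL hζ h1, Jw (L := 0) hl hA hlp hlm le_rfl (by simp) rfl] at h
  have hcos : Real.cos (l / 2) ≤ 0 := Real.cos_nonpos_of_pi_div_two_le_of_le (by linarith) (by linarith [Real.pi_pos])
  have e1 : Phi l (fun _ => 0) = 0 := by
    unfold Phi
    rw [intervalIntegral.integral_congr (g := fun _ => 0)]
    · simp
    · intro r hr
      rw [uIcc_of_le zero_le_one] at hr
      simp only [add_zero]
      exact max_eq_right (mul_nonpos_of_nonneg_of_nonpos hr.1 hcos)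
  have e2 : I3 l (fun _ => 0) = 0 := by
    unfold I3; simp
  rw [e1, e2] at h
  nlinarith

lemma I3_le {l L : ℝ} (hl : 0 < l) {ζ : ℝ → ℝ} (hL : 0 ≤ L)
    (hζ : ∀ x y, |ζ x - ζ y| ≤ L * |x - y|) : I3 l ζ ≤ l * ∫ r in (0:ℝ)..1, deriv ζ r ^ 2 * r := by
  have hc : Continuous ζ := (lip_of hζ).continuous
  have hdm : Measurable fun p : ℝ × ℝ => deriv ζ p.1 := (measurable_deriv ζ).comp measurable_fst
  have hdL : ∀ x, |deriv ζ x| ≤ L := deriv_le_of hL hζ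
  have i3 : IntegrableOn (fun p : ℝ × ℝ => deriv ζ p.1 ^ 2 * chi l ζ p * p.1) (Om l 1) := by
    refine mul_chi_int hc l (F := fun p => deriv ζ p.1 ^ 2) (hdm.pow_const 2) (C := L ^ 2) ?_
    intro p
    rw [abs_of_nonneg (sq_nonneg _)]
    exact sq_le_of_abs (hdL p.1)
  have i4 : IntegrableOn (fun p : ℝ × ℝ => deriv ζ p.1 ^ 2 * p.1) (Om l 1) := by
    refine intOn_Om ((hdm.pow_const 2).mul measurable_fst) (C := L ^ 2 * 1) ?_
    rintro p ⟨⟨h1, h2⟩, -⟩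
    have := sq_le_of_abs (hdL p.1)
    rw [abs_of_nonneg (by positivity)]
    gcongr
  have h1 : I3 l ζ ≤ ∫ p in Om l 1, deriv ζ p.1 ^ 2 * p.1 := by
    unfold I3
    refine setIntegral_mono_on i3 i4 (measurableSet_Om l 1) ?_
    rintro p ⟨⟨h1, h2⟩, -⟩
    have := chi_le l ζ p
    have k : deriv ζ p.1 ^ 2 * chi l ζ p ≤ deriv ζ p.1 ^ 2 * 1 := mul_le_mul_of_nonneg_left this (sq_nonneg _)
    rw [mul_one] at k
    exact mul_le_mul_of_nonneg_right k h1.le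
  rw [fub_rt hl.le zero_le_one i4] at h1
  simp only [intervalIntegral.integral_const, sub_zero, smul_eq_mul] at h1
  rwa [intervalIntegral.integral_const_mul] at h1

lemma chi_int {l L : ℝ} {ζ : ℝ → ℝ} (hζ : ∀ x y, |ζ x - ζ y| ≤ L * |x - y|) :
    IntegrableOn (fun p => chi l ζ p * p.1) (Om l 1) := by
  simpa using mul_chi_int (lip_of hζ).continuous l (F := fun _ => 1) measurable_const (C := 1) (by simp)

lemma chi_mono {l : ℝ} {ζ ζ' : ℝ → ℝ} {p : ℝ × ℝ} (h : ζ p.1 ≤ ζ' p.1) : chi l ζ p ≤ chi l ζ' p := by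
  by_cases h1 : 0 < Wz l ζ p.1 p.2
  · have h2 : 0 < Wz l ζ' p.1 p.2 := by unfold Wz at *; linarith
    unfold chi; rw [if_pos h1, if_pos h2]
  · have : chi l ζ p = 0 := if_neg h1
    rw [this]; exact chi_nonneg _ _ _

/-- the logarithmic competitor -/
lemma plane_case1 {l lp lm K A : ℝ} (hl : 0 < l) (hl2 : l < 2 * Real.pi) (hpl : Real.pi ≤ l) (hlp : 0 ≤ lp) (hlm : 0 ≤ lm)
    (hA : 0 < A) {f : ℝ → ℝ} (hf : TLip l K f) (hm : HMin l lp lm f)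
    (hfA : ∀ θ ∈ Icc 0 l, f θ = A * max (Real.cos (θ - l / 2)) 0) (hle : lp ≤ A ^ 2) : False := by
  have hS : 0 < Real.sin (l / 2) := Real.sin_pos_of_pos_of_lt_pi (by linarith) (by linarith)
  set S := Real.sin (l / 2) with hSdef
  obtain ⟨M, hM0, hM⟩ : ∃ M : ℝ, 0 < M ∧ l < 2 * S * M := by
    refine ⟨l / (2 * S) + 1, by positivity, ?_⟩
    have : 2 * S * (l / (2 * S) + 1) = l + 2 * S := by field_simp
    rw [this]; linarith
  set δ := Real.exp (-M) with hδ
  have hδ0 : 0 < δ := Real.exp_pos _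
  have hδ1 : δ < 1 := by rw [hδ]; simpa using hM0
  have hlog : Real.log δ = -M := Real.log_exp _
  set ζ : ℝ → ℝ := fun r => -(δ / M) * Real.log (max r δ) with hζdef
  have hζ : ∀ x y, |ζ x - ζ y| ≤ (1 / M) * |x - y| := by
    intro x y
    have e : ζ x - ζ y = -(δ / M) * (Real.log (max x δ) - Real.log (max y δ)) := by simp only [hζdef]; ring
    rw [e, abs_mul, abs_neg, abs_of_pos (by positivity)]
    have := mul_le_mul_of_nonneg_left (log_max_lip hδ0 x y) (by positivity : 0 ≤ δ / M)
    refine this.trans (le_of_eq ?_)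
    field_simp
  have hζ1 : ζ 1 = 0 := by simp [hζdef, max_eq_left hδ1.le]
  have hζs : ∀ r, r ≤ δ → ζ r = δ := by
    intro r hr
    simp only [hζdef]
    rw [max_eq_right hr, hlog]; field_simp
  have hζp : ∀ r, r ≤ 1 → 0 ≤ ζ r := by
    intro r hr
    simp only [hζdef]
    have h1 : Real.log (max r δ) ≤ 0 := Real.log_nonpos (le_max_of_le_right hδ0.le) (max_le hr hδ1.le)
    have h2 : 0 ≤ δ / M := by positivity
    nlinarith
  have key := plane_ineq hl hl2 hpl hlp hlm hA hf hm hfA (by positivity) hζ hζ1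
  have har : ar l (fun _ => 0) ≤ ar l ζ := by
    unfold ar
    refine setIntegral_mono_on (chi_int (L := 0) (by simp)) (chi_int hζ) (measurableSet_Om l 1) ?_
    rintro p ⟨⟨h1, h2⟩, -⟩
    exact mul_le_mul_of_nonneg_right (chi_mono (hζp _ h2.le)) h1.le
  have hzc : Continuous ζ := (lip_of hζ).continuous
  have hPhi : δ ^ 2 / 2 ≤ Phi l ζ := by
    have hcont : Continuous fun r => max (r * Real.cos (l / 2) + ζ r) 0 := by fun_prop
    unfold Phi
    rw [← intervalIntegral.integral_add_adjacent_intervals (hcont.intervalIntegrable 0 δ) (hcont.intervalIntegrable δ 1)]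
    have h2 : 0 ≤ ∫ r in δ..1, max (r * Real.cos (l / 2) + ζ r) 0 :=
      intervalIntegral.integral_nonneg hδ1.le fun r _ => le_max_right _ _
    have h3 : ∫ r in (0:ℝ)..δ, (δ - r) ≤ ∫ r in (0:ℝ)..δ, max (r * Real.cos (l / 2) + ζ r) 0 := by
      refine intervalIntegral.integral_mono_on hδ0.le (Continuous.intervalIntegrable (by fun_prop) _ _) (hcont.intervalIntegrable 0 δ) ?_
      intro r hr
      refine le_max_of_le_left ?_
      rw [hζs r hr.2]
      have := mul_le_mul_of_nonneg_left (Real.neg_one_le_cos (l / 2)) hr.1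
      linarith
    have h4 : ∫ r in (0:ℝ)..δ, (δ - r) = δ ^ 2 / 2 := by
      rw [intervalIntegral.integral_sub (by simp) (by simp)]
      simp; ring
    linarith
  have hI : I3 l ζ ≤ l * (δ ^ 2 / M) := by
    refine (I3_le hl (by positivity) hζ).trans (le_of_eq ?_)
    congr 1
    have hdL : ∀ x, |deriv ζ x| ≤ 1 / M := deriv_le_of (by positivity) hζ
    have hIntg : ∀ a b : ℝ, 0 ≤ a → a ≤ b → b ≤ 1 → IntervalIntegrable (fun r => deriv ζ r ^ 2 * r) volume a b := by
      intro a b ha hab hb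
      refine bm_int (((measurable_deriv ζ).pow_const 2).mul measurable_id') hab (C := (1 / M) ^ 2 * 1) ?_
      intro x hx
      have h0 : 0 ≤ x := ha.trans hx.1.le
      have h1 : x ≤ 1 := hx.2.le.trans hb
      have := sq_le_of_abs (hdL x)
      rw [Pi.mul_apply, abs_of_nonneg (by positivity)]
      gcongr
    rw [← intervalIntegral.integral_add_adjacent_intervals (hIntg 0 δ le_rfl hδ0.le hδ1.le) (hIntg δ 1 hδ0.le hδ1.le le_rfl)]
    have p1 : ∫ r in (0:ℝ)..δ, deriv ζ r ^ 2 * r = 0 := by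
      rw [intervalIntegral.integral_of_le hδ0.le, integral_Ioc_eq_integral_Ioo]
      rw [setIntegral_congr_fun (g := fun _ => 0) measurableSet_Ioo]
      · simp
      · intro r hr
        have : ζ =ᶠ[nhds r] fun _ => δ := by
          filter_upwards [isOpen_Iio.mem_nhds hr.2] with s hs
          exact hζs s (le_of_lt hs)
        simp only [this.deriv_eq]; simp
    have p2 : ∫ r in δ..1, deriv ζ r ^ 2 * r = ∫ r in δ..1, (δ / M) ^ 2 * (1 / r) := by
      rw [intervalIntegral.integral_of_le hδ1.le, intervalIntegral.integral_of_le hδ1.le]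
      rw [integral_Ioc_eq_integral_Ioo, integral_Ioc_eq_integral_Ioo]
      refine setIntegral_congr_fun measurableSet_Ioo fun r hr => ?_
      have hr0 : r ≠ 0 := (hδ0.trans hr.1).ne'
      have : deriv ζ r = -(δ / M) * (1 / r) := ((hasDerivAt_log_max hδ0 hr.1).const_mul (-(δ / M))).deriv
      simp only [this]
      field_simp
    rw [p1, p2, intervalIntegral.integral_const_mul, integral_one_div_of_pos hδ0 one_pos, one_div, Real.log_inv, hlog]
    field_simp
    ring
  have h1 : (lp - A ^ 2) * (ar l ζ - ar l (fun _ => 0)) ≤ 0 :=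
    mul_nonpos_of_nonpos_of_nonneg (by linarith) (by linarith)
  have h2 : I3 l ζ - 4 * S * Phi l ζ < 0 := by
    have h3 := mul_le_mul_of_nonneg_left hPhi (by positivity : 0 ≤ 4 * S)
    have h4 : l * (δ ^ 2 / M) < 4 * S * (δ ^ 2 / 2) := by
      have : l * (δ ^ 2 / M) = (l / M) * δ ^ 2 := by ring
      have h5 : l / M < 2 * S := by rwa [div_lt_iff₀ hM0]
      have := mul_lt_mul_of_pos_right h5 (by positivity : 0 < δ ^ 2)
      linarith
    linarith
  have h3 := mul_neg_of_pos_of_neg (by positivity : 0 < A ^ 2) h2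
  linarith

lemma plane_case2 {l lp lm K A : ℝ} (hl : 0 < l) (hl2 : l < 2 * Real.pi) (hpl : Real.pi ≤ l) (hlp : 0 ≤ lp) (hlm : 0 ≤ lm)
    (hA : 0 < A) {f : ℝ → ℝ} (hf : TLip l K f) (hm : HMin l lp lm f)
    (hfA : ∀ θ ∈ Icc 0 l, f θ = A * max (Real.cos (θ - l / 2)) 0) (hlt : A ^ 2 < lp) : False := by
  have hpi := Real.pi_gt_three
  have hd : 0 < lp - A ^ 2 := by linarith
  set d := lp - A ^ 2 with hddef
  obtain ⟨t, ht0, ht1, ht2⟩ : ∃ t : ℝ, 0 < t ∧ t ≤ 1 ∧ A ^ 2 * l * t ≤ d / 16 := by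
    refine ⟨min 1 (d / (16 * (A ^ 2 * l))), by positivity, min_le_left _ _, ?_⟩
    have := mul_le_mul_of_nonneg_left (min_le_right 1 (d / (16 * (A ^ 2 * l)))) (by positivity : 0 ≤ A ^ 2 * l)
    refine this.trans (le_of_eq ?_)
    field_simp
  set ζ : ℝ → ℝ := fun r => -(t * (1 - r)) with hζdef
  have hζ : ∀ x y, |ζ x - ζ y| ≤ t * |x - y| := by
    intro x y
    have e : ζ x - ζ y = t * (x - y) := by simp only [hζdef]; ring
    rw [e, abs_mul, abs_of_pos ht0]
  have hζ1 : ζ 1 = 0 := by simp [hζdef]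
  have hζp : ∀ r, r ≤ 1 → ζ r ≤ 0 := by
    intro r hr
    simp only [hζdef]
    nlinarith
  have key := plane_ineq hl hl2 hpl hlp hlm hA hf hm hfA ht0.le hζ hζ1
  have hcos : Real.cos (l / 2) ≤ 0 := Real.cos_nonpos_of_pi_div_two_le_of_le (by linarith) (by linarith)
  have hPhi : Phi l ζ = 0 := by
    unfold Phi
    rw [intervalIntegral.integral_congr (g := fun _ => 0)]
    · simp
    · intro r hr
      rw [uIcc_of_le zero_le_one] at hr
      have h1 := mul_nonpos_of_nonneg_of_nonpos hr.1 hcos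
      have h2 := hζp r hr.2
      exact max_eq_right (by linarith)
  have hI : I3 l ζ ≤ l * t ^ 2 := by
    refine (I3_le hl ht0.le hζ).trans ?_
    refine mul_le_mul_of_nonneg_left ?_ hl.le
    have : ∀ r, deriv ζ r = t := by
      intro r
      have : HasDerivAt ζ (-(t * (0 - 1))) r :=
        (((hasDerivAt_const r (1:ℝ)).sub (hasDerivAt_id r)).const_mul t).neg
      rw [this.deriv]; ring
    simp only [this]
    rw [intervalIntegral.integral_const_mul, integral_id]
    nlinarith [sq_nonneg t]
  set B : Set (ℝ × ℝ) := Ioo (0:ℝ) (1 / 2) ×ˢ Ioo (l / 2 + Real.pi / 2 - t) (l / 2 + Real.pi / 2) with hB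
  have hBm : MeasurableSet B := measurableSet_Ioo.prod measurableSet_Ioo
  have hBO : B ⊆ Om l 1 := by
    rintro ⟨r, θ⟩ ⟨⟨h1, h2⟩, ⟨h3, h4⟩⟩
    refine ⟨⟨h1, ?_⟩, ⟨?_, ?_⟩⟩ <;> simp only at * <;> linarith
  have har : t / 8 ≤ ar l (fun _ => 0) - ar l ζ := by
    unfold ar
    have c0 : IntegrableOn (fun p => chi l (fun _ => 0) p * p.1) (Om l 1) := chi_int (L := 0) (by simp)
    have c1 : IntegrableOn (fun p => chi l ζ p * p.1) (Om l 1) := chi_int hζ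
    have c2 : IntegrableOn (fun p => chi l (fun _ => 0) p * p.1 - chi l ζ p * p.1) (Om l 1) := Integrable.sub c0 c1
    rw [← integral_sub c0 c1]
    have h1 : ∫ p in B, (chi l (fun _ => 0) p * p.1 - chi l ζ p * p.1) ≤
        ∫ p in Om l 1, (chi l (fun _ => 0) p * p.1 - chi l ζ p * p.1) := by
      refine setIntegral_mono_set c2 ?_ hBO.eventuallyLE
      refine (ae_restrict_iff' (measurableSet_Om l 1)).2 (Eventually.of_forall ?_)
      rintro p ⟨⟨h1, h2⟩, -⟩
      have := mul_le_mul_of_nonneg_right (chi_mono (l := l) (ζ := ζ) (ζ' := fun _ => 0) (hζp _ h2.le)) h1.le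
      simp only [Pi.zero_apply]; linarith
    refine le_trans (le_of_eq ?_) h1
    have h2 : ∫ p in B, (chi l (fun _ => 0) p * p.1 - chi l ζ p * p.1) = ∫ p in B, p.1 * (1:ℝ) := by
      refine setIntegral_congr_fun hBm ?_
      rintro ⟨r, θ⟩ ⟨⟨h1, h2⟩, ⟨h3, h4⟩⟩
      simp only at h1 h2 h3 h4
      have hc0 : 0 < Real.cos (θ - l / 2) := Real.cos_pos_of_mem_Ioo ⟨by linarith, by linarith⟩
      have hc1 : Real.cos (θ - l / 2) ≤ t := by
        rw [← Real.sin_pi_div_two_sub]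
        exact (Real.sin_le (by linarith)).trans (by linarith)
      have k0 : chi l (fun _ => 0) (r, θ) = 1 := if_pos (by
        simp only [Wz]; have := mul_pos h1 hc0; linarith)
      have k1 : chi l ζ (r, θ) = 0 := if_neg (by
        simp only [Wz, hζdef, not_lt]
        have := mul_le_mul_of_nonneg_left hc1 h1.le
        nlinarith)
      simp only [k0, k1]; ring
    rw [h2, hB, Measure.volume_eq_prod, setIntegral_prod_mul (fun r : ℝ => r) (fun _ : ℝ => (1:ℝ))]
    rw [← integral_Ioc_eq_integral_Ioo, ← intervalIntegral.integral_of_le (by norm_num), integral_id]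
    simp [ht0.le]
    ring
  rw [hPhi, mul_zero, sub_zero] at key
  have h1 := mul_le_mul_of_nonneg_left har hd.le
  have h2 := mul_le_mul_of_nonneg_left hI (by positivity : 0 ≤ A ^ 2)
  have h3 := mul_le_mul_of_nonneg_right ht2 ht0.le
  have h4 := mul_pos hd ht0
  nlinarith

theorem HMin_zero {l lp lm K : ℝ} (hl : 0 < l) (hl2 : l < 2 * Real.pi) (hlp : 0 ≤ lp) (hlm : 0 ≤ lm) {f : ℝ → ℝ}
    (hf : TLip l K f) (hm : HMin l lp lm f) (θ : ℝ) : f θ = 0 := by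
  by_contra h0
  obtain ⟨k, A, hA, hpl, hfA⟩ := classify hl hl2 hlp hlm hf hm h0
  have main : ∀ (lp lm A : ℝ) (g : ℝ → ℝ), 0 ≤ lp → 0 ≤ lm → 0 < A → TLip l K g → HMin l lp lm g →
      (∀ θ ∈ Icc 0 l, g θ = A * max (Real.cos (θ - l / 2)) 0) → False := by
    intro lp lm A g hlp hlm hA hg hm hgA
    rcases le_or_gt lp (A ^ 2) with h | h
    · exact plane_case1 hl hl2 hpl hlp hlm hA hg hm hgA h
    · exact plane_case2 hl hl2 hpl hlp hlm hA hg hm hgA h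
  rcases lt_or_gt_of_ne hA with h | h
  · refine main lm lp (-A) _ hlm hlp (by linarith) (hf.rot k).neg (hm.rot hl hlp hlm hf k).neg ?_
    intro θ hθ
    simp only [hfA θ hθ]; ring
  · exact main lp lm A _ hlp hlm h (hf.rot k) (hm.rot hl hlp hlm hf k) hfA

end

section

open MeasureTheory Set Filter

lemma final_vertex {l lp lm K : ℝ} (hl0 : 0 < l)
    (hl : l < 2 * Real.pi) (hlp : 0 ≤ lp) (hlm : 0 ≤ lm) (hne : lp ≠ lm)
    {u : ℝ → ℝ → ℝ} (hu : PLip l K u) (hm : PMin l lp lm u) :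
    ∃ ε ∈ Set.Ioo (0:ℝ) 1,
      (∀ r ∈ Set.Icc (0:ℝ) ε, ∀ θ : ℝ, 0 < u r θ) ∨
      (∀ r ∈ Set.Icc (0:ℝ) ε, ∀ θ : ℝ, u r θ < 0) ∨
      (∀ r ∈ Set.Icc (0:ℝ) ε, ∀ θ : ℝ, u r θ = 0) := by
  have hK := hu.K_nonneg
  have hconst : ∀ θ, u 0 θ = u 0 0 := by
    intro θ
    have h := hu.ang 0 θ 0
    simp only [abs_zero, mul_zero, zero_mul] at h
    exact sub_eq_zero.1 (abs_nonpos_iff.1 h)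
  by_cases h0 : u 0 0 = 0
  · have hv : ∀ θ, u 0 θ = 0 := fun θ => (hconst θ).trans h0
    obtain ⟨f, hf, hmf, hfb⟩ := blowup hl0 hlp hlm hu hm hv
    have hf0 := HMin_zero hl0 hl hlp hlm hf hmf
    have hlog : 0 < Real.log 2 := Real.log_pos one_lt_two
    -- choice of the constant
    have hcc : ∀ L : ℝ, 0 < L → 12 * (L / (12 * (K + 1))) * K < L := by
      intro L hL
      have : 12 * (L / (12 * (K + 1))) * K = L * K / (K + 1) := by field_simp
      rw [this, div_lt_iff₀ (by linarith)]
      nlinarith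
    have key : ∀ c : ℝ, 0 < c → ∃ r ∈ Ioo (0:ℝ) 1, ∀ θ, |u r θ| ≤ c * r * Real.log 2 := by
      intro c hc
      obtain ⟨r, hr, h⟩ := hfb (c * Real.log 2) (by positivity)
      refine ⟨r, hr, fun θ => ?_⟩
      have h1 := h θ
      rw [hf0, sub_zero, abs_div, abs_of_pos hr.1, div_le_iff₀ hr.1] at h1
      linarith
    have hvn : ∀ θ, negU u 0 θ = 0 := fun θ => by simp [negU, hv]
    have hmn := PMin.negU hm
    have hun := PLip.negU hu
    rcases hlp.eq_or_lt with hp | hp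
    · have hq : 0 < lm := lt_of_le_of_ne hlm (by rw [hp]; exact hne)
      obtain ⟨r, hr, h⟩ := key (lm / (12 * (K + 1))) (by positivity)
      have h2 := nondeg hl0 hlm hlp hun hmn hvn hr.1 hr.2.le
        (c := lm / (12 * (K + 1))) (by positivity) (hcc lm hq)
        (fun θ => (neg_le_abs (u r θ)).trans (h θ))
      subst hp
      have h3 := mv hl0 hlm hun hmn hvn (by linarith [hr.1, hr.2]) h2
      exact ⟨r / 2, ⟨by linarith [hr.1], by linarith [hr.1, hr.2]⟩, Or.inr (Or.inr fun s hs θ => by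
        have := h3 s hs θ
        simpa [negU] using this)⟩
    rcases hlm.eq_or_lt with hq | hq
    · obtain ⟨r, hr, h⟩ := key (lp / (12 * (K + 1))) (by positivity)
      have h2 := nondeg hl0 hlp hlm hu hm hv hr.1 hr.2.le
        (c := lp / (12 * (K + 1))) (by positivity) (hcc lp hp)
        (fun θ => (le_abs_self (u r θ)).trans (h θ))
      subst hq
      have h3 := mv hl0 hlp hu hm hv (by linarith [hr.1, hr.2]) h2
      exact ⟨r / 2, ⟨by linarith [hr.1], by linarith [hr.1, hr.2]⟩, Or.inr (Or.inr h3)⟩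
    · have hL : 0 < min lp lm := lt_min hp hq
      obtain ⟨r, hr, h⟩ := key (min lp lm / (12 * (K + 1))) (by positivity)
      have h2 := nondeg hl0 hlp hlm hu hm hv hr.1 hr.2.le
        (c := min lp lm / (12 * (K + 1))) (by positivity)
        ((hcc _ hL).trans_le (min_le_left _ _))
        (fun θ => (le_abs_self (u r θ)).trans (h θ))
      have h3 := nondeg hl0 hlm hlp hun hmn hvn hr.1 hr.2.le
        (c := min lp lm / (12 * (K + 1))) (by positivity)
        ((hcc _ hL).trans_le (min_le_right _ _))
        (fun θ => (neg_le_abs (u r θ)).trans (h θ))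
      exact ⟨r / 2, ⟨by linarith [hr.1], by linarith [hr.1, hr.2]⟩, Or.inr (Or.inr fun s hs θ => by
        have h4 := h3 s hs θ
        have h5 := h2 s hs θ
        simp only [negU] at h4
        linarith)⟩
  · have hpos : 0 < |u 0 0| := abs_pos.2 h0
    set ε := min (1 / 2) (|u 0 0| / (2 * (K + 1))) with hε
    have hε0 : 0 < ε := lt_min (by norm_num) (by positivity)
    have hε1 : ε ≤ 1 / 2 := min_le_left _ _
    have hεK : K * ε < |u 0 0| := by
      have h1 : ε ≤ |u 0 0| / (2 * (K + 1)) := min_le_right _ _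
      rw [le_div_iff₀ (by linarith)] at h1
      nlinarith
    have hcl : ∀ r ∈ Icc (0:ℝ) ε, ∀ θ, |u r θ - u 0 0| < |u 0 0| := by
      intro r hr θ
      have h1 := hu.rad r 0 θ
      rw [hconst θ, sub_zero, abs_of_nonneg hr.1] at h1
      have := mul_le_mul_of_nonneg_left hr.2 hK
      linarith
    refine ⟨ε, ⟨hε0, by linarith⟩, ?_⟩
    rcases lt_or_gt_of_ne h0 with h | h
    · refine Or.inr (Or.inl fun r hr θ => ?_)
      have := (abs_lt.1 (hcl r hr θ)).2
      rw [abs_of_neg h] at this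
      linarith
    · refine Or.inl fun r hr θ => ?_
      have := (abs_lt.1 (hcl r hr θ)).1
      rw [abs_of_pos h] at this
      linarith

end

/-- On a cone of length `l < 2π`, the vertex does not belong to the free boundary of a
minimizer of `J(C_1, λ₊, λ₋)`: on some cone ball `C_ε` the minimizer is everywhere
positive, everywhere negative, or identically zero. -/
theorem vertex_not_in_free_boundary (l lp lm : ℝ) (hl0 : 0 < l)
    (hl : l < 2 * Real.pi) (hlp : 0 ≤ lp) (hlm : 0 ≤ lm) (hne : lp ≠ lm)
    (u : ℝ → ℝ → ℝ) (hu : IsMinimizerJ l lp lm 1 u) :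
    ∃ ε ∈ Set.Ioo (0:ℝ) 1,
      (∀ r ∈ Set.Icc (0:ℝ) ε, ∀ θ : ℝ, 0 < u r θ) ∨
      (∀ r ∈ Set.Icc (0:ℝ) ε, ∀ θ : ℝ, u r θ < 0) ∨
      (∀ r ∈ Set.Icc (0:ℝ) ε, ∀ θ : ℝ, u r θ = 0) := by
  obtain ⟨K, hK⟩ := hu.1.exists_PLip
  obtain ⟨ε, hε, h⟩ := final_vertex hl0 hl hlp hlm hne hK (hu.pmin hl0 hl hlp hlm)
  have he : ∀ r ∈ Set.Icc (0:ℝ) ε, ∀ θ : ℝ, clampU u r θ = u r θ :=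
    fun r hr θ => clampU_eq hr.1 (hr.2.trans hε.2.le) θ
  refine ⟨ε, hε, ?_⟩
  rcases h with h | h | h
  · exact Or.inl fun r hr θ => he r hr θ ▸ h r hr θ
  · exact Or.inr (Or.inl fun r hr θ => he r hr θ ▸ h r hr θ)
  · exact Or.inr (Or.inr fun r hr θ => he r hr θ ▸ h r hr θ)
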